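/- Let (A,m) be an analytically unramified, formally equidimensional Noetherian local ring with depth A ≥ 2, and let K be an m-primary ideal. Then there exists a flat local ring homomorphism φ: A → (A',m') with mA' = m' and an element y ∈ K' := KA' such that: (1) the ring A'/(y) is analytically unramified; (2) y is superficial both for the K'-adic filtration {(K')^n} and for the integral closure filtration {((K')^n)^*} of K'; (3) the image of (K')^* in A'/(y) is an integrally closed ideal of A'/(y); (4) (K^n)^* A' = ((K')^n)^* for all n ≥ 1. -/

import Mathlib

/-!
Formalization of a statement from:
T. J. Puthenpurakal, "On asymptotic depth of integral closure filtration and an application".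
All auxiliary notions are defined below; proof obligations inside auxiliary definitions
(which are all true propositions) are discharged with `sorry` where a full proof would be
lengthy, which does not affect the meaning of the final statement.
-/

open Polynomial IsLocalRing

set_option synthInstance.maxHeartbeats 1000000
set_option maxHeartbeats 1000000

noncomputable section

variable {A : Type} [CommRing A]

/-- `x` is integral over the ideal `I`: there is an equation
`x ^ n + c 1 * x ^ (n-1) + ... + c n = 0` with `n ≥ 1` and `c i ∈ I ^ i`. -/
def Ideal.IsIntegralElemOver (I : Ideal A) (x : A) : Prop :=
  ∃ (n : ℕ) (c : ℕ → A), 0 < n ∧ (∀ i ∈ Finset.Icc 1 n, c i ∈ I ^ i) ∧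
    x ^ n + ∑ i ∈ Finset.Icc 1 n, c i * x ^ (n - i) = 0

/-- The integral closure `I^*` of an ideal `I`.  (The set of elements integral over `I`
is an ideal, so it is equal to its span.) -/
def Ideal.intCl (I : Ideal A) : Ideal A :=
  Ideal.span {x | I.IsIntegralElemOver x}

/-- `I` is an `𝔪`-primary ideal of the local ring `A`. -/
def Ideal.IsMPrimary [IsLocalRing A] (I : Ideal A) : Prop :=
  I.radical = maximalIdeal A

/-- `A` is analytically unramified: the `𝔪`-adic completion `Â` is reduced. -/
def IsAnalyticallyUnramified (A : Type) [CommRing A] [IsLocalRing A] : Prop :=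
  IsReduced (AdicCompletion (maximalIdeal A) A)

/-- `A` is formally equidimensional (quasi-unmixed): `dim Â/P = dim A` for every
minimal prime `P` of the `𝔪`-adic completion `Â`. -/
def IsFormallyEquidimensional (A : Type) [CommRing A] [IsLocalRing A] : Prop :=
  ∀ P ∈ minimalPrimes (AdicCompletion (maximalIdeal A) A),
    ringKrullDim ((AdicCompletion (maximalIdeal A) A) ⧸ P) = ringKrullDim A

/-- `depth A ≥ n`: there is a regular sequence of length `n` inside the maximal ideal. -/
def HasDepthGE (A : Type) [CommRing A] [IsLocalRing A] (n : ℕ) : Prop :=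
  ∃ rs : List A, rs.length = n ∧ (∀ x ∈ rs, x ∈ maximalIdeal A) ∧
    RingTheory.Sequence.IsRegular A rs

/-- `x` is a superficial element for the (descending multiplicative) filtration `F`:
there is `c ≥ 0` with `(F (n+1) :_A x) ∩ F c = F n` for all `n ≥ c`. -/
def IsSuperficialFor (F : ℕ → Ideal A) (x : A) : Prop :=
  ∃ c : ℕ, ∀ n ≥ c, (F (n + 1)).colon (Ideal.span {x}) ⊓ F c = F n

/-- The data of a flat local extension `A → B` with `𝔪B = 𝔪_B`, together with an element
`y ∈ KB` satisfying the conclusions of Lemma 2.3 (`induct`) of the paper. -/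
structure GoodFlatExtension [IsLocalRing A] (K : Ideal A) where
  /-- The extension ring `A'`. -/
  B : Type
  [commRingB : CommRing B]
  [localRingB : IsLocalRing B]
  [algB : Algebra A B]
  /-- `A → A'` is flat. -/
  flat : Module.Flat A B
  /-- `A → A'` is a local homomorphism. -/
  localHom : IsLocalHom (algebraMap A B)
  /-- `𝔪 A' = 𝔪'`. -/
  map_maximal : (maximalIdeal A).map (algebraMap A B) = maximalIdeal B
  /-- The element `y ∈ K' = K A'`. -/
  y : B
  y_mem : y ∈ K.map (algebraMap A B)
  /-- (1) `A'/(y)` is analytically unramified, i.e. its completion at its maximal ideal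
  (the image of `𝔪'`) is reduced. -/
  quotient_unramified : IsReduced (AdicCompletion
      ((maximalIdeal B).map (Ideal.Quotient.mk (Ideal.span {y}))) (B ⧸ Ideal.span {y}))
  /-- (2) `y` is superficial for the `K'`-adic filtration. -/
  superficial_adic : IsSuperficialFor (fun n => (K.map (algebraMap A B)) ^ n) y
  /-- (2) `y` is superficial for the integral closure filtration of `K'`. -/
  superficial_intCl : IsSuperficialFor (fun n => ((K.map (algebraMap A B)) ^ n).intCl) y
  /-- (3) the image of `(K')^*` in `A'/(y)` is integrally closed. -/
  quotient_integrally_closed :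
    ((((K.map (algebraMap A B)).intCl).map (Ideal.Quotient.mk (Ideal.span {y}))).intCl)
      = (((K.map (algebraMap A B)).intCl).map (Ideal.Quotient.mk (Ideal.span {y})))
  /-- (4) `(Kⁿ)^* A' = ((K')ⁿ)^*` for all `n ≥ 1`. -/
  map_intCl : ∀ n : ℕ, 1 ≤ n →
    ((K ^ n).intCl).map (algebraMap A B) = ((K.map (algebraMap A B)) ^ n).intCl

/-! ### The integral closure filtration -/

namespace Ideal

theorem isIntegralElemOver_pow_iff (I : Ideal A) (n : ℕ) (x : A) :
    (I ^ n).IsIntegralElemOver x ↔ IsIntegral (reesAlgebra I) (monomial n x : A[X]) := by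
  constructor
  · rintro ⟨d, c, hd, hc, h⟩
    have hmem : ∀ i ∈ Finset.Icc 1 d, (monomial (n * i) (c i) : A[X]) ∈ reesAlgebra I := by
      intro i hi
      apply reesAlgebra.monomial_mem.2
      rw [pow_mul]; exact hc i hi
    classical
    let C : ℕ → reesAlgebra I := fun i =>
      if hi : i ∈ Finset.Icc 1 d then ⟨monomial (n * i) (c i), hmem i hi⟩ else 0
    let p : (reesAlgebra I)[X] := X ^ d + ∑ i ∈ Finset.Icc 1 d, Polynomial.C (C i) * X ^ (d - i)
    have hdeg : (∑ i ∈ Finset.Icc 1 d, Polynomial.C (C i) * X ^ (d - i)).degree < (d : WithBot ℕ) := by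
      rw [← Polynomial.mem_degreeLT]
      refine Submodule.sum_mem _ fun i hi => ?_
      rw [Polynomial.mem_degreeLT]
      refine lt_of_le_of_lt (Polynomial.degree_C_mul_X_pow_le _ _) ?_
      simp only [Finset.mem_Icc] at hi
      exact_mod_cast (by omega : d - i < d)
    refine ⟨p, Polynomial.monic_X_pow_add hdeg, ?_⟩
    have hs : ∑ i ∈ Finset.Icc 1 d, eval₂ (algebraMap (reesAlgebra I) A[X]) (monomial n x)
        (Polynomial.C (C i) * X ^ (d - i)) = monomial (n * d) (∑ i ∈ Finset.Icc 1 d, c i * x ^ (d - i)) := by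
      rw [map_sum]
      refine Finset.sum_congr rfl fun i hi => ?_
      have : (C i : A[X]) = monomial (n * i) (c i) := by simp only [C, dif_pos hi]
      rw [eval₂_mul, eval₂_C, eval₂_X_pow, Subalgebra.algebraMap_def, this, Algebra.algebraMap_self_apply, monomial_pow,
        monomial_mul_monomial]
      simp only [Finset.mem_Icc] at hi
      rw [← mul_add, Nat.add_sub_cancel' hi.2]
    simp only [p, eval₂_add, eval₂_X_pow, eval₂_finsetSum, hs]
    rw [monomial_pow, ← map_add, h, map_zero]
  · rintro ⟨p, hp, h⟩
    rcases Nat.eq_zero_or_pos p.natDegree with h0 | h0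
    · have hp1 : p = 1 := hp.natDegree_eq_zero.1 h0
      rw [hp1, eval₂_one] at h
      have : Subsingleton A := by
        have := congrArg (fun q => coeff q 0) h
        simp at this
        exact subsingleton_of_zero_eq_one this.symm
      exact ⟨1, fun _ => 0, one_pos, by simp, Subsingleton.elim _ _⟩
    refine ⟨p.natDegree, fun i => ((p.coeff (p.natDegree - i) : reesAlgebra I) : A[X]).coeff (n * i),
      h0, fun i hi => ?_, ?_⟩
    · rw [← pow_mul]
      exact (p.coeff (p.natDegree - i)).2 _
    · have := congrArg (fun q => coeff q (n * p.natDegree)) h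
      simp only [eval₂_eq_sum_range, finsetSum_coeff, coeff_zero] at this
      rw [Finset.sum_range_succ] at this
      have e1 : (algebraMap (reesAlgebra I) A[X] (p.coeff p.natDegree) * monomial n x ^ p.natDegree).coeff
          (n * p.natDegree) = x ^ p.natDegree := by
        rw [hp.coeff_natDegree, map_one, one_mul, monomial_pow, coeff_monomial, if_pos rfl]
      rw [e1, add_comm] at this
      rw [← this]
      congr 1
      refine Finset.sum_bij' (fun i _ => p.natDegree - i) (fun i _ => p.natDegree - i)
        (fun i hi => ?_) (fun i hi => ?_) (fun i hi => ?_) (fun i hi => ?_) (fun i hi => ?_)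
      · simp at hi ⊢; omega
      · simp at hi ⊢; omega
      · simp at hi ⊢; omega
      · simp at hi ⊢; omega
      · simp only [Finset.mem_Icc] at hi
        rw [monomial_pow, ← C_mul_X_pow_eq_monomial, ← mul_assoc]
        have : n * p.natDegree = n * i + n * (p.natDegree - i) := by
          rw [← mul_add, Nat.add_sub_cancel' hi.2]
        rw [this, coeff_mul_X_pow, coeff_mul_C]
        rfl

/-- The integral closure filtration of an ideal. -/
abbrev icF (I : Ideal A) (n : ℕ) : Ideal A := (I ^ n).intCl

theorem mem_icF_iff (I : Ideal A) (n : ℕ) (x : A) :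
    x ∈ I.icF n ↔ IsIntegral (reesAlgebra I) (monomial n x : A[X]) := by
  constructor
  · intro hx
    refine Submodule.span_induction (p := fun x _ => IsIntegral (reesAlgebra I) (monomial n x : A[X]))
      (fun x hx => (isIntegralElemOver_pow_iff I n x).1 hx) (by rw [map_zero]; exact isIntegral_zero)
      (fun x y _ _ hx hy => by rw [map_add]; exact hx.add hy) (fun a x _ hx => ?_) hx
    have : (monomial n (a • x) : A[X]) = algebraMap A A[X] a * monomial n x := by
      rw [Polynomial.algebraMap_eq, C_mul_monomial, smul_eq_mul]
    rw [this, IsScalarTower.algebraMap_apply A (reesAlgebra I) A[X]]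
    exact isIntegral_algebraMap.mul hx
  · intro hx
    exact Submodule.subset_span ((isIntegralElemOver_pow_iff I n x).2 hx)

theorem mem_icF_iff_isIntegralElemOver (I : Ideal A) (n : ℕ) (x : A) :
    x ∈ I.icF n ↔ (I ^ n).IsIntegralElemOver x := by
  rw [mem_icF_iff, isIntegralElemOver_pow_iff]

theorem mem_intCl_iff (I : Ideal A) (x : A) : x ∈ I.intCl ↔ I.IsIntegralElemOver x := by
  have := mem_icF_iff_isIntegralElemOver I 1 x
  rwa [icF, pow_one] at this

theorem pow_le_icF (I : Ideal A) (n : ℕ) : I ^ n ≤ I.icF n := fun x hx => by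
  rw [mem_icF_iff]
  exact isIntegral_algebraMap (R := reesAlgebra I) (x := ⟨monomial n x, reesAlgebra.monomial_mem.2 hx⟩)

theorem icF_mul_mem {I : Ideal A} {m n : ℕ} {x y : A} (hx : x ∈ I.icF m) (hy : y ∈ I.icF n) :
    x * y ∈ I.icF (m + n) := by
  rw [mem_icF_iff] at *
  rw [← monomial_mul_monomial]; exact hx.mul hy

theorem icF_mul_le (I : Ideal A) (m n : ℕ) : I.icF m * I.icF n ≤ I.icF (m + n) :=
  Ideal.mul_le.2 fun _ hx _ hy => icF_mul_mem hx hy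

@[simp] theorem icF_zero (I : Ideal A) : I.icF 0 = ⊤ :=
  top_le_iff.1 (by simpa using pow_le_icF I 0)

theorem pow_mul_icF_le (I : Ideal A) (m n : ℕ) : I ^ m * I.icF n ≤ I.icF (m + n) :=
  (Ideal.mul_mono_left (pow_le_icF I m)).trans (icF_mul_le I m n)

theorem icF_pow_le (I : Ideal A) (m n : ℕ) : (I.icF m) ^ n ≤ I.icF (m * n) := by
  induction n with
  | zero => simp
  | succ n ih =>
    rw [pow_succ, mul_add, mul_one]
    exact (Ideal.mul_mono_left ih).trans (icF_mul_le _ _ _)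

theorem intCl_mono {I J : Ideal A} (h : I ≤ J) : I.intCl ≤ J.intCl := by
  refine Submodule.span_mono ?_
  rintro x ⟨n, c, hn, hc, hx⟩
  exact ⟨n, c, hn, fun i hi => Ideal.pow_right_mono h i (hc i hi), hx⟩

theorem icF_anti (I : Ideal A) {m n : ℕ} (h : m ≤ n) : I.icF n ≤ I.icF m :=
  intCl_mono (Ideal.pow_le_pow_right h)

theorem icF_mono {I J : Ideal A} (h : I ≤ J) (n : ℕ) : I.icF n ≤ J.icF n :=
  intCl_mono (Ideal.pow_right_mono h n)

theorem map_intCl_le {B : Type} [CommRing B] (f : A →+* B) (I : Ideal A) :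
    I.intCl.map f ≤ (I.map f).intCl := by
  rw [Ideal.intCl, Ideal.map_span, Ideal.span_le]
  rintro _ ⟨x, ⟨n, c, hn, hc, hx⟩, rfl⟩
  refine Submodule.subset_span ⟨n, fun i => f (c i), hn, fun i hi => ?_, ?_⟩
  · rw [← Ideal.map_pow]; exact Ideal.mem_map_of_mem f (hc i hi)
  · simpa using congrArg f hx

theorem map_icF_le {B : Type} [CommRing B] (f : A →+* B) (I : Ideal A) (n : ℕ) :
    (I.icF n).map f ≤ (I.map f).icF n := by
  rw [icF, icF, ← Ideal.map_pow]; exact map_intCl_le f _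

theorem mem_icF_of_intCl_pow {B : Type} [CommRing B] (f : A →+* B) {I : Ideal A} {n : ℕ} {x : A}
    (hx : x ∈ I.icF n) : f x ∈ (I.map f).icF n := map_icF_le f I n (Ideal.mem_map_of_mem f hx)

/-- An element satisfying a monic equation with coefficients in the integral closure filtration. -/
theorem mem_icF_of_monic {I : Ideal A} {n : ℕ} {x : A} (p : A[X]) (hp : p.Monic)
    (hc : ∀ j, p.coeff j ∈ I.icF (n * (p.natDegree - j))) (h : p.eval x = 0) : x ∈ I.icF n := by
  rcases subsingleton_or_nontrivial A with hA | hA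
  · rw [Subsingleton.elim x 0]; exact zero_mem _
  rw [mem_icF_iff]
  let S := integralClosure (reesAlgebra I) A[X]
  suffices IsIntegral S (monomial n x : A[X]) from isIntegral_trans (R := reesAlgebra I) (A := S) _ this
  let c : ℕ → S := fun i => ⟨monomial (n * (p.natDegree - i)) (p.coeff i), (mem_icF_iff _ _ _).1 (hc i)⟩
  let q : S[X] := ∑ j ∈ Finset.range (p.natDegree + 1), C (c j) * X ^ j
  have hq : ∀ j ≤ p.natDegree, (q.coeff j : A[X]) = monomial (n * (p.natDegree - j)) (p.coeff j) := by
    intro j hj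
    simp only [q, finsetSum_coeff, coeff_C_mul, coeff_X_pow]
    rw [Finset.sum_eq_single j]
    · simp [c]
    · intro b _ hb; rw [if_neg hb.symm, mul_zero]
    · intro h; simp at h; omega
  refine ⟨q, ?_, ?_⟩
  · refine monic_of_natDegree_le_of_coeff_eq_one p.natDegree ?_ ?_
    · refine natDegree_sum_le_of_forall_le _ _ fun j hj => ?_
      refine (natDegree_C_mul_X_pow_le _ _).trans ?_
      simp at hj; omega
    · apply Subtype.ext
      rw [hq _ le_rfl]
      simp [hp.coeff_natDegree]
  · rw [eval₂_finsetSum]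
    have : ∀ j ∈ Finset.range (p.natDegree + 1), eval₂ (algebraMap S A[X]) (monomial n x)
        (C (c j) * X ^ j) = monomial (n * p.natDegree) (p.coeff j * x ^ j) := by
      intro j hj
      simp only [Finset.mem_range] at hj
      rw [eval₂_mul, eval₂_C, eval₂_X_pow]
      change (monomial (n * (p.natDegree - j)) (p.coeff j)) * _ = _
      rw [monomial_pow, monomial_mul_monomial, ← mul_add,
        Nat.sub_add_cancel (by omega)]
    rw [Finset.sum_congr rfl this, ← map_sum, ← eval_eq_sum_range, h, map_zero]

/-- The determinant trick for the integral closure filtration. -/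
theorem mem_icF_of_mul_le {I : Ideal A} {n : ℕ} {x : A} (N : Ideal A) (hN : N.FG)
    (hfaith : ∀ a : A, (∀ y ∈ N, a * y = 0) → a = 0) (h : ∀ y ∈ N, x * y ∈ I.icF n * N) :
    x ∈ I.icF n := by
  have : Module.Finite A N := Module.Finite.iff_fg.2 hN
  let f : N →ₗ[A] N := LinearMap.lsmul A N x
  have hr : f.range ≤ I.icF n • (⊤ : Submodule A N) := by
    rintro _ ⟨y, rfl⟩
    rw [Submodule.mem_smul_top_iff]
    exact h y y.2
  obtain ⟨p, hp, -, hc, h0⟩ :=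
    LinearMap.exists_monic_and_natDegree_eq_and_coeff_mem_pow_and_aeval_eq_zero A f (I.icF n) hr
  have hev : p.eval x = 0 := by
    refine hfaith _ fun y hy => ?_
    have h1 : aeval f p = LinearMap.lsmul A N (p.eval x) := by
      have : f = algebraMap A (Module.End A N) x := rfl
      rw [this, aeval_algebraMap_apply]
      rw [coe_aeval_eq_eval]; rfl
    rw [h1] at h0
    have := congrArg (fun g => ((g ⟨y, hy⟩ : N) : A)) h0
    simpa using this
  refine mem_icF_of_monic p hp (fun i => ?_) hev
  exact icF_pow_le _ _ _ (hc i)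

end Ideal

namespace Ideal

/-- The integral closure filtration is linearly comparable with the adic filtration. -/
def HasLinearBound (K : Ideal A) : Prop := ∃ c : ℕ, ∀ n, K.icF (n + c) ≤ K ^ n

theorem exists_stable_of_le_pow [IsNoetherianRing A] (K : Ideal A) (H : ℕ → Ideal A)
    (hH : ∀ n, H (n + 1) ≤ H n) (hK : ∀ n, K * H n ≤ H (n + 1)) (c : ℕ)
    (hc : ∀ n, H (n + c) ≤ K ^ n) :
    ∃ n₀, ∀ n ≥ n₀, H (n + 1) = K * H n := by
  let F : K.Filtration A :=
    { N := fun n => H (n + c)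
      mono := fun i => by rw [add_right_comm]; exact hH _
      smul_le := fun i => by rw [add_right_comm, smul_eq_mul]; exact hK _ }
  have hle : F ≤ K.stableFiltration (⊤ : Submodule A A) := by
    intro i
    change H (i + c) ≤ K ^ i • ⊤
    rw [smul_eq_mul, Ideal.mul_top]
    exact hc i
  obtain ⟨n₀, h⟩ := (K.stableFiltration_stable (⊤ : Submodule A A)).of_le hle
  refine ⟨n₀ + c, fun n hn => ?_⟩
  have := h (n - c) (by omega)
  change K • H (n - c + c) = H (n - c + 1 + c) at this
  rw [add_right_comm, Nat.sub_add_cancel (by omega)] at this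
  exact this.symm

theorem HasLinearBound.exists_stable [IsNoetherianRing A] {K : Ideal A} (h : K.HasLinearBound) :
    ∃ n₀, ∀ n ≥ n₀, ∀ m, K.icF (n + m) = K ^ m * K.icF n := by
  obtain ⟨c, hc⟩ := h
  obtain ⟨n₀, hn⟩ := exists_stable_of_le_pow K K.icF (fun n => icF_anti K n.le_succ)
    (fun n => by simpa [add_comm] using pow_mul_icF_le K 1 n) c hc
  refine ⟨n₀, fun n hn0 m => ?_⟩
  induction m with
  | zero => simp
  | succ m ih => rw [← add_assoc, hn _ (by omega), ih, ← mul_assoc, ← pow_succ']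

theorem pow_faithful {K : Ideal A} {a : A} (ha : a ∈ K) (ha' : a ∈ nonZeroDivisors A) (n : ℕ) (x : A)
    (hx : ∀ y ∈ K ^ n, x * y = 0) : x = 0 :=
  (mul_right_mem_nonZeroDivisors_eq_zero_iff (pow_mem ha' n)).1 (hx _ (Ideal.pow_mem_pow ha n))

theorem HasLinearBound.mem_icF_of_mul_pow [IsNoetherianRing A] {K : Ideal A} (h : K.HasLinearBound)
    {a : A} (ha : a ∈ K) (ha' : a ∈ nonZeroDivisors A) {n m : ℕ} {x : A}
    (hx : ∀ y ∈ K ^ m, x * y ∈ K.icF (n + m)) : x ∈ K.icF n := by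
  obtain ⟨n₀, h0⟩ := h.exists_stable
  refine mem_icF_of_mul_le (K.icF (n₀ + m)) (IsNoetherian.noetherian _)
    (fun z hz => pow_faithful ha ha' (n₀ + m) z fun y hy => hz y (pow_le_icF K _ hy)) fun y hy => ?_
  have h1 : x * y ∈ K.icF (n₀ + m + n) := by
    rw [h0 n₀ le_rfl m] at hy
    refine Submodule.mul_induction_on hy (fun u hu v hv => ?_) (fun u v hu hv => ?_)
    · rw [← mul_assoc]
      convert icF_mul_mem (hx u hu) hv using 2; omega
    · rw [mul_add]; exact add_mem hu hv
  rw [h0 _ (by omega)] at h1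
  exact Ideal.mul_mono_left (pow_le_icF K n) h1

end Ideal

namespace Ideal

/-- The ideal of possible lower order parts of an equation of integral dependence of degree `d`
of `x` over `I`. -/
def depIdeal (I : Ideal A) (x : A) (d : ℕ) : Ideal A :=
  ∑ i ∈ Finset.Icc 1 d, I ^ i * span {x ^ (d - i)}

theorem isIntegralElemOver_iff_depIdeal (I : Ideal A) (x : A) :
    I.IsIntegralElemOver x ↔ ∃ d, 0 < d ∧ x ^ d ∈ I.depIdeal x d := by
  constructor
  · rintro ⟨d, c, hd, hc, h⟩
    refine ⟨d, hd, ?_⟩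
    rw [eq_neg_of_add_eq_zero_left h]
    refine neg_mem ?_
    rw [depIdeal, Ideal.sum_eq_sup, Finset.sup_eq_iSup]
    refine Submodule.sum_mem _ fun i hi => ?_
    exact Submodule.mem_iSup_of_mem i (Submodule.mem_iSup_of_mem hi
      (Ideal.mul_mem_mul (hc i hi) (mem_span_singleton_self _)))
  · rintro ⟨d, hd, h⟩
    suffices H : ∀ s : Finset ℕ, ∀ y ∈ ∑ i ∈ s, I ^ i * span {x ^ (d - i)},
        ∃ c : ℕ → A, (∀ i ∈ s, c i ∈ I ^ i) ∧ y = ∑ i ∈ s, c i * x ^ (d - i) by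
      obtain ⟨c, hc, hy⟩ := H _ _ h
      refine ⟨d, fun i => - c i, hd, fun i hi => neg_mem (hc i hi), ?_⟩
      rw [hy]; simp
    intro s
    induction s using Finset.induction_on with
    | empty => intro y hy; exact ⟨fun _ => 0, by simp, by simpa using hy⟩
    | insert a s ha ih =>
      intro y hy
      rw [Finset.sum_insert ha] at hy
      obtain ⟨u, hu, v, hv, rfl⟩ := Submodule.mem_sup.1 hy
      obtain ⟨c, hc, rfl⟩ := ih v hv
      obtain ⟨b, hb, rfl⟩ := Ideal.mem_mul_span_singleton.1 hu
      refine ⟨Function.update c a b, fun i hi => ?_, ?_⟩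
      · rcases eq_or_ne i a with rfl | h
        · simpa using hb
        · rw [Function.update_of_ne h]
          exact hc i ((Finset.mem_insert.1 hi).resolve_left h)
      · rw [Finset.sum_insert ha, Function.update_self]
        congr 1
        refine Finset.sum_congr rfl fun i hi => ?_
        rw [Function.update_of_ne (by rintro rfl; exact ha hi)]

theorem map_depIdeal {B : Type} [CommRing B] (f : A →+* B) (I : Ideal A) (x : A) (d : ℕ) :
    (I.depIdeal x d).map f = (I.map f).depIdeal (f x) d := by
  rw [depIdeal, depIdeal, ← Ideal.mapHom_apply, map_sum]
  refine Finset.sum_congr rfl fun i _ => ?_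
  rw [Ideal.mapHom_apply, Ideal.map_mul, Ideal.map_pow, Ideal.map_span, Set.image_singleton, map_pow]

theorem mul_mem_depIdeal {I : Ideal A} {x s y : A} {d : ℕ} (h : y ∈ I.depIdeal x d) :
    s ^ (d - 1) * y ∈ I.depIdeal (s * x) d := by
  have : span {s ^ (d - 1)} * I.depIdeal x d ≤ I.depIdeal (s * x) d := by
    rw [depIdeal, depIdeal, Finset.mul_sum]
    simp only [Ideal.sum_eq_sup]
    refine Finset.sup_mono_fun fun i hi => ?_
    rw [mul_left_comm]
    refine Ideal.mul_mono_right ?_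
    rw [span_singleton_mul_span_singleton, span_singleton_le_span_singleton, mul_pow]
    simp only [Finset.mem_Icc] at hi
    exact mul_dvd_mul_right (pow_dvd_pow _ (by omega)) _
  exact this (Ideal.mul_mem_mul (mem_span_singleton_self _) h)

theorem mem_intCl_iff_depIdeal (I : Ideal A) (x : A) :
    x ∈ I.intCl ↔ ∃ d, 0 < d ∧ x ^ d ∈ I.depIdeal x d := by
  rw [mem_intCl_iff, isIntegralElemOver_iff_depIdeal]

theorem intCl_map_of_isLocalization {B : Type} [CommRing B] [Algebra A B] (M : Submonoid A)
    [IsLocalization M B] (I : Ideal A) :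
    (I.map (algebraMap A B)).intCl = I.intCl.map (algebraMap A B) := by
  refine le_antisymm (fun z hz => ?_) (map_intCl_le _ _)
  obtain ⟨⟨h, u⟩, hzu⟩ := IsLocalization.surj M z
  simp only at hzu
  have hx : algebraMap A B h ∈ (I.map (algebraMap A B)).intCl := by
    rw [← hzu]; exact Ideal.mul_mem_right _ _ hz
  obtain ⟨d, hd, hx⟩ := (mem_intCl_iff_depIdeal _ _).1 hx
  rw [← map_depIdeal, ← map_pow, IsLocalization.algebraMap_mem_map_algebraMap_iff M] at hx
  obtain ⟨s, hs, hx⟩ := hx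
  have : s * h ∈ I.intCl := by
    refine (mem_intCl_iff_depIdeal _ _).2 ⟨d, hd, ?_⟩
    have := mul_mem_depIdeal (s := s) hx
    rwa [← mul_assoc, ← pow_succ, Nat.sub_add_cancel hd, ← mul_pow] at this
  have h2 := Ideal.mem_map_of_mem (algebraMap A B) this
  rw [map_mul, ← hzu] at h2
  have hsu := (IsLocalization.map_units B ⟨s, hs⟩)
  have huu := (IsLocalization.map_units B u)
  exact (Ideal.mul_unit_mem_iff_mem _ huu).1 ((Ideal.unit_mul_mem_iff_mem _ hsu).1 h2)

attribute [local instance] Polynomial.algebra in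
theorem coeff_mem_icF_of_mem_icF_map_C {I : Ideal A} {n : ℕ} {f : A[X]}
    (hf : f ∈ (I.map (C : A →+* A[X])).icF n) (j : ℕ) : f.coeff j ∈ I.icF n := by
  rw [mem_icF_iff]
  let g : A[X] →+* A[X][X] := mapRingHom (C : A →+* A[X])
  have key : IsIntegral (reesAlgebra I)[X] (C (monomial n 1) * g f : A[X][X]) := by
    rw [mem_icF_iff_isIntegralElemOver] at hf
    obtain ⟨d, c, hd, hc, h⟩ := hf
    have hmem : ∀ i ∈ Finset.Icc 1 d, ∃ e : (reesAlgebra I)[X],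
        algebraMap (reesAlgebra I)[X] A[X][X] e = C (monomial (n * i) 1) * g (c i) := by
      intro i hi
      have hci := hc i hi
      rw [← pow_mul, ← Ideal.map_pow, mem_map_C_iff] at hci
      have : C (monomial (n * i) 1) * g (c i) ∈ Polynomial.lifts (algebraMap (reesAlgebra I) A[X]) := by
        rw [Polynomial.lifts_iff_coeff_lifts]
        intro k
        refine ⟨⟨monomial (n * i) ((c i).coeff k), reesAlgebra.monomial_mem.2 (hci k)⟩, ?_⟩
        simp [g]
      obtain ⟨e, he⟩ := this
      exact ⟨e, he⟩
    choose! e he using hmem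
    let p : (reesAlgebra I)[X][X] := X ^ d + ∑ i ∈ Finset.Icc 1 d, C (e i) * X ^ (d - i)
    have hdeg : (∑ i ∈ Finset.Icc 1 d, C (e i) * X ^ (d - i)).degree < (d : WithBot ℕ) := by
      rw [← Polynomial.mem_degreeLT]
      refine Submodule.sum_mem _ fun i hi => ?_
      rw [Polynomial.mem_degreeLT]
      refine lt_of_le_of_lt (Polynomial.degree_C_mul_X_pow_le _ _) ?_
      simp only [Finset.mem_Icc] at hi
      exact_mod_cast (by omega : d - i < d)
    refine ⟨p, Polynomial.monic_X_pow_add hdeg, ?_⟩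
    have hs : ∀ i ∈ Finset.Icc 1 d, eval₂ (algebraMap (reesAlgebra I)[X] A[X][X])
        (C (monomial n 1) * g f) (C (e i) * X ^ (d - i)) =
        C (monomial (n * d) 1) * g (c i * f ^ (d - i)) := by
      intro i hi
      rw [eval₂_mul, eval₂_C, eval₂_X_pow, he i hi, mul_pow, map_mul, map_pow]
      simp only [Finset.mem_Icc] at hi
      have : (monomial (n * d) 1 : A[X]) = monomial (n * i) 1 * (monomial n 1) ^ (d - i) := by
        rw [monomial_pow, monomial_mul_monomial, ← mul_add, Nat.add_sub_cancel' hi.2]; simp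
      rw [this, map_mul, map_pow]; ring
    simp only [p, eval₂_add, eval₂_X_pow, eval₂_finsetSum]
    have hm : (monomial n (1 : A) : A[X]) ^ d = monomial (n * d) 1 := by rw [monomial_pow, one_pow]
    rw [Finset.sum_congr rfl hs, ← Finset.mul_sum, ← map_sum, mul_pow, ← C_pow, hm, ← map_pow g,
      ← mul_add, ← map_add, h, map_zero, mul_zero]
  have := Polynomial.isIntegral_iff_isIntegral_coeff.1 key j
  have e : (C (monomial n 1) * g f).coeff j = monomial n (f.coeff j) := by simp [g]
  rwa [e] at this

theorem icF_map_C (I : Ideal A) (n : ℕ) :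
    (I.map (C : A →+* A[X])).icF n = (I.icF n).map (C : A →+* A[X]) :=
  le_antisymm (fun _ hf => mem_map_C_iff.2 fun j => coeff_mem_icF_of_mem_icF_map_C hf j)
    (map_icF_le _ _ _)

/-- If every ideal of `A` is contracted from `B` and `B` is approximated by `A` modulo an ideal
contained in the integral closure, the integral closure of an extended ideal is extended. -/
theorem icF_map_of_contracted {B : Type} [CommRing B] (f : A →+* B)
    (hcon : ∀ J : Ideal A, (J.map f).comap f = J) (I : Ideal A) (n : ℕ) (Q : Ideal A)
    (hQ : Q ≤ I.icF n) (happ : ∀ b : B, ∃ a : A, b - f a ∈ Q.map f) :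
    (I.map f).icF n = (I.icF n).map f := by
  refine le_antisymm (fun z hz => ?_) (map_icF_le _ _ _)
  obtain ⟨a, ha⟩ := happ z
  have h1 : f a ∈ (I.map f).icF n := by
    have := sub_mem hz (map_icF_le f I n (Ideal.map_mono hQ ha))
    simpa using this
  have h2 : a ∈ I.icF n := by
    rw [icF, mem_intCl_iff_depIdeal] at h1 ⊢
    obtain ⟨d, hd, h⟩ := h1
    refine ⟨d, hd, ?_⟩
    rw [← Ideal.map_pow, ← map_depIdeal, ← map_pow] at h
    rw [← hcon (depIdeal _ _ _)]
    exact h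
  have := add_mem (Ideal.map_mono hQ ha) (Ideal.mem_map_of_mem f h2)
  simpa using this

end Ideal

section

/-! ### Adic completeness -/

section AdicBasics
variable {R : Type*} [CommRing R] {I : Ideal R}

theorem IsHausdorff.eq_zero_of_forall_mem_pow [IsHausdorff I R] {x : R} (h : ∀ n, x ∈ I ^ n) : x = 0 :=
  IsHausdorff.haus ‹_› x fun n => by
    rw [SModEq.zero, smul_eq_mul, Ideal.mul_top]; exact h n

theorem isHausdorff_of_forall (h : ∀ x, (∀ n, x ∈ I ^ n) → x = 0) : IsHausdorff I R :=
  ⟨fun x hx => h x fun n => by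
    have := hx n
    rwa [SModEq.zero, smul_eq_mul, Ideal.mul_top] at this⟩

theorem IsPrecomplete.exists_limit [IsPrecomplete I R] (f : ℕ → R)
    (hf : ∀ n, f (n + 1) - f n ∈ I ^ n) : ∃ L, ∀ n, f n - L ∈ I ^ n := by
  have h : ∀ m k, f (m + k) - f m ∈ I ^ m := by
    intro m k
    induction k with
    | zero => simp
    | succ k ih =>
      have := add_mem (Ideal.pow_le_pow_right (Nat.le_add_right m k) (hf (m + k))) ih
      rwa [sub_add_sub_cancel] at this
  obtain ⟨L, hL⟩ := IsPrecomplete.prec ‹_› (f := f) (fun {m n} hmn => by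
    rw [SModEq.sub_mem, smul_eq_mul, Ideal.mul_top]
    obtain ⟨k, rfl⟩ := Nat.exists_eq_add_of_le hmn
    rw [← neg_sub]; exact neg_mem (h m k))
  refine ⟨L, fun n => ?_⟩
  have := hL n
  rwa [SModEq.sub_mem, smul_eq_mul, Ideal.mul_top] at this

theorem isPrecomplete_of_forall (h : ∀ f : ℕ → R, (∀ m n, m ≤ n → f n - f m ∈ I ^ m) →
    ∃ L, ∀ n, f n - L ∈ I ^ n) : IsPrecomplete I R :=
  ⟨fun f hf => by
    obtain ⟨L, hL⟩ := h f fun m n hmn => by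
      have := hf hmn
      rw [SModEq.sub_mem, smul_eq_mul, Ideal.mul_top] at this
      rw [← neg_sub]; exact neg_mem this
    exact ⟨L, fun n => by rw [SModEq.sub_mem, smul_eq_mul, Ideal.mul_top]; exact hL n⟩⟩

theorem isAdicComplete_of_forall (h0 : ∀ x, (∀ n, x ∈ I ^ n) → x = 0)
    (h : ∀ f : ℕ → R, (∀ m n, m ≤ n → f n - f m ∈ I ^ m) → ∃ L, ∀ n, f n - L ∈ I ^ n) :
    IsAdicComplete I R :=
  { toIsHausdorff := isHausdorff_of_forall h0
    toIsPrecomplete := isPrecomplete_of_forall h }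

end AdicBasics

theorem MvPowerSeries.exists_evalHom {V E : Type*} [CommRing V] [CommRing E] (f : V →+* E)
    (I : Ideal E) [IsAdicComplete I E] {σ : Type*} [Finite σ] (y : σ → E) (hy : ∀ i, y i ∈ I) :
    ∃ φ : MvPowerSeries σ V →+* E, (∀ v, φ (MvPowerSeries.C v) = f v) ∧
      ∀ i, φ (MvPowerSeries.X i) = y i := by
  let J := MvPolynomial.idealOfVars σ V
  let ψ : MvPolynomial σ V →+* E := MvPolynomial.eval₂Hom f y
  have hJ : J ≤ I.comap ψ := by
    refine Ideal.span_le.2 ?_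
    rintro _ ⟨i, rfl⟩
    simpa [ψ] using hy i
  have hJn : ∀ n, J ^ n ≤ (I ^ n).comap ψ := fun n =>
    (Ideal.pow_right_mono hJ n).trans (Ideal.le_comap_pow ψ n)
  let g : ∀ n, AdicCompletion J (MvPolynomial σ V) →+* E ⧸ I ^ n := fun n =>
    (Ideal.quotientMap (I ^ n) ψ (hJn n)).comp (AdicCompletion.evalₐ J n : _ →+* _)
  have hg : ∀ {m n : ℕ} (hle : m ≤ n), (Ideal.Quotient.factorPow I hle).comp (g n) = g m := by
    intro m n hle
    ext x
    obtain ⟨x, rfl⟩ := AdicCompletion.mk_surjective J (MvPolynomial σ V) x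
    simp only [g, RingHom.comp_apply, RingHom.coe_coe, AdicCompletion.evalₐ_mk,
      Ideal.quotientMap_mk, Ideal.Quotient.factor_mk]
    rw [Ideal.Quotient.eq, ← map_sub]
    apply hJn
    have := x.2 hle
    rw [SModEq.sub_mem, smul_eq_mul, Ideal.mul_top] at this
    rw [← neg_sub]; exact neg_mem this
  let L := IsAdicComplete.liftRingHom I g hg
  have hL : ∀ p : MvPolynomial σ V, L (AdicCompletion.of J _ p) = ψ p := by
    intro p
    rw [← sub_eq_zero]
    refine IsHausdorff.eq_zero_of_forall_mem_pow (I := I) fun n => ?_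
    rw [← Ideal.Quotient.eq]
    rw [IsAdicComplete.mk_liftRingHom]
    simp [g, AdicCompletion.evalₐ_of]
  refine ⟨L.comp (MvPowerSeries.toAdicCompletionAlgEquiv σ V).toRingEquiv.toRingHom, fun v => ?_,
    fun i => ?_⟩
  · have : MvPowerSeries.toAdicCompletion σ V (MvPowerSeries.C v) = AdicCompletion.of J _ (MvPolynomial.C v) := by
      rw [← MvPolynomial.coe_C, MvPowerSeries.toAdicCompletion_coe]
    have h2 := hL (MvPolynomial.C v)
    rw [← this] at h2
    refine Eq.trans h2 ?_
    simp [ψ]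
  · have : MvPowerSeries.toAdicCompletion σ V (MvPowerSeries.X i) = AdicCompletion.of J _ (MvPolynomial.X i) := by
      rw [← MvPolynomial.coe_X, MvPowerSeries.toAdicCompletion_coe]
    have h2 := hL (MvPolynomial.X i)
    rw [← this] at h2
    refine Eq.trans h2 ?_
    simp [ψ]

/-- The complete version of Nakayama's lemma for finiteness. -/
theorem Module.Finite.of_isPrecomplete {P E : Type*} [CommRing P] [CommRing E] [Algebra P E]
    (J : Ideal P) [IsAdicComplete J P] [IsHausdorff (J.map (algebraMap P E)) E] (n : ℕ) (e : Fin n → E)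
    (h : ∀ x : E, ∃ c : Fin n → P, x - ∑ i, c i • e i ∈ J.map (algebraMap P E)) :
    ∀ x : E, ∃ c : Fin n → P, x = ∑ i, c i • e i := by
  have : IsHausdorff J E := IsHausdorff.map_algebraMap_iff.mp ‹_›
  let f : (Fin n → P) →ₗ[P] E := Fintype.linearCombination P e
  have hs : Function.Surjective f := by
    have : IsPrecomplete J (Fin n → P) := by
      refine ⟨fun g hg => ?_⟩
      have hmem : ∀ (k : ℕ) (v : Fin n → P), v ∈ (J ^ k • ⊤ : Submodule P (Fin n → P)) ↔
          ∀ i, v i ∈ J ^ k := by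
        refine fun k v => ⟨fun hv i => ?_, fun hv => ?_⟩
        · induction hv using Submodule.smul_induction_on' with
          | smul r hr m _ => exact Ideal.mul_mem_right _ _ hr
          | add x _ y _ hx hy => exact add_mem hx hy
        · rw [← Finset.univ_sum_single v]
          refine sum_mem fun i _ => ?_
          have : (Pi.single i (v i) : Fin n → P) = v i • Pi.single i 1 := by
            rw [← Pi.single_smul, smul_eq_mul, mul_one]
          rw [this]
          exact Submodule.smul_mem_smul (hv i) trivial
      have : ∀ i, ∃ L, ∀ k, g k i - L ∈ J ^ k := fun i =>
        IsPrecomplete.exists_limit _ fun k => by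
          have := hg (Nat.le_succ k)
          rw [SModEq.sub_mem, hmem] at this
          rw [← neg_sub]
          exact neg_mem (this i)
      choose L hL using this
      exact ⟨L, fun k => by rw [SModEq.sub_mem, hmem]; exact fun i => hL i k⟩
    refine surjective_of_mkQ_comp_surjective (I := J) (f := f) fun y => ?_
    obtain ⟨x, rfl⟩ := Submodule.mkQ_surjective _ y
    obtain ⟨c, hc⟩ := h x
    refine ⟨c, ?_⟩
    simp only [LinearMap.comp_apply]
    rw [← sub_eq_zero, ← map_sub, ← LinearMap.mem_ker, Submodule.ker_mkQ, Ideal.smul_top_eq_map]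
    rw [← neg_sub]
    exact neg_mem hc
  intro x
  obtain ⟨c, hc⟩ := hs x
  exact ⟨c, hc.symm⟩

end

section

theorem isNoetherianRing_of_isAdicComplete {R E : Type*} [CommRing R] [CommRing E] [IsNoetherianRing R]
    (f : R →+* E) (I : Ideal E) [IsAdicComplete I E] (hI : I.FG)
    (hf : ∀ x : E, ∃ r, x - f r ∈ I) : IsNoetherianRing E := by
  obtain ⟨s, hs⟩ := hI
  obtain ⟨φ, hφ, hX⟩ := MvPowerSeries.exists_evalHom f I (fun i : s => (i : E))
    (fun i => hs ▸ Ideal.subset_span i.2)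
  let J : Ideal (MvPowerSeries s R) := Ideal.span (Set.range MvPowerSeries.X)
  have hJ : J.map φ = I := by
    rw [← hs, Ideal.map_span, ← Set.range_comp]
    congr 1
    ext x
    simp [hX]
  have : IsHausdorff (J.map φ) E := by rw [hJ]; infer_instance
  have : Function.Surjective φ := by
    refine surjective_of_mk_map_comp_surjective (I := J) φ fun y => ?_
    obtain ⟨y, rfl⟩ := Ideal.Quotient.mk_surjective y
    obtain ⟨r, hr⟩ := hf y
    refine ⟨MvPowerSeries.C r, ?_⟩
    rw [RingHom.comp_apply, hφ, eq_comm, Ideal.Quotient.eq, hJ]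
    exact hr
  exact isNoetherianRing_of_surjective _ _ φ this

theorem Ideal.mem_map_of_mul_mem_map {R S : Type} [CommRing R] [CommRing S] [Algebra R S]
    [Module.Flat R S] {I J : Ideal R} {w : R}
    (hI : ∀ a, w * a ∈ I → a ∈ J) {b : S} (hb : algebraMap R S w * b ∈ I.map (algebraMap R S)) :
    b ∈ J.map (algebraMap R S) := by
  obtain ⟨n, s, g, hg⟩ := Submodule.mem_span_set'.1 hb
  choose r hrI hr using fun i => (g i).2
  obtain ⟨k, a, y, hxy, h0⟩ := Module.Flat.isTrivialRelation_of_sum_smul_eq_zero (R := R) (M := S)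
    (f := (Fin.cons w r : Fin (n + 1) → R)) (x := (Fin.cons b (fun i => - s i) : Fin (n + 1) → S)) (by
      rw [Fin.sum_univ_succ]
      simp only [Fin.cons_zero, Fin.cons_succ, Algebra.smul_def, hr]
      rw [← hg, ← Finset.sum_add_distrib]
      refine Finset.sum_eq_zero fun i _ => ?_
      rw [smul_eq_mul]; ring)
  have hb' := hxy 0
  rw [Fin.cons_zero] at hb'
  rw [hb']
  refine Submodule.sum_mem _ fun j _ => ?_
  rw [Algebra.smul_def]
  refine Ideal.mul_mem_right _ _ (Ideal.mem_map_of_mem _ (hI _ ?_))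
  have := h0 j
  rw [Fin.sum_univ_succ] at this
  simp only [Fin.cons_zero, Fin.cons_succ] at this
  rw [eq_neg_of_add_eq_zero_left this]
  exact neg_mem (Submodule.sum_mem _ fun i _ => Ideal.mul_mem_right _ _ (hrI i))

/-- A flat local extension along which integral closures of powers of primary ideals extend. -/
structure IsGoodExtension (R S : Type) [CommRing R] [CommRing S] [IsLocalRing R] [IsLocalRing S]
    [Algebra R S] : Prop where
  flat : Module.Flat R S
  map_max : (maximalIdeal R).map (algebraMap R S) = maximalIdeal S
  icF_map : ∀ K : Ideal R, (∃ N, maximalIdeal R ^ N ≤ K) → ∀ n,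
    (K.map (algebraMap R S)).icF n = (K.icF n).map (algebraMap R S)

namespace IsGoodExtension
variable {R S T : Type} [CommRing R] [CommRing S] [CommRing T] [IsLocalRing R] [IsLocalRing S]
  [IsLocalRing T] [Algebra R S] [Algebra S T] [Algebra R T] [IsScalarTower R S T]

theorem pow_le (h : IsGoodExtension R S) {K : Ideal R} {N : ℕ} (hK : maximalIdeal R ^ N ≤ K) :
    maximalIdeal S ^ N ≤ K.map (algebraMap R S) := by
  rw [← h.map_max, ← Ideal.map_pow]; exact Ideal.map_mono hK

theorem trans (h : IsGoodExtension R S) (h' : IsGoodExtension S T) : IsGoodExtension R T where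
  flat := by
    have := h.flat; have := h'.flat
    exact Module.Flat.trans R S T
  map_max := by
    rw [← h'.map_max, ← h.map_max, Ideal.map_map, ← IsScalarTower.algebraMap_eq]
  icF_map K hK n := by
    obtain ⟨N, hN⟩ := hK
    rw [IsScalarTower.algebraMap_eq R S T, ← Ideal.map_map, ← Ideal.map_map,
      h'.icF_map _ ⟨N, h.pow_le hN⟩, h.icF_map K ⟨N, hN⟩]

theorem isLocalHom (h : IsGoodExtension R S) : IsLocalHom (algebraMap R S) :=
  ((local_hom_TFAE (algebraMap R S)).out 2 0).1 (h.map_max.le)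

theorem hasLinearBound (h : IsGoodExtension R S) {K : Ideal R} (hK : ∃ N, maximalIdeal R ^ N ≤ K)
    (hb : K.HasLinearBound) : (K.map (algebraMap R S)).HasLinearBound := by
  obtain ⟨c, hc⟩ := hb
  refine ⟨c, fun n => ?_⟩
  rw [h.icF_map K hK, ← Ideal.map_pow]
  exact Ideal.map_mono (hc n)

end IsGoodExtension

section Completion
variable (R : Type) [CommRing R] [IsLocalRing R] [IsNoetherianRing R]

theorem AdicCompletion.exists_sub_mem_map_pow (b : AdicCompletion (maximalIdeal R) R) (N : ℕ) :
    ∃ a : R, b - algebraMap R _ a ∈ ((maximalIdeal R) ^ N).map (algebraMap R (AdicCompletion (maximalIdeal R) R)) := by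
  obtain ⟨a, ha⟩ := Submodule.mkQ_surjective (maximalIdeal R ^ N • ⊤ : Submodule R R) (AdicCompletion.eval (maximalIdeal R) R N b)
  refine ⟨a, ?_⟩
  have h2 : b - algebraMap R _ a ∈ ((maximalIdeal R) ^ N • ⊤ :
      Submodule R (AdicCompletion (maximalIdeal R) R)) := by
    rw [AdicCompletion.pow_smul_top_eq_ker_eval (IsNoetherian.noetherian _)]
    refine (LinearMap.mem_ker (f := AdicCompletion.eval (maximalIdeal R) R N)).2 ?_
    rw [map_sub, ← ha, sub_eq_zero]
    rfl
  rwa [Ideal.smul_top_eq_map] at h2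

theorem AdicCompletion.isNoetherianRing : IsNoetherianRing (AdicCompletion (maximalIdeal R) R) := by
  refine isNoetherianRing_of_isAdicComplete (algebraMap R _)
    (maximalIdeal (AdicCompletion (maximalIdeal R) R)) ?_ fun b => ?_
  · rw [AdicCompletion.maximalIdeal_eq_map]
    exact Ideal.FG.map (IsNoetherian.noetherian (maximalIdeal R)) _
  · obtain ⟨a, ha⟩ := AdicCompletion.exists_sub_mem_map_pow R b 1
    refine ⟨a, ?_⟩
    rwa [pow_one, ← AdicCompletion.maximalIdeal_eq_map] at ha

theorem AdicCompletion.isGoodExtension : IsGoodExtension R (AdicCompletion (maximalIdeal R) R) where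
  flat := inferInstance
  map_max := (AdicCompletion.maximalIdeal_eq_map (R := R)).symm
  icF_map K hK n := by
    obtain ⟨N, hN⟩ := hK
    have : Module.FaithfullyFlat R (AdicCompletion (maximalIdeal R) R) :=
      Module.FaithfullyFlat.of_flat_of_isLocalHom
    refine Ideal.icF_map_of_contracted _ (fun J => ?_) K n (maximalIdeal R ^ (N * n)) ?_
      fun b => AdicCompletion.exists_sub_mem_map_pow R b _
    · exact Ideal.comap_map_eq_self_of_faithfullyFlat _
    · rw [pow_mul]
      exact (Ideal.pow_right_mono hN n).trans (Ideal.pow_le_icF _ _)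

end Completion

/-- Localizations of polynomial-like extensions at the extension of the maximal ideal. -/
theorem isGoodExtension_of_isLocalization {R P B : Type} [CommRing R] [CommRing P] [CommRing B]
    [IsLocalRing R] [IsLocalRing B] [Algebra R P] [Algebra P B] [Algebra R B] [IsScalarTower R P B]
    [Module.Flat R P] (hic : ∀ (K : Ideal R) n, (K.map (algebraMap R P)).icF n = (K.icF n).map (algebraMap R P))
    (q : Ideal P) [q.IsPrime] (hq : q = (maximalIdeal R).map (algebraMap R P))
    [IsLocalization.AtPrime B q] : IsGoodExtension R B where
  flat := by
    have : Module.Flat P B := IsLocalization.flat B q.primeCompl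
    exact Module.Flat.trans R P B
  map_max := by
    rw [IsScalarTower.algebraMap_eq R P B, ← Ideal.map_map, ← hq, IsLocalization.AtPrime.map_eq_maximalIdeal q]
  icF_map K _ n := by
    rw [IsScalarTower.algebraMap_eq R P B, ← Ideal.map_map, ← Ideal.map_map, ← hic K n]
    unfold Ideal.icF
    rw [← Ideal.map_pow, Ideal.intCl_map_of_isLocalization q.primeCompl]

end

/-- The generic linear form `∑ a i X ^ i`. -/
def genPoly (a : ℕ → A) (s : ℕ) : A[X] := ∑ i ∈ Finset.range s, C (a i) * X ^ i

theorem genPoly_succ (a : ℕ → A) (s : ℕ) : genPoly a (s + 1) = genPoly a s + C (a s) * X ^ s :=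
  Finset.sum_range_succ _ _

theorem genPoly_coeff (a : ℕ → A) (s i : ℕ) : (genPoly a s).coeff i = if i < s then a i else 0 := by
  simp [genPoly]

theorem genPoly_mem_map_C (a : ℕ → A) (s : ℕ) :
    genPoly a s ∈ (Ideal.span (a '' Set.Iio s)).map (C : A →+* A[X]) :=
  Submodule.sum_mem _ fun i hi => Ideal.mul_mem_right _ _
    (Ideal.mem_map_of_mem _ (Ideal.subset_span ⟨i, Finset.mem_range.1 hi, rfl⟩))

theorem span_image_Iio_succ (a : ℕ → A) (s : ℕ) :
    Ideal.span (a '' Set.Iio (s + 1)) = Ideal.span {a s} ⊔ Ideal.span (a '' Set.Iio s) := by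
  rw [← Ideal.span_union, ← Nat.succ_eq_add_one, ← Nat.succ_eq_succ, Order.Iio_succ_eq_insert,
    Set.image_insert_eq]
  rfl

theorem Polynomial.eq_add_C_mul_X_pow_of_degree_lt {g : A[X]} {d : ℕ} (h : g.degree < (d + 1 : ℕ)) :
    ∃ g' : A[X], g'.degree < d ∧ g = g' + C (g.coeff d) * X ^ d := by
  refine ⟨g - C (g.coeff d) * X ^ d, ?_, by ring⟩
  rw [degree_lt_iff_coeff_zero] at h ⊢
  intro m hm
  rw [coeff_sub, coeff_C_mul_X_pow]
  rcases hm.eq_or_lt with rfl | hm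
  · simp
  · rw [if_neg hm.ne', h m hm, sub_zero]

theorem Ideal.sup_pow_succ_le (I J : Ideal A) (n : ℕ) : (I ⊔ J) ^ (n + 1) ≤ I * (I ⊔ J) ^ n ⊔ J ^ (n + 1) := by
  induction n with
  | zero => simp
  | succ n ih =>
    calc (I ⊔ J) ^ (n + 2) = I * (I ⊔ J) ^ (n + 1) ⊔ J * (I ⊔ J) ^ (n + 1) := by
          rw [pow_succ' _ (n + 1), Ideal.sup_mul]
      _ ≤ I * (I ⊔ J) ^ (n + 1) ⊔ J * (I * (I ⊔ J) ^ n ⊔ J ^ (n + 1)) := by gcongr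
      _ ≤ _ := by
          rw [Ideal.mul_sup, ← pow_succ', mul_left_comm, ← sup_assoc]
          gcongr
          refine sup_le le_rfl (Ideal.mul_mono_right ?_)
          rw [pow_succ']
          gcongr
          exact le_sup_right

/-- A Dedekind–Mertens statement: coefficients of a factor are controlled by those of a product
with a generic linear form. -/
theorem dedekindMertens (a : ℕ → A) (s d : ℕ) : ∃ M : ℕ, ∀ (c : Ideal A) (g : A[X]), g.degree < d →
    genPoly a s * g ∈ c.map C → ∀ x ∈ Ideal.span (a '' Set.Iio s) ^ (M + 1),
      C x * g ∈ (Ideal.span (a '' Set.Iio s) ^ M * c).map (C : A →+* A[X]) := by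
  induction s generalizing d with
  | zero =>
    refine ⟨0, fun c g _ _ x hx => ?_⟩
    have : x = 0 := by simpa using hx
    simp [this]
  | succ s ihs =>
    induction d with
    | zero =>
      refine ⟨0, fun c g hg _ x hx => ?_⟩
      have : g = 0 := by simpa using hg
      simp [this]
    | succ d ihd =>
      obtain ⟨M, hM⟩ := ihd
      obtain ⟨N, hN⟩ := ihs (d + 1)
      set K := Ideal.span (a '' Set.Iio (s + 1)) with hK
      set K' := Ideal.span (a '' Set.Iio s) with hK'
      have hKK : K = Ideal.span {a s} ⊔ K' := span_image_Iio_succ a s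
      have hle : K' ≤ K := hKK ▸ le_sup_right
      have haK : a s ∈ K := hKK ▸ Ideal.mem_sup_left (Ideal.mem_span_singleton_self _)
      refine ⟨M + 1 + N, fun c g hg hw => ?_⟩
      obtain ⟨g', hg', hgg⟩ := eq_add_C_mul_X_pow_of_degree_lt hg
      set b := g.coeff d
      have hab : a s * b ∈ c := by
        have := Ideal.mem_map_C_iff.1 hw (s + d)
        rw [genPoly_succ, add_mul, coeff_add, mul_right_comm, add_comm s d, coeff_mul_X_pow, coeff_C_mul, coeff_mul,
          Finset.sum_eq_zero, zero_add] at this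
        · exact this
        · intro p hp
          have hp := Finset.HasAntidiagonal.mem_antidiagonal.1 hp
          rw [genPoly_coeff]
          split_ifs with hi
          · rw [(degree_lt_iff_coeff_zero _ _).1 hg p.2 (by lia), mul_zero]
          · rw [zero_mul]
      have h1 : ∀ x ∈ K ^ (M + 1), C (x * a s) * g ∈ (K ^ (M + 1) * c).map C := by
        intro x hx
        have h2 : genPoly a (s + 1) * (C (a s) * g') ∈ (K * c).map C := by
          have e : genPoly a (s + 1) * (C (a s) * g') = C (a s) * (genPoly a (s + 1) * g)
              - C (a s * b) * (genPoly a (s + 1)) * X ^ d := by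
            rw [C_mul]
            linear_combination (- C (a s) * genPoly a (s + 1)) * hgg
          rw [e, Ideal.map_mul]
          refine sub_mem (Ideal.mul_mem_mul (Ideal.mem_map_of_mem _ haK) hw) (Ideal.mul_mem_right _ _ ?_)
          rw [mul_comm (Ideal.map C K)]
          exact Ideal.mul_mem_mul (Ideal.mem_map_of_mem _ hab) (genPoly_mem_map_C _ _)
        have h3 := hM (K * c) (C (a s) * g') (by
          rw [degree_lt_iff_coeff_zero] at hg' ⊢
          intro m hm; rw [coeff_C_mul, hg' m hm, mul_zero]) h2 x hx
        rw [← mul_assoc, ← mul_assoc, ← pow_succ] at h3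
        have e : C (x * a s) * g = C x * C (a s) * g' + C (x * (a s * b)) * X ^ d := by
          rw [C_mul, C_mul, C_mul]
          linear_combination (C x * C (a s)) * hgg
        rw [e]
        exact add_mem h3 (Ideal.mul_mem_right _ _ (Ideal.mem_map_of_mem _ (Ideal.mul_mem_mul hx hab)))
      have h4 : ∀ x ∈ K ^ (M + 1), ∀ y ∈ K' ^ (N + 1), C (y * x) * g ∈ (K ^ (M + 1 + N) * c).map C := by
        intro x hx y hy
        have h5 : genPoly a s * (C x * g) ∈ (K ^ (M + 1) * c).map C := by
          have e : genPoly a s * (C x * g) = C x * (genPoly a (s + 1) * g) - C (x * a s) * g * X ^ s := by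
            rw [genPoly_succ, C_mul]; ring
          rw [e]
          refine sub_mem ?_ (Ideal.mul_mem_right _ _ (h1 x hx))
          rw [Ideal.map_mul]
          exact Ideal.mul_mem_mul (Ideal.mem_map_of_mem _ hx) hw
        have h6 := hN _ (C x * g) (by
          rw [degree_lt_iff_coeff_zero] at hg ⊢
          intro m hm; rw [coeff_C_mul, hg m hm, mul_zero]) h5 y hy
        rw [← mul_assoc (C y), ← C_mul] at h6
        refine Ideal.map_mono ?_ h6
        rw [← mul_assoc, add_comm (M + 1) N, pow_add K N (M + 1)]
        exact Ideal.mul_mono_left (Ideal.mul_mono_left (Ideal.pow_right_mono hle N))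
      intro x hx
      have h7 : K ^ (M + 1 + N + 1) ≤ Ideal.span {a s} * K ^ (M + 1 + N) ⊔ K' ^ (N + 1) * K ^ (M + 1) := by
        calc K ^ (M + 1 + N + 1) = K ^ (N + 1) * K ^ (M + 1) := by rw [← pow_add]; congr 1; ring
          _ ≤ (Ideal.span {a s} * K ^ N ⊔ K' ^ (N + 1)) * K ^ (M + 1) := by
            gcongr
            rw [hKK]
            exact Ideal.sup_pow_succ_le _ _ _
          _ = _ := by rw [Ideal.sup_mul, mul_assoc, ← pow_add, add_comm N]
      let T : Ideal A := Ideal.comap C (((K ^ (M + 1 + N) * c).map C).colon (Ideal.span {g}))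
      have hT : ∀ y, y ∈ T ↔ C y * g ∈ (K ^ (M + 1 + N) * c).map C := by
        intro y
        rw [Ideal.mem_comap, Ideal.mem_colon_span_singleton]
      rw [← hT]
      refine (h7.trans (sup_le ?_ ?_)) hx
      · rw [add_comm (M + 1) N, pow_add, Ideal.span_singleton_mul_le_iff]
        refine fun z hz => Submodule.mul_induction_on hz (fun y hy x hx => ?_) fun x y hx hy => ?_
        · rw [hT, show a s * (y * x) = y * (x * a s) by ring, C_mul, mul_assoc, add_comm (M + 1) N, pow_add,
            mul_assoc, Ideal.map_mul]
          exact Ideal.mul_mem_mul (Ideal.mem_map_of_mem _ hy) (h1 x hx)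
        · rw [mul_add]; exact add_mem hx hy
      · rw [Ideal.mul_le]
        intro y hy x hx
        exact (hT _).2 (h4 x hx y hy)

section

/-- `w` is superficial for the integral closure filtration of `K`, from the start. -/
structure IsStrictSuperficial (K : Ideal A) (w : A) : Prop where
  linearBound : K.HasLinearBound
  mem : w ∈ K
  nzd : w ∈ nonZeroDivisors A
  colon : ∀ n a, w * a ∈ K.icF (n + 1) → a ∈ K.icF n

namespace IsStrictSuperficial
variable {K : Ideal A} {w : A}

theorem colon_pow (hw : IsStrictSuperficial K w) (m n : ℕ) (a : A) (h : w ^ m * a ∈ K.icF (n + m)) : a ∈ K.icF n := by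
  induction m generalizing n with
  | zero => simpa using h
  | succ m ih =>
    refine ih n (hw.colon _ _ ?_)
    rw [← mul_assoc, ← pow_succ']
    exact h

theorem pow_mem (hw : IsStrictSuperficial K w) (m : ℕ) : w ^ m ∈ K.icF m := Ideal.pow_le_icF _ _ (Ideal.pow_mem_pow hw.mem m)

end IsStrictSuperficial

/-- The degree `j` part of the blow-up algebra `⋃ F j / w ^ j` of the integral closure filtration. -/
def blowupPiece (K : Ideal A) (w : A) (L : Type) [CommRing L] [Algebra A L]
    [IsLocalization.Away w L] (j : ℕ) : Submodule A L :=
  Submodule.map ((LinearMap.mulRight A ((IsLocalization.Away.invSelf w : L) ^ j)).comp (Algebra.linearMap A L)) (K.icF j)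

section Blowup
variable {K : Ideal A} {w : A} {L : Type} [CommRing L] [Algebra A L] [IsLocalization.Away w L]

theorem mem_blowupPiece {j : ℕ} {z : L} : z ∈ blowupPiece K w L j ↔
    ∃ f ∈ K.icF j, algebraMap A L f * (IsLocalization.Away.invSelf w : L) ^ j = z := by
  simp [blowupPiece]

theorem algebraMap_pow_mul_invSelf_pow (n : ℕ) :
    algebraMap A L w ^ n * (IsLocalization.Away.invSelf w : L) ^ n = 1 := by
  rw [← mul_pow, IsLocalization.Away.mul_invSelf, one_pow]

theorem blowupPiece_le_add (hw : w ∈ K) (j i : ℕ) :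
    blowupPiece K w L j ≤ blowupPiece K w L (j + i) := by
  intro z hz
  rw [mem_blowupPiece] at hz ⊢
  obtain ⟨f, hf, rfl⟩ := hz
  refine ⟨w ^ i * f, ?_, ?_⟩
  · rw [add_comm]
    exact Ideal.pow_mul_icF_le K i j (Ideal.mul_mem_mul (Ideal.pow_mem_pow hw i) hf)
  · rw [map_mul, map_pow, pow_add]
    linear_combination (algebraMap A L f * (IsLocalization.Away.invSelf w : L) ^ j) *
      algebraMap_pow_mul_invSelf_pow (w := w) (L := L) i

theorem blowupPiece_mono (hw : w ∈ K) {i j : ℕ} (h : i ≤ j) :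
    blowupPiece K w L i ≤ blowupPiece K w L j := by
  obtain ⟨k, rfl⟩ := Nat.exists_eq_add_of_le h
  exact blowupPiece_le_add hw i k

theorem mul_mem_blowupPiece {i j : ℕ} {y z : L} (hy : y ∈ blowupPiece K w L i)
    (hz : z ∈ blowupPiece K w L j) : y * z ∈ blowupPiece K w L (i + j) := by
  rw [mem_blowupPiece] at hy hz ⊢
  obtain ⟨f, hf, rfl⟩ := hy
  obtain ⟨g, hg, rfl⟩ := hz
  refine ⟨f * g, Ideal.icF_mul_le _ _ _ (Ideal.mul_mem_mul hf hg), ?_⟩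
  rw [map_mul, pow_add]; ring

theorem algebraMap_mem_blowupPiece_zero (a : A) : algebraMap A L a ∈ blowupPiece K w L 0 := by
  rw [mem_blowupPiece]
  exact ⟨a, by simp, by simp⟩

/-- The blow-up algebra `⋃ F j / w ^ j` of the integral closure filtration. -/
def blowupAlgebra (K : Ideal A) (w : A) (hw : w ∈ K) (L : Type) [CommRing L] [Algebra A L]
    [IsLocalization.Away w L] : Subalgebra A L where
  carrier := {z | ∃ j, z ∈ blowupPiece K w L j}
  mul_mem' := fun ⟨_, hi⟩ ⟨_, hj⟩ => ⟨_, mul_mem_blowupPiece hi hj⟩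
  add_mem' := fun ⟨_, hi⟩ ⟨_, hj⟩ => ⟨_, add_mem (blowupPiece_mono hw (le_max_left _ _) hi)
    (blowupPiece_mono hw (le_max_right _ _) hj)⟩
  algebraMap_mem' := fun a => ⟨0, algebraMap_mem_blowupPiece_zero a⟩

theorem invSelf_eq_of_mul_eq {z : L} {n : ℕ} {a : A} (h : z * algebraMap A L w ^ n = algebraMap A L a) :
    z = algebraMap A L a * (IsLocalization.Away.invSelf w : L) ^ n := by
  rw [← h, mul_assoc, algebraMap_pow_mul_invSelf_pow, mul_one]

variable (w) in
theorem exists_eq_mul_invSelf_pow (z : L) :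
    ∃ n a, z = algebraMap A L a * (IsLocalization.Away.invSelf w : L) ^ n := by
  obtain ⟨n, a, h⟩ := IsLocalization.Away.surj w z
  exact ⟨n, a, invSelf_eq_of_mul_eq h⟩

namespace IsStrictSuperficial

theorem algebraMap_injective (hw : IsStrictSuperficial K w) : Function.Injective (algebraMap A L) :=
  IsLocalization.injective L (Submonoid.powers_le.2 hw.nzd)

theorem mem_icF_of_mem_blowupPiece (hw : IsStrictSuperficial K w) {a : A} {n j : ℕ}
    (h : algebraMap A L a * (IsLocalization.Away.invSelf w : L) ^ n ∈ blowupPiece K w L j) :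
    a ∈ K.icF n := by
  have := blowupPiece_le_add hw.mem j n h
  rw [mem_blowupPiece] at this
  obtain ⟨f, hf, he⟩ := this
  have h2 : w ^ j * a = f := by
    apply hw.algebraMap_injective (L := L)
    rw [map_mul, map_pow]
    have e1 := algebraMap_pow_mul_invSelf_pow (w := w) (L := L) (j + n)
    have e2 := algebraMap_pow_mul_invSelf_pow (w := w) (L := L) n
    rw [pow_add, pow_add] at e1
    rw [pow_add] at he
    linear_combination (-(algebraMap A L w ^ j) * algebraMap A L w ^ n) * he
      + (algebraMap A L f) * e1 - (algebraMap A L w ^ j * algebraMap A L a) * e2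
  refine hw.colon_pow j n a ?_
  rw [h2, add_comm n j]; exact hf

theorem mem_icF_of_mem_blowupAlgebra (hw : IsStrictSuperficial K w) {a : A} {n : ℕ}
    (h : algebraMap A L a * (IsLocalization.Away.invSelf w : L) ^ n ∈ blowupAlgebra K w hw.mem L) :
    a ∈ K.icF n := by
  obtain ⟨j, hj⟩ := h
  exact hw.mem_icF_of_mem_blowupPiece hj

theorem mem_blowupAlgebra_of_isIntegral (hw : IsStrictSuperficial K w) {z : L} (hz : IsIntegral (blowupAlgebra K w hw.mem L) z) :
    z ∈ blowupAlgebra K w hw.mem L := by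
  obtain ⟨p, hp, hpz⟩ := hz
  have hex : ∃ n, ∀ j < p.natDegree, ((p.coeff j : blowupAlgebra K w hw.mem L) : L) ∈ blowupPiece K w L n := by
    choose m hm using fun j => (p.coeff j).2
    refine ⟨(Finset.range p.natDegree).sup m, fun j hj => blowupPiece_mono hw.mem ?_ (hm j)⟩
    exact Finset.le_sup (f := m) (Finset.mem_range.2 hj)
  obtain ⟨n, hn⟩ := hex
  obtain ⟨k, a₀, rfl⟩ := exists_eq_mul_invSelf_pow w z
  set v : L := IsLocalization.Away.invSelf w
  set W := algebraMap A L w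
  have hvW : W * v = 1 := IsLocalization.Away.mul_invSelf w
  let N := n + k
  let a := w ^ n * a₀
  have hz : algebraMap A L a₀ * v ^ k = algebraMap A L a * v ^ N := by
    have e := algebraMap_pow_mul_invSelf_pow (w := w) (L := L) n
    simp only [a, N, map_mul, map_pow, pow_add]
    linear_combination (- algebraMap A L a₀ * v ^ k) * e
  rw [hz] at hpz ⊢
  have : ∀ j, ∃ f : A, j < p.natDegree → f ∈ K.icF n ∧
      algebraMap A L f * v ^ n = ((p.coeff j : blowupAlgebra K w hw.mem L) : L) := by
    intro j
    by_cases hj : j < p.natDegree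
    · obtain ⟨f, hf, he⟩ := mem_blowupPiece.1 (hn j hj)
      exact ⟨f, fun _ => ⟨hf, he⟩⟩
    · exact ⟨0, fun h => absurd h hj⟩
  choose f hf using this
  refine ⟨N, mem_blowupPiece.2 ⟨a, ?_, rfl⟩⟩
  let d := p.natDegree
  let r : A[X] := ∑ j ∈ Finset.range d, C (f j * w ^ (N * (d - j) - n)) * X ^ j
  have hrdeg : r.degree < d := by
    rw [degree_lt_iff_coeff_zero]
    intro m hm
    simp only [r, finsetSum_coeff, coeff_C_mul_X_pow]
    exact Finset.sum_eq_zero fun j hj => if_neg (by have := Finset.mem_range.1 hj; lia)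
  rcases subsingleton_or_nontrivial A with hA | hA
  · rw [Subsingleton.elim a 0]; exact zero_mem _
  have hdeg : (X ^ d + r).natDegree = d := natDegree_eq_of_degree_eq_some (by
    rw [degree_add_eq_left_of_degree_lt] <;> simp [hrdeg])
  refine Ideal.mem_icF_of_monic (X ^ d + r) (monic_X_pow_add hrdeg) (fun j => ?_) ?_
  · rw [hdeg, coeff_add, coeff_X_pow]
    have hc : r.coeff j = if j < d then f j * w ^ (N * (d - j) - n) else 0 := by
      simp only [r, finsetSum_coeff, coeff_C_mul_X_pow]
      rw [Finset.sum_ite_eq]; simp only [Finset.mem_range]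
    rw [hc]
    rcases lt_trichotomy j d with h | h | h
    · rw [if_neg h.ne, if_pos h, zero_add]
      have hle : n ≤ N * (d - j) := by
        have : 1 ≤ d - j := Nat.sub_pos_of_lt h
        calc n ≤ N * 1 := by simp [N]
          _ ≤ _ := Nat.mul_le_mul_left _ this
      have := Ideal.icF_mul_le K _ _ (Ideal.mul_mem_mul (hf j h).1 (hw.pow_mem (N * (d - j) - n)))
      rwa [Nat.add_sub_of_le hle] at this
    · subst h; simp
    · rw [if_neg h.ne', if_neg h.not_gt]; simp
  · apply hw.algebraMap_injective (L := L)
    rw [map_zero]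
    rw [eval₂_eq_sum_range, Finset.sum_range_succ, hp.coeff_natDegree, map_one, one_mul] at hpz
    have h2 := congrArg (fun y => (W ^ N) ^ d * y) hpz
    simp only [mul_zero] at h2
    rw [← h2]
    have hWv : W ^ N * v ^ N = 1 := by rw [← mul_pow, hvW, one_pow]
    simp only [eval_add, eval_pow, eval_X, r, eval_finsetSum, eval_mul, eval_C, map_add, map_sum,
      map_mul, map_pow, mul_add, Finset.mul_sum]
    rw [add_comm]
    congr 1
    · refine Finset.sum_congr rfl fun j hj => ?_
      have hj : j < d := Finset.mem_range.1 hj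
      have hle : n ≤ N * (d - j) := by
        have : 1 ≤ d - j := Nat.sub_pos_of_lt hj
        calc n ≤ N * 1 := by simp [N]
          _ ≤ _ := Nat.mul_le_mul_left _ this
      have e1 : (W ^ N) ^ d = (W ^ N) ^ j * (W ^ (N * (d - j) - n) * W ^ n) := by
        rw [← pow_add, Nat.sub_add_cancel hle, pow_mul, ← pow_add,
          Nat.add_sub_of_le hj.le]
      have e2 : W ^ n * v ^ n = 1 := by rw [← mul_pow, hvW, one_pow]
      have e3 : (W ^ N) ^ j * (v ^ N) ^ j = 1 := by rw [← mul_pow, hWv, one_pow]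
      rw [e1]
      have e4 : (algebraMap (blowupAlgebra K w hw.mem L) L) (p.coeff j) = algebraMap A L (f j) * v ^ n :=
        ((hf j hj).2).symm
      rw [e4, mul_pow]
      linear_combination (-(algebraMap A L (f j)) * W ^ (N * (d - j) - n) * (algebraMap A L a) ^ j) * e2
        - (algebraMap A L (f j)) * W ^ (N * (d - j) - n) * (algebraMap A L a) ^ j * W ^ n * v ^ n * e3
    · rw [mul_pow, mul_left_comm, ← mul_pow (W ^ N), hWv, one_pow, mul_one]

theorem mem_blowupAlgebra_of_pow_mem (hw : IsStrictSuperficial K w) {z : L} {n : ℕ} (hn : 0 < n) (hz : z ^ n ∈ blowupAlgebra K w hw.mem L) :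
    z ∈ blowupAlgebra K w hw.mem L := by
  refine hw.mem_blowupAlgebra_of_isIntegral (IsIntegral.of_pow hn ?_)
  exact isIntegral_algebraMap (R := blowupAlgebra K w hw.mem L) (x := ⟨_, hz⟩)

end IsStrictSuperficial
end Blowup

end

section

theorem IsLocalRing.exists_eq_unit_mul_pow {W : Type} [CommRing W] [IsLocalRing W] [IsNoetherianRing W]
    {p : W} (h : maximalIdeal W = Ideal.span {p}) {a : W} (ha : a ≠ 0) :
    ∃ n u, IsUnit u ∧ a = u * p ^ n := by
  have hex : ∃ n, a ∉ Ideal.span {p} ^ n := by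
    by_contra! hcon
    refine ha ?_
    have := Ideal.iInf_pow_eq_bot_of_isLocalRing (Ideal.span {p}) (h ▸ (maximalIdeal.isMaximal W).ne_top)
    rw [← Submodule.mem_bot W, ← this]
    exact Submodule.mem_iInf _ |>.2 hcon
  classical
  have hpos : Nat.find hex ≠ 0 := fun h0 => by
    have := Nat.find_spec hex
    rw [h0] at this
    simp at this
  obtain ⟨n, hn⟩ := Nat.exists_eq_succ_of_ne_zero hpos
  have h1 := Nat.find_spec hex
  have h2 := not_not.1 (Nat.find_min hex (m := n) (by lia))
  rw [Ideal.span_singleton_pow, Ideal.mem_span_singleton] at h1 h2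
  obtain ⟨u, rfl⟩ := h2
  refine ⟨n, u, ?_, mul_comm _ _⟩
  by_contra hu
  have : u ∈ maximalIdeal W := (mem_maximalIdeal u).2 hu
  rw [h, Ideal.mem_span_singleton] at this
  obtain ⟨c, rfl⟩ := this
  rw [hn] at h1
  exact h1 ⟨c, by rw [pow_succ, mul_assoc]⟩

namespace PrincipalClosed
variable {O : Type} [CommRing O] {w : O}

/-- The principal ideals generated by the powers of `w` are integrally closed. -/
def PowersClosed (w : O) : Prop := ∀ n, (Ideal.span {w}).icF n ≤ Ideal.span {w} ^ n

theorem dvd_of_pow_dvd (hic : PowersClosed w) {a : O} {n k : ℕ} (hk : 0 < k) (h : (w ^ n) ^ k ∣ a ^ k) :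
    w ^ n ∣ a := by
  have : a ∈ (Ideal.span {w}).icF n := by
    rw [Ideal.mem_icF_iff_isIntegralElemOver]
    refine ⟨k, fun i => if i = k then - a ^ k else 0, hk, fun i _ => ?_, ?_⟩
    · dsimp only
      split_ifs with h'
      · subst h'
        rw [Ideal.span_singleton_pow, Ideal.span_singleton_pow, Ideal.mem_span_singleton]
        exact h.neg_right
      · exact zero_mem _
    · rw [Finset.sum_eq_single k]
      · simp
      · intro i _ hi; simp [hi]
      · intro h; simp at h; lia
  have := hic n this
  rwa [Ideal.span_singleton_pow, Ideal.mem_span_singleton] at this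

variable [IsNoetherianRing O]

theorem exists_of_mem_associatedPrimes {Q : Ideal O} (hQ : Q ∈ associatedPrimes O (O ⧸ Ideal.span {w})) :
    ∃ b, b ∉ Ideal.span {w} ∧ ∀ q, q ∈ Q ↔ q * b ∈ Ideal.span {w} := by
  obtain ⟨hp, x, hx⟩ := isAssociatedPrime_iff.1 hQ
  obtain ⟨b, rfl⟩ := Ideal.Quotient.mk_surjective x
  have key : ∀ q, q ∈ Q ↔ q * b ∈ Ideal.span {w} := fun q => by
    rw [hx, Submodule.mem_colon_singleton, Submodule.mem_bot, Algebra.smul_def,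
      ← Ideal.Quotient.eq_zero_iff_mem, map_mul]
    rfl
  refine ⟨b, fun hb => hp.ne_top ?_, key⟩
  rw [Ideal.eq_top_iff_one, key, one_mul]
  exact hb

theorem exists_mem_associatedPrimes {b : O} (hb : b ∉ Ideal.span {w}) :
    ∃ Q ∈ associatedPrimes O (O ⧸ Ideal.span {w}), ∀ q, q * b ∈ Ideal.span {w} → q ∈ Q := by
  obtain ⟨Q, hQ, hle⟩ := exists_le_isAssociatedPrime_of_isNoetherianRing O
    (Ideal.Quotient.mk (Ideal.span {w}) b) (by rwa [Ne, Ideal.Quotient.eq_zero_iff_mem])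
  refine ⟨Q, hQ, fun q hq => hle ?_⟩
  rw [Submodule.mem_colon_singleton, Submodule.mem_bot, Algebra.smul_def]
  rw [← Ideal.Quotient.eq_zero_iff_mem, map_mul] at hq
  exact hq

theorem mem_of_mem_associatedPrimes {Q : Ideal O} (hQ : Q ∈ associatedPrimes O (O ⧸ Ideal.span {w})) :
    w ∈ Q := by
  obtain ⟨b, -, h⟩ := exists_of_mem_associatedPrimes hQ
  rw [h, mul_comm]
  exact Ideal.mul_mem_left _ _ (Ideal.mem_span_singleton_self w)

theorem mem_span_pow_of_forall (hw : w ∈ nonZeroDivisors O) (n : ℕ) (a : O)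
    (h : ∀ Q ∈ associatedPrimes O (O ⧸ Ideal.span {w}), ∃ s, s ∉ Q ∧ w ^ n ∣ s * a) : w ^ n ∣ a := by
  by_contra hcon
  have : ∃ k < n, w ^ k ∣ a ∧ ¬ w ^ (k + 1) ∣ a := by
    classical
    have hex : ∃ n, ¬ w ^ n ∣ a := ⟨n, hcon⟩
    have h0 : Nat.find hex ≠ 0 := fun h0 => by
      have := Nat.find_spec hex
      rw [h0] at this
      simp at this
    obtain ⟨k, hk⟩ := Nat.exists_eq_succ_of_ne_zero h0
    refine ⟨k, ?_, not_not.1 (Nat.find_min hex (m := k) (by lia)), ?_⟩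
    · have := Nat.find_min' hex hcon; lia
    · have := Nat.find_spec hex
      rwa [hk] at this
  obtain ⟨k, hk, ⟨b, rfl⟩, hk2⟩ := this
  have hb : b ∉ Ideal.span {w} := fun hb => by
    obtain ⟨c, rfl⟩ := Ideal.mem_span_singleton.1 hb
    exact hk2 ⟨c, by rw [pow_succ, mul_assoc]⟩
  obtain ⟨Q, hQ, hle⟩ := exists_mem_associatedPrimes hb
  obtain ⟨s, hs, c, hc⟩ := h Q hQ
  refine hs (hle s (Ideal.mem_span_singleton.2 ⟨w ^ (n - k - 1) * c, ?_⟩))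
  refine (mem_nonZeroDivisors_iff_right.1 (pow_mem hw k)) _ ?_ |> sub_eq_zero.1
  have : w ^ n = w ^ k * (w * w ^ (n - k - 1)) := by rw [← pow_succ', ← pow_add]; congr 1; lia
  rw [this] at hc
  linear_combination hc

theorem exists_maximalIdeal_eq_span (hw : w ∈ nonZeroDivisors O) (hic : PowersClosed w) {Q : Ideal O} [Q.IsPrime]
    (hQ : Q ∈ associatedPrimes O (O ⧸ Ideal.span {w})) :
    ∃ p ∈ Q, maximalIdeal (Localization.AtPrime Q) = Ideal.span {algebraMap O (Localization.AtPrime Q) p} := by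
  obtain ⟨b, hb, h⟩ := exists_of_mem_associatedPrimes hQ
  have hwQ := mem_of_mem_associatedPrimes hQ
  have hcan : ∀ x y, w * x = w * y → x = y := fun x y hxy =>
    sub_eq_zero.1 ((mem_nonZeroDivisors_iff_right.1 hw) _ (by linear_combination hxy))
  have hex : ∃ p ∈ Q, ∃ t ∉ Q, b * p = w * t := by
    by_contra! hcon
    refine hb ?_
    have := hic 1 (x := b) (Ideal.mem_icF_of_mul_le Q (IsNoetherian.noetherian Q) (fun a ha => ?_) fun p hp => ?_)
    · simpa using this
    · exact (mem_nonZeroDivisors_iff_right.1 hw) a (ha w hwQ)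
    · obtain ⟨t, ht⟩ := Ideal.mem_span_singleton.1 ((h p).1 hp)
      have htQ : t ∈ Q := by
        by_contra htQ
        exact hcon p hp t htQ (by rw [mul_comm, ht])
      rw [mul_comm b, ht]
      exact Ideal.mul_mem_mul (Ideal.pow_le_icF _ _ (by simp)) htQ
  obtain ⟨p, hp, t, ht, hpt⟩ := hex
  refine ⟨p, hp, ?_⟩
  rw [← Localization.AtPrime.map_eq_maximalIdeal]
  refine le_antisymm (Ideal.map_le_iff_le_comap.2 fun q hq => ?_)
    ((Ideal.span_singleton_le_iff_mem _).2 (Ideal.mem_map_of_mem _ hp))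
  obtain ⟨t', ht'⟩ := Ideal.mem_span_singleton.1 ((h q).1 hq)
  have h1 : t * q = t' * p := hcan _ _ (by linear_combination (-q) * hpt + p * ht')
  have hu := IsLocalization.map_units (Localization.AtPrime Q) (⟨t, ht⟩ : Q.primeCompl)
  rw [Ideal.mem_comap, ← Ideal.unit_mul_mem_iff_mem _ hu, ← map_mul]
  simp only [h1]
  rw [map_mul]
  exact Ideal.mul_mem_left _ _ (Ideal.mem_span_singleton_self _)

theorem exists_prime_of_not_dvd (hw : w ∈ nonZeroDivisors O) (hic : PowersClosed w) {x : O} (hx : ¬ w ∣ x) :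
    ∃ (Q : Ideal O) (_ : Q.IsPrime), w ∈ Q ∧ (∃ p ∈ Q, maximalIdeal (Localization.AtPrime Q) =
        Ideal.span {algebraMap O (Localization.AtPrime Q) p}) ∧
      ∃ q r t, r < q ∧ x ^ q = w ^ r * t ∧ t ∉ Q := by
  have hfin := associatedPrimes.finite O (O ⧸ Ideal.span {w})
  have hval : ∀ Q ∈ associatedPrimes O (O ⧸ Ideal.span {w}), ∃ e r s s', 0 < e ∧ s ∉ Q ∧
      s * x ^ e = s' * w ^ r ∧ (s' ∈ Q → e ≤ r) := by
    intro Q hQ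
    have : Q.IsPrime := hQ.isPrime
    obtain ⟨p, hp, hmax⟩ := exists_maximalIdeal_eq_span hw hic hQ
    set W := Localization.AtPrime Q
    let f := algebraMap O W
    have hwW : f w ∈ maximalIdeal W := by
      rw [← Localization.AtPrime.map_eq_maximalIdeal]
      exact Ideal.mem_map_of_mem _ (mem_of_mem_associatedPrimes hQ)
    have hw0 : f w ≠ 0 := by
      intro h0
      obtain ⟨s, hs⟩ := (IsLocalization.map_eq_zero_iff Q.primeCompl W w).1 h0
      refine s.2 ?_
      rw [(mem_nonZeroDivisors_iff_right.1 hw) s hs]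
      exact zero_mem Q
    by_cases hx0 : f x = 0
    · obtain ⟨s, hs⟩ := (IsLocalization.map_eq_zero_iff Q.primeCompl W x).1 hx0
      exact ⟨1, 1, s, 0, one_pos, s.2, by simp [hs], fun _ => le_rfl⟩
    · obtain ⟨e, u, hu, he⟩ := IsLocalRing.exists_eq_unit_mul_pow hmax hw0
      obtain ⟨r, v, hv, hr⟩ := IsLocalRing.exists_eq_unit_mul_pow hmax hx0
      have he0 : 0 < e := by
        rcases Nat.eq_zero_or_pos e with rfl | h
        · exfalso
          rw [pow_zero, mul_one] at he
          exact (mem_maximalIdeal _).1 hwW (he ▸ hu)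
        · exact h
      have heq : u ^ r * f x ^ e = v ^ e * f w ^ r := by
        have : f x = v * f p ^ r := hr
        have h2 : f w = u * f p ^ e := he
        rw [this, h2]; ring
      obtain ⟨g, hg⟩ := (hu.pow r).exists_right_inv
      have heq2 : f (x ^ e) = (g * v ^ e) * f (w ^ r) := by
        rw [map_pow, map_pow]; linear_combination (-f x ^ e) * hg + g * heq
      have hgv : IsUnit (g * v ^ e) := (IsUnit.of_mul_eq_one _ (by rwa [mul_comm] at hg)).mul (hv.pow e)
      obtain ⟨⟨c, d⟩, hcd⟩ := IsLocalization.surj Q.primeCompl (g * v ^ e)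
      have hcQ : c ∉ Q := by
        intro hc
        have : IsUnit (f c) := by rw [← hcd]; exact hgv.mul (IsLocalization.map_units W d)
        exact (IsLocalization.AtPrime.isUnit_to_map_iff W Q c).1 this hc
      have h3 : f (d * x ^ e) = f (c * w ^ r) := by
        have h4 : g * v ^ e * f d = f c := hcd
        rw [map_mul, map_mul, heq2]; linear_combination f (w ^ r) * h4
      obtain ⟨s, hs⟩ := (IsLocalization.eq_iff_exists Q.primeCompl W).1 h3
      refine ⟨e, r, s * d, s * c, he0, (s * d).2, by linear_combination hs, fun h => ?_⟩
      exact absurd h (Ideal.IsPrime.mul_notMem inferInstance s.2 hcQ)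
  choose! e r s s' he hs heq hs' using hval
  let S := hfin.toFinset
  have hSmem : ∀ Q, Q ∈ S ↔ Q ∈ associatedPrimes O (O ⧸ Ideal.span {w}) := fun Q => hfin.mem_toFinset
  have hne : S.Nonempty := by
    obtain ⟨Q, hQ, -⟩ := exists_mem_associatedPrimes (w := w) (b := x) (by rwa [Ideal.mem_span_singleton])
    exact ⟨Q, (hSmem Q).2 hQ⟩
  obtain ⟨Q, hQ, hmin⟩ := S.exists_min_image (fun Q => (r Q : ℚ) / e Q) hne
  rw [hSmem] at hQ
  have hmin' : ∀ Q' ∈ associatedPrimes O (O ⧸ Ideal.span {w}), r Q * e Q' ≤ r Q' * e Q := by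
    intro Q' hQ'
    have := hmin Q' ((hSmem Q').2 hQ')
    rw [div_le_div_iff₀ (by exact_mod_cast he Q hQ) (by exact_mod_cast he Q' hQ')] at this
    exact_mod_cast this
  have key : ∀ k l, 0 < k → (∀ Q' ∈ associatedPrimes O (O ⧸ Ideal.span {w}), l * e Q' ≤ r Q' * k) →
      w ^ l ∣ x ^ k := by
    intro k l hk hkl
    let E := ∏ Q' ∈ S, e Q'
    have hE : 0 < E := Finset.prod_pos fun Q' h => he Q' ((hSmem Q').1 h)
    refine dvd_of_pow_dvd hic hE ?_
    rw [← pow_mul, ← pow_mul]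
    refine mem_span_pow_of_forall hw _ _ fun Q' hQ' => ?_
    have hp : Q'.IsPrime := hQ'.isPrime
    obtain ⟨m, hm⟩ : e Q' ∣ E := Finset.dvd_prod_of_mem _ ((hSmem Q').2 hQ')
    refine ⟨s Q' ^ (k * m), fun h => hs Q' hQ' (hp.mem_of_pow_mem _ h), ?_⟩
    have : s Q' ^ (k * m) * x ^ (k * E) = s' Q' ^ (k * m) * w ^ (r Q' * (k * m)) := by
      rw [hm, show k * (e Q' * m) = e Q' * (k * m) by ring, pow_mul x, ← mul_pow, heq Q' hQ', mul_pow,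
        ← pow_mul]
    rw [this]
    refine Dvd.dvd.mul_left (pow_dvd_pow _ ?_) _
    rw [hm]
    calc l * (e Q' * m) = l * e Q' * m := by ring
      _ ≤ r Q' * k * m := Nat.mul_le_mul_right _ (hkl Q' hQ')
      _ = _ := by ring
  have hlt : r Q < e Q := by
    by_contra! hle
    refine hx ?_
    have := key 1 1 one_pos fun Q' hQ' => ?_
    · simpa using this
    · have h1 := hmin' Q' hQ'
      have h2 : e Q * e Q' ≤ r Q' * e Q := (Nat.mul_le_mul_right _ hle).trans h1
      rw [mul_comm (r Q')] at h2
      have := Nat.le_of_mul_le_mul_left h2 (he Q hQ)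
      lia
  have hp : Q.IsPrime := hQ.isPrime
  obtain ⟨t, ht⟩ := key (e Q) (r Q) (he Q hQ) hmin'
  refine ⟨Q, hp, mem_of_mem_associatedPrimes hQ, exists_maximalIdeal_eq_span hw hic hQ,
    e Q, r Q, t, hlt, ht, fun htQ => ?_⟩
  have h1 := heq Q hQ
  have h2 : s Q * t = s' Q := by
    refine sub_eq_zero.1 ((mem_nonZeroDivisors_iff_right.1 (pow_mem hw (r Q))) _ ?_)
    rw [ht] at h1; linear_combination h1
  have h3 := hs' Q hQ (h2 ▸ Ideal.mul_mem_left _ _ htQ)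
  lia

end PrincipalClosed

end

section

namespace IsStrictSuperficial
variable {K : Ideal A} {w : A} {L : Type} [CommRing L] [Algebra A L] [IsLocalization.Away w L]

theorem isNoetherianRing_blowupAlgebra [IsNoetherianRing A] (hw : IsStrictSuperficial K w) :
    IsNoetherianRing (blowupAlgebra K w hw.mem L) := by
  obtain ⟨n₀, hn₀⟩ := hw.linearBound.exists_stable
  have hfg : (blowupPiece K w L (n₀ + 1)).FG := Submodule.FG.map _ (IsNoetherian.noetherian (K.icF (n₀ + 1)))
  obtain ⟨s, hs⟩ := hfg
  have hP : blowupPiece K w L (n₀ + 1) ≤ Subalgebra.toSubmodule (Algebra.adjoin A (s : Set L)) := by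
    rw [← hs]; exact Algebra.span_le_adjoin A _
  have hall : ∀ j, blowupPiece K w L (n₀ + 1 + j) ≤ Subalgebra.toSubmodule (Algebra.adjoin A (s : Set L)) := by
    intro j
    induction j with
    | zero => exact hP
    | succ j ih =>
      intro z hz
      obtain ⟨f, hf, rfl⟩ := mem_blowupPiece.1 hz
      have h1 := hn₀ (n₀ + 1 + j) (by lia) 1
      rw [pow_one] at h1
      rw [← add_assoc, h1] at hf
      clear hz
      refine Submodule.mul_induction_on hf (fun k hk g hg => ?_) fun x y hx hy => ?_
      · have e : algebraMap A L (k * g) * (IsLocalization.Away.invSelf w : L) ^ (n₀ + 1 + (j + 1)) =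
          (algebraMap A L k * (IsLocalization.Away.invSelf w : L) ^ 1) *
          (algebraMap A L g * (IsLocalization.Away.invSelf w : L) ^ (n₀ + 1 + j)) := by
          rw [map_mul]; ring
        rw [e]
        refine Subalgebra.mul_mem _ (hP (blowupPiece_mono hw.mem (Nat.le_add_left 1 n₀) ?_)) (ih ?_)
        · exact mem_blowupPiece.2 ⟨k, Ideal.pow_le_icF _ _ (by simpa using hk), rfl⟩
        · exact mem_blowupPiece.2 ⟨g, hg, rfl⟩
      · rw [map_add, add_mul]; exact add_mem hx hy
  have hO : blowupAlgebra K w hw.mem L = Algebra.adjoin A (s : Set L) := by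
    refine le_antisymm ?_ (Algebra.adjoin_le fun z hz => ?_)
    · rintro z ⟨j, hj⟩
      exact hall j (blowupPiece_mono hw.mem (by lia) hj)
    · exact ⟨n₀ + 1, hs ▸ Submodule.subset_span hz⟩
  have : (blowupAlgebra K w hw.mem L).FG := ⟨s, hO.symm⟩
  have := (Subalgebra.fg_iff_finiteType _).1 this
  exact Algebra.FiniteType.isNoetherianRing A _

theorem algebraMap_mem_nonZeroDivisors (hw : IsStrictSuperficial K w) :
    algebraMap A (blowupAlgebra K w hw.mem L) w ∈ nonZeroDivisors (blowupAlgebra K w hw.mem L) := by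
  rw [mem_nonZeroDivisors_iff_right]
  intro z hz
  have hz' := congrArg Subtype.val hz
  refine Subtype.ext ((IsLocalization.Away.algebraMap_isUnit (S := L) w).mul_left_eq_zero.1 ?_)
  exact hz'

theorem powersClosed (hw : IsStrictSuperficial K w) :
    PrincipalClosed.PowersClosed (algebraMap A (blowupAlgebra K w hw.mem L) w) := by
  intro n a ha
  set v : L := IsLocalization.Away.invSelf w
  have hvn : algebraMap A L w ^ n * v ^ n = 1 := algebraMap_pow_mul_invSelf_pow n
  rw [Ideal.span_singleton_pow, Ideal.mem_span_singleton]
  suffices h : (a : L) * v ^ n ∈ blowupAlgebra K w hw.mem L by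
    refine ⟨⟨_, h⟩, Subtype.ext ?_⟩
    change (a : L) = algebraMap A L w ^ n * (a * v ^ n)
    linear_combination (-(a : L)) * hvn
  refine hw.mem_blowupAlgebra_of_isIntegral ?_
  rw [Ideal.mem_icF_iff_isIntegralElemOver] at ha
  obtain ⟨d, c, hd, hc, h⟩ := ha
  simp only [Ideal.span_singleton_pow, Ideal.mem_span_singleton] at hc
  have : ∀ i, ∃ c', i ∈ Finset.Icc 1 d → c i = ((algebraMap A (blowupAlgebra K w hw.mem L)) w ^ n) ^ i * c' := by
    intro i
    by_cases hi : i ∈ Finset.Icc 1 d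
    · obtain ⟨c', h'⟩ := hc i hi; exact ⟨c', fun _ => h'⟩
    · exact ⟨0, fun h => absurd h hi⟩
  choose c' hc' using this
  let p : (blowupAlgebra K w hw.mem L)[X] := X ^ d + ∑ i ∈ Finset.Icc 1 d, C (c' i) * X ^ (d - i)
  refine ⟨p, monic_X_pow_add ?_, ?_⟩
  · rw [← mem_degreeLT]
    refine Submodule.sum_mem _ fun i hi => mem_degreeLT.2 ?_
    refine (degree_C_mul_X_pow_le _ _).trans_lt ?_
    rw [Finset.mem_Icc] at hi
    exact_mod_cast Nat.sub_lt hd hi.1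
  · have h' := congrArg (fun z : blowupAlgebra K w hw.mem L => (z : L)) h
    simp only [AddMemClass.coe_add, SubmonoidClass.coe_pow, AddSubmonoidClass.coe_finsetSum,
      MulMemClass.coe_mul, ZeroMemClass.coe_zero] at h'
    rw [eval₂_add, eval₂_pow, eval₂_X, eval₂_finsetSum]
    simp only [eval₂_mul, eval₂_C, eval₂_pow, eval₂_X]
    have h2 := congrArg (fun z => z * (v ^ n) ^ d) h'
    simp only [zero_mul, add_mul, Finset.sum_mul] at h2
    rw [← h2, mul_pow]
    congr 1
    refine Finset.sum_congr rfl fun i hi => ?_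
    rw [hc' i hi, mul_pow]
    change (c' i : L) * _ = (algebraMap A L w ^ n) ^ i * (c' i : L) * _ * _
    have e : (v ^ n) ^ d = (v ^ n) ^ i * (v ^ n) ^ (d - i) := by
      rw [← pow_add]; congr 1; have := (Finset.mem_Icc.1 hi).2; lia
    have e1 : (algebraMap A L w ^ n) ^ i * (v ^ n) ^ i = 1 := by rw [← mul_pow, hvn, one_pow]
    rw [e]
    linear_combination (-(c' i : L) * (a : L) ^ (d - i) * (v ^ n) ^ (d - i)) * e1

end IsStrictSuperficial

end

section

namespace IsStrictSuperficial
variable {K : Ideal A} {w : A} {L : Type} [CommRing L] [Algebra A L] [IsLocalization.Away w L]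

/-- An ideal of the blow-up algebra, as a submodule of the ambient ring. -/
abbrev idealPiece (hw : IsStrictSuperficial K w) (Q : Ideal (blowupAlgebra K w hw.mem L)) :
    Submodule (blowupAlgebra K w hw.mem L) L :=
  Submodule.map (Algebra.linearMap (blowupAlgebra K w hw.mem L) L) Q

variable (hw : IsStrictSuperficial K w) {Q : Ideal (blowupAlgebra K w hw.mem L)}

theorem mul_mem_idealPiece {a z : L} (ha : a ∈ blowupAlgebra K w hw.mem L) (hz : z ∈ hw.idealPiece Q) :
    a * z ∈ hw.idealPiece Q := (hw.idealPiece Q).smul_mem ⟨a, ha⟩ hz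

theorem mem_blowupAlgebra_of_mem_idealPiece {z : L} (hz : z ∈ hw.idealPiece Q) :
    z ∈ blowupAlgebra K w hw.mem L := by
  obtain ⟨y, -, rfl⟩ := hz; exact y.2

theorem mem_idealPiece_of_pow [hQ : Q.IsPrime] {z : L} {n : ℕ} (hn : 0 < n) (hz : z ^ n ∈ hw.idealPiece Q) :
    z ∈ hw.idealPiece Q := by
  have h := hw.mem_blowupAlgebra_of_pow_mem hn (hw.mem_blowupAlgebra_of_mem_idealPiece hz)
  obtain ⟨y, hy, he⟩ := hz
  refine ⟨⟨z, h⟩, hQ.mem_of_pow_mem n ?_, rfl⟩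
  have : (⟨z, h⟩ : blowupAlgebra K w hw.mem L) ^ n = y := Subtype.ext he.symm
  rwa [this]

/-- The elements `z` with `z ^ q / w ^ (r * k)` in `Q`. -/
def rootPiece (hw : IsStrictSuperficial K w) (Q : Ideal (blowupAlgebra K w hw.mem L)) (q s : ℕ) : Set L :=
  {z | z ^ q * (IsLocalization.Away.invSelf w : L) ^ s ∈ hw.idealPiece Q}

theorem add_mem_rootPiece [hQ : Q.IsPrime] {q s : ℕ} (hq : 0 < q) {y z : L}
    (hy : y ∈ hw.rootPiece Q q s) (hz : z ∈ hw.rootPiece Q q s) : y + z ∈ hw.rootPiece Q q s := by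
  change _ ∈ hw.idealPiece Q
  rw [add_pow, Finset.sum_mul]
  refine Submodule.sum_mem _ fun i hi => ?_
  have hi' : i + (q - i) = q := by have := Finset.mem_range.1 hi; lia
  obtain ⟨y', hy', hye⟩ := hy
  obtain ⟨z', hz', hze⟩ := hz
  set v : L := IsLocalization.Away.invSelf w
  have : y ^ i * z ^ (q - i) * v ^ s ∈ hw.idealPiece Q := by
    refine hw.mem_idealPiece_of_pow hq ⟨y' ^ i * z' ^ (q - i), ?_, ?_⟩
    · rcases Nat.eq_zero_or_pos i with rfl | h
      · rw [pow_zero, one_mul]; exact Ideal.pow_mem_of_mem _ hz' _ (by lia)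
      · exact Ideal.mul_mem_right _ _ (Ideal.pow_mem_of_mem _ hy' _ h)
    · have hye : (y' : L) = y ^ q * v ^ s := hye
      have hze : (z' : L) = z ^ q * v ^ s := hze
      change (y' : L) ^ i * (z' : L) ^ (q - i) = _
      rw [hye, hze]
      have e : (v ^ s) ^ q = (v ^ s) ^ i * (v ^ s) ^ (q - i) := by rw [← pow_add, hi']
      rw [mul_pow (_ * _) (v ^ s) q, e]
      ring
  have h2 := hw.mul_mem_idealPiece (natCast_mem (blowupAlgebra K w hw.mem L) (q.choose i)) this
  convert h2 using 1
  ring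

theorem mul_mem_rootPiece {q s t : ℕ} {y z : L}
    (hy : y ^ q * (IsLocalization.Away.invSelf w : L) ^ s ∈ blowupAlgebra K w hw.mem L)
    (hz : z ∈ hw.rootPiece Q q t) : y * z ∈ hw.rootPiece Q q (s + t) := by
  have := hw.mul_mem_idealPiece hy hz
  change _ ∈ hw.idealPiece Q
  convert this using 1
  rw [mul_pow, pow_add]; ring

theorem exists_sub_mem_rootPiece [hQ : Q.IsPrime] (hwQ : algebraMap A _ w ∈ Q) {x : A} {M q r : ℕ}
    (hx : ∀ b ∈ K ^ (M + 1), ∃ g ∈ K.icF M, ∃ f ∈ K.icF (M + 2), b * x = w * g + f) (hrq : r < q)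
    (ht : algebraMap A L x ^ q * (IsLocalization.Away.invSelf w : L) ^ r ∈ blowupAlgebra K w hw.mem L)
    (k : ℕ) (b : A) (hb : b ∈ (K ^ (M + 1)) ^ k) :
    ∃ g ∈ K.icF (k * M), algebraMap A L (b * x ^ k) * (IsLocalization.Away.invSelf w : L) ^ (k * (M + 1))
      - algebraMap A L g * (IsLocalization.Away.invSelf w : L) ^ (k * M) ∈ hw.rootPiece Q q (r * k) := by
  have hq : 0 < q := by lia
  set v : L := IsLocalization.Away.invSelf w with hv
  have hWv : algebraMap A L w * v = 1 := IsLocalization.Away.mul_invSelf w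
  have hO : ∀ {n : ℕ} {a : A}, a ∈ K.icF n → algebraMap A L a * v ^ n ∈ blowupAlgebra K w hw.mem L :=
    fun {n a} h => ⟨n, mem_blowupPiece.2 ⟨a, h, rfl⟩⟩
  induction k generalizing b with
  | zero =>
    refine ⟨b, by simp, ?_⟩
    have : (0 : L) ∈ hw.rootPiece Q q 0 := by
      change _ ∈ hw.idealPiece Q
      rw [zero_pow hq.ne', zero_mul]; exact zero_mem _
    rw [mul_zero]
    convert this using 1
    rw [zero_mul, zero_mul, pow_zero, pow_zero, mul_one, mul_one, mul_one, sub_self]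
  | succ k ih =>
    rw [pow_succ'] at hb
    refine Submodule.mul_induction_on hb (fun b₁ hb₁ b₂ hb₂ => ?_) fun y z hy hz => ?_
    · obtain ⟨g₁, hg₁, f, hf, he⟩ := hx b₁ hb₁
      obtain ⟨g₂, hg₂, hθ⟩ := ih b₂ hb₂
      refine ⟨g₁ * g₂, ?_, ?_⟩
      · have := Ideal.icF_mul_mem hg₁ hg₂
        rwa [show M + k * M = (k + 1) * M by ring] at this
      set θ := algebraMap A L (b₂ * x ^ k) * v ^ (k * (M + 1)) - algebraMap A L g₂ * v ^ (k * M) with hθd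
      have hφ : (algebraMap A L w * (algebraMap A L f * v ^ (M + 2))) ∈ hw.rootPiece Q q r := by
        change _ ∈ hw.idealPiece Q
        have hW : algebraMap A L w ∈ hw.idealPiece Q := ⟨_, hwQ, rfl⟩
        have h1 := hw.mul_mem_idealPiece (Subalgebra.mul_mem _ (Subalgebra.pow_mem _ (hO hf) q)
          (Subalgebra.pow_mem _ (Subalgebra.algebraMap_mem _ w) (q - r - 1))) hW
        convert h1 using 1
        have e : algebraMap A L w ^ q = algebraMap A L w ^ r * (algebraMap A L w ^ (q - r - 1) * algebraMap A L w) := by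
          rw [← pow_succ, ← pow_add]; congr 1; lia
        have e2 : algebraMap A L w ^ r * v ^ r = 1 := by rw [← mul_pow, hWv, one_pow]
        rw [mul_pow, e]
        linear_combination ((algebraMap A L w ^ (q - r - 1) * algebraMap A L w) * (algebraMap A L f * v ^ (M + 2)) ^ q) * e2
      have hmap : algebraMap A L b₁ * algebraMap A L x = algebraMap A L w * algebraMap A L g₁ + algebraMap A L f := by
        rw [← map_mul, he, map_add, map_mul]
      have hγ : algebraMap A L g₁ * v ^ M = algebraMap A L b₁ * v ^ (M + 1) * algebraMap A L x
          - algebraMap A L w * (algebraMap A L f * v ^ (M + 2)) := by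
        rw [pow_succ, pow_succ]
        linear_combination (-v ^ (M+1)) * hmap - v ^ M * algebraMap A L g₁ * hWv
          + algebraMap A L f * v ^ (M + 1) * hWv
      have hb₂x : (algebraMap A L (b₂ * x ^ k) * v ^ (k * (M + 1))) ^ q * v ^ (r * k) ∈ blowupAlgebra K w hw.mem L := by
        have h1 : algebraMap A L b₂ * v ^ (k * (M + 1)) ∈ blowupAlgebra K w hw.mem L := by
          refine hO (Ideal.pow_le_icF _ _ ?_)
          rwa [mul_comm, pow_mul]
        have h2 := Subalgebra.mul_mem _ (Subalgebra.pow_mem _ h1 q) (Subalgebra.pow_mem _ ht k)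
        convert h2 using 1
        rw [map_mul, map_pow, mul_comm r k]; ring
      have h3 : algebraMap A L b₁ * v ^ (M + 1) ∈ blowupAlgebra K w hw.mem L := hO (Ideal.pow_le_icF _ _ hb₁)
      have hγθ : (algebraMap A L g₁ * v ^ M) * θ ∈ hw.rootPiece Q q (r + r * k) := by
        rw [hγ, sub_eq_add_neg, add_mul]
        refine hw.add_mem_rootPiece hq (hw.mul_mem_rootPiece ?_ hθ) (hw.mul_mem_rootPiece ?_ hθ)
        · have := Subalgebra.mul_mem _ (Subalgebra.pow_mem _ h3 q) ht
          convert this using 1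
          ring
        · have := hw.mem_blowupAlgebra_of_mem_idealPiece hφ
          have := Subalgebra.mul_mem _ (Subalgebra.pow_mem _ (neg_mem (one_mem (blowupAlgebra K w hw.mem L))) q) this
          convert this using 1
          ring
      have h4 := hw.mul_mem_rootPiece hb₂x hφ
      rw [add_comm (r * k)] at h4
      have h5 := hw.add_mem_rootPiece hq hγθ h4
      rw [show r * (k + 1) = r + r * k by ring]
      convert h5 using 1
      have e1 : v ^ ((k + 1) * (M + 1)) = v ^ (M + 1) * v ^ (k * (M + 1)) := by rw [← pow_add]; ring_nf
      have e2 : v ^ ((k + 1) * M) = v ^ M * v ^ (k * M) := by rw [← pow_add]; ring_nf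
      rw [hθd, e1, e2, map_mul, map_mul, map_mul, map_mul, map_pow, map_pow]
      linear_combination (-(algebraMap A L b₂ * algebraMap A L x ^ k * v ^ (k * (M + 1)))) * hγ
    · obtain ⟨g, hg, h⟩ := hy
      obtain ⟨g', hg', h'⟩ := hz
      refine ⟨g + g', add_mem hg hg', ?_⟩
      have := hw.add_mem_rootPiece hq h h'
      convert this using 1
      simp only [map_mul, map_add, map_pow]; ring

theorem exists_sub_mem_idealPiece [hQ : Q.IsPrime] (hwQ : algebraMap A _ w ∈ Q) {x : A} {M q r : ℕ}
    (hx : ∀ b ∈ K ^ (M + 1), ∃ g ∈ K.icF M, ∃ f ∈ K.icF (M + 2), b * x = w * g + f) (hrq : r < q)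
    (ht : algebraMap A L x ^ q * (IsLocalization.Away.invSelf w : L) ^ r ∈ blowupAlgebra K w hw.mem L)
    (b : A) (hb : b ∈ (K ^ (M + 1)) ^ q) :
    ∃ g ∈ K.icF (q * M + r), (algebraMap A L b * (IsLocalization.Away.invSelf w : L) ^ (q * (M + 1))) *
      (algebraMap A L x ^ q * (IsLocalization.Away.invSelf w : L) ^ r)
      - algebraMap A L g * (IsLocalization.Away.invSelf w : L) ^ (q * M + r) ∈ hw.idealPiece Q := by
  obtain ⟨g, hg, h⟩ := hw.exists_sub_mem_rootPiece hwQ hx hrq ht q b hb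
  set v : L := IsLocalization.Away.invSelf w with hv
  have h1 : (algebraMap A L b * v ^ (q * (M + 1))) * (algebraMap A L x ^ q * v ^ r)
      - algebraMap A L g * v ^ (q * M + r) ∈ hw.idealPiece Q := by
    refine hw.mem_idealPiece_of_pow (n := q) (by lia) ?_
    change _ ∈ hw.idealPiece Q at h
    convert h using 1
    rw [pow_mul v r q, ← mul_pow, map_mul, map_pow, pow_add]
    ring
  refine ⟨g, hw.mem_icF_of_mem_blowupAlgebra (L := L) ?_, h1⟩
  have h2 := hw.mem_blowupAlgebra_of_mem_idealPiece h1
  have h3 : algebraMap A L b * v ^ (q * (M + 1)) ∈ blowupAlgebra K w hw.mem L := by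
    refine ⟨_, mem_blowupPiece.2 ⟨b, Ideal.pow_le_icF _ _ ?_, rfl⟩⟩
    rwa [mul_comm, pow_mul]
  have h4 := Subalgebra.sub_mem _ (Subalgebra.mul_mem _ h3 ht) h2
  rwa [sub_sub_cancel] at h4

end IsStrictSuperficial

end

theorem isArtinian_of_maximalIdeal_smul_eq_zero [IsLocalRing A] {N : Type} [AddCommGroup N] [Module A N]
    [Module.Finite A N] (h : ∀ a ∈ maximalIdeal A, ∀ x : N, a • x = 0) : IsArtinian A N := by
  have ht : Module.IsTorsionBySet A N (maximalIdeal A : Set A) := fun x a => h a a.2 x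
  let := ht.module
  have : IsScalarTower A (A ⧸ maximalIdeal A) N := ht.isScalarTower
  have : Module.Finite (A ⧸ maximalIdeal A) N := Module.Finite.of_restrictScalars_finite A _ N
  have : IsArtinianRing (A ⧸ maximalIdeal A) := by
    let := Ideal.Quotient.field (maximalIdeal A); infer_instance
  have : IsArtinian (A ⧸ maximalIdeal A) N := isArtinian_of_fg_of_artinian'
  exact isArtinian_of_surjective_algebraMap (R := A ⧸ maximalIdeal A) Ideal.Quotient.mk_surjective

theorem finite_and_isField_of_mul_le [IsLocalRing A] {Λ : Type} [CommRing Λ] [IsDomain Λ] [Algebra A Λ]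
    (h : ∀ a ∈ maximalIdeal A, algebraMap A Λ a = 0) (P : ℕ → Submodule A Λ) (hmono : Monotone P)
    (hfg : ∀ j, (P j).FG) (hunion : ∀ x, ∃ j, x ∈ P j) {t : Λ} (ht : t ≠ 0) {j₀ : ℕ}
    (hmul : ∀ j ≥ j₀, ∀ y ∈ P (j + 1), t * y ∈ P j) : Module.Finite A Λ ∧ IsField Λ := by
  have hstep : ∀ j ≥ j₀, P (j + 1) ≤ P j := by
    intro j hj x hx
    have : Module.Finite A (P (j + 1)) := Module.Finite.iff_fg.2 (hfg _)
    have : IsArtinian A (P (j + 1)) := isArtinian_of_maximalIdeal_smul_eq_zero fun a ha y =>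
      Subtype.ext (by
        change a • (y : Λ) = 0
        rw [Algebra.smul_def, h a ha, zero_mul])
    let f : P (j + 1) →ₗ[A] P (j + 1) := ((LinearMap.mulLeft A t).comp (P (j + 1)).subtype).codRestrict _
      fun y => hmono j.le_succ (hmul j hj y y.2)
    have hf : Function.Injective f := fun y z hyz =>
      Subtype.ext (mul_left_cancel₀ ht (congrArg Subtype.val hyz))
    obtain ⟨y, hy⟩ := IsArtinian.surjective_of_injective_endomorphism f hf ⟨x, hx⟩
    have : t * (y : Λ) = x := congrArg Subtype.val hy
    rw [← this]
    exact hmul j hj y y.2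
  have hall : ∀ k, P (j₀ + k) ≤ P j₀ := by
    intro k
    induction k with
    | zero => exact le_rfl
    | succ k ih => exact (hstep (j₀ + k) (by lia)).trans ih
  have htop : P j₀ = ⊤ := top_le_iff.1 fun x _ => by
    obtain ⟨j, hj⟩ := hunion x
    exact hall j (hmono (by lia) hj)
  have hfin : Module.Finite A Λ := ⟨htop ▸ hfg j₀⟩
  refine ⟨hfin, ?_⟩
  have : IsArtinian A Λ := isArtinian_of_maximalIdeal_smul_eq_zero fun a ha y => by
    rw [Algebra.smul_def, h a ha, zero_mul]
  have : IsArtinianRing Λ := isArtinian_of_tower A this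
  exact IsArtinianRing.isField_of_isDomain Λ

theorem exists_sub_mem_maximalIdeal_localization {O : Type} [CommRing O] (Q : Ideal O) [hQ : Q.IsMaximal]
    (x : Localization.AtPrime Q) : ∃ o : O, x - algebraMap O _ o ∈ maximalIdeal (Localization.AtPrime Q) := by
  obtain ⟨⟨a, s⟩, hs⟩ := IsLocalization.surj Q.primeCompl x
  obtain ⟨b, y, hy, hb⟩ := hQ.exists_inv s.2
  refine ⟨a * b, ?_⟩
  have hu := IsLocalization.map_units (Localization.AtPrime Q) s
  rw [← Ideal.mul_unit_mem_iff_mem _ hu, sub_mul]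
  simp only at hs
  rw [hs, ← map_mul, ← map_sub, ← Localization.AtPrime.map_eq_maximalIdeal]
  refine Ideal.mem_map_of_mem _ ?_
  have : a - a * b * s = a * y := by linear_combination (-a) * hb
  rw [this]; exact Ideal.mul_mem_left _ _ hy

theorem finite_localization [IsLocalRing A] [IsAdicComplete (maximalIdeal A) A] {O : Type} [CommRing O]
    [IsNoetherianRing O] [Algebra A O] (Q : Ideal O) [hQ : Q.IsMaximal] [Module.Finite A (O ⧸ Q)]
    {p : O} (hmax : maximalIdeal (Localization.AtPrime Q) = Ideal.span {algebraMap O (Localization.AtPrime Q) p})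
    {w : A} (hw : w ∈ maximalIdeal A) (hw0 : algebraMap A (Localization.AtPrime Q) w ≠ 0)
    (hmQ : ∀ a ∈ maximalIdeal A, algebraMap A O a ∈ Q) :
    Module.Finite A (Localization.AtPrime Q) := by
  set W := Localization.AtPrime Q
  have hbase : ∃ N : Submodule A W, N.FG ∧ ∀ x, ∃ y ∈ N, x - y ∈ maximalIdeal W := by
    obtain ⟨n, e, he⟩ := Submodule.fg_iff_exists_fin_generating_family.1 (Module.Finite.fg_top (R := A) (M := O ⧸ Q))
    choose e' he' using fun i => Ideal.Quotient.mk_surjective (e i)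
    refine ⟨Submodule.span A (Set.range fun i => algebraMap O W (e' i)), Submodule.fg_span (Set.finite_range _), fun x => ?_⟩
    obtain ⟨o, ho⟩ := exists_sub_mem_maximalIdeal_localization Q x
    obtain ⟨c, hc⟩ := (Submodule.mem_span_range_iff_exists_fun A).1 (he ▸ Submodule.mem_top : Ideal.Quotient.mk Q o ∈ _)
    refine ⟨∑ i, c i • algebraMap O W (e' i), (Submodule.mem_span_range_iff_exists_fun A).2 ⟨c, rfl⟩, ?_⟩
    have h1 : o - ∑ i, c i • e' i ∈ Q := by
      rw [← Ideal.Quotient.eq_zero_iff_mem, map_sub, ← hc, map_sum, sub_eq_zero]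
      refine Finset.sum_congr rfl fun i _ => ?_
      rw [Algebra.smul_def, Algebra.smul_def, map_mul, he']; rfl
    have h2 := Ideal.mem_map_of_mem (algebraMap O W) h1
    rw [Localization.AtPrime.map_eq_maximalIdeal, map_sub, map_sum] at h2
    have h3 := add_mem ho h2
    rw [sub_add_sub_cancel] at h3
    convert h3 using 2
    refine Finset.sum_congr rfl fun i _ => ?_
    rw [Algebra.smul_def, Algebra.smul_def, map_mul, ← IsScalarTower.algebraMap_apply A O W]
  obtain ⟨N₁, hN₁, hN₁'⟩ := hbase
  set π := algebraMap O W p with hπ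
  have hpow : ∀ k, ∃ N : Submodule A W, N.FG ∧ ∀ x, ∃ y ∈ N, π ^ k ∣ x - y := by
    intro k
    induction k with
    | zero => exact ⟨⊥, Submodule.fg_bot, fun x => ⟨0, zero_mem _, by simp⟩⟩
    | succ k ih =>
      obtain ⟨N, hN, hN'⟩ := ih
      refine ⟨N ⊔ N₁.map (LinearMap.mulLeft A (π ^ k)), hN.sup (hN₁.map _), fun x => ?_⟩
      obtain ⟨y, hy, z, hz⟩ := hN' x
      obtain ⟨y', hy', hz'⟩ := hN₁' z
      rw [hmax, Ideal.mem_span_singleton] at hz'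
      obtain ⟨z', hz'⟩ := hz'
      refine ⟨y + π ^ k * y', add_mem (Submodule.mem_sup_left hy) (Submodule.mem_sup_right ⟨y', hy', rfl⟩), z', ?_⟩
      rw [pow_succ]; linear_combination hz + π ^ k * hz'
  obtain ⟨k, u, hu, hk⟩ := IsLocalRing.exists_eq_unit_mul_pow hmax hw0
  obtain ⟨N, hN, hN'⟩ := hpow k
  obtain ⟨n, e, he⟩ := Submodule.fg_iff_exists_fin_generating_family.1 hN
  have hle : (maximalIdeal A).map (algebraMap A W) ≤ maximalIdeal W := by
    rw [Ideal.map_le_iff_le_comap, ← Localization.AtPrime.map_eq_maximalIdeal]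
    intro a ha
    rw [Ideal.mem_comap, IsScalarTower.algebraMap_apply A O W]
    exact Ideal.mem_map_of_mem _ (hmQ a ha)
  have : IsHausdorff ((maximalIdeal A).map (algebraMap A W)) W :=
    IsHausdorff.of_le_jacobson _ _ (hle.trans (IsLocalRing.maximalIdeal_le_jacobson _))
  have := Module.Finite.of_isPrecomplete (maximalIdeal A) n e fun x => by
    obtain ⟨y, hy, z, hz⟩ := hN' x
    rw [← he] at hy
    obtain ⟨c, rfl⟩ := (Submodule.mem_span_range_iff_exists_fun A).1 hy
    refine ⟨c, ?_⟩
    obtain ⟨g, hg⟩ := hu.exists_left_inv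
    have : x - ∑ i, c i • e i = (g * z) * algebraMap A W w := by
      rw [hz]
      have hk' : algebraMap A W w = u * π ^ k := hk
      rw [hk']; linear_combination (-π ^ k * z) * hg
    rw [this]
    exact Ideal.mul_mem_left _ _ (Ideal.mem_map_of_mem _ hw)
  refine ⟨Submodule.fg_iff_exists_fin_generating_family.2 ⟨n, e, top_le_iff.1 fun x _ => ?_⟩⟩
  obtain ⟨c, hc⟩ := this x
  exact (Submodule.mem_span_range_iff_exists_fun A).2 ⟨c, hc.symm⟩

section

/-- `x, y` is a regular sequence. -/
structure IsRegularPair (x y : A) : Prop where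
  nzd : x ∈ nonZeroDivisors A
  dvd : ∀ a b, y * a = x * b → x ∣ a

namespace IsRegularPair
variable {x y : A}

theorem pow_right (h : IsRegularPair x y) (n : ℕ) : IsRegularPair x (y ^ n) := by
  refine ⟨h.nzd, ?_⟩
  induction n with
  | zero => exact fun a b hab => ⟨b, by simpa using hab⟩
  | succ n ih =>
    intro a b hab
    obtain ⟨c, hc⟩ := h.dvd (y ^ n * a) b (by rw [← hab]; ring)
    exact ih _ _ hc

theorem eq_zero_of_mul_eq [IsLocalRing A] [IsNoetherianRing A] (h : IsRegularPair x y)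
    (hx : x ∈ maximalIdeal A) {f c : A} (hf : f * y = x * (f * c)) : f = 0 := by
  have key : ∀ n, ∀ f : A, f * y = x * (f * c) → x ^ n ∣ f := by
    intro n
    induction n with
    | zero => simp
    | succ n ih =>
      intro f hf
      obtain ⟨g, rfl⟩ := h.dvd f _ (by rw [mul_comm]; exact hf)
      obtain ⟨k, hk⟩ := ih g ((mul_cancel_left_mem_nonZeroDivisors h.nzd).1 (by linear_combination hf))
      exact ⟨k, by rw [pow_succ']; linear_combination x * hk⟩
  refine IsHausdorff.eq_zero_of_forall_mem_pow (I := maximalIdeal A) fun n => ?_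
  obtain ⟨k, hk⟩ := key n f hf
  rw [hk]
  exact Ideal.mul_mem_right _ _ (Ideal.pow_mem_pow hx n)

end IsRegularPair

theorem IsIntegral.exists_pow_eq_mul {W : Type} [CommRing W] [Algebra A W] {a b : A} {y : W} (hy : IsIntegral A y)
    (h : algebraMap A W a * y = algebraMap A W b) : ∃ d c, algebraMap A W (b ^ d) = algebraMap A W (a * c) := by
  obtain ⟨p, hp, hpy⟩ := hy
  have h1 := Polynomial.scaleRoots_eval₂_eq_zero (p := p) (algebraMap A W) (r := y) (s := a) hpy
  rw [h, Polynomial.eval₂_at_apply, Polynomial.eval_eq_sum_range, Polynomial.natDegree_scaleRoots,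
    Finset.sum_range_succ, Polynomial.coeff_scaleRoots_natDegree, hp, one_mul] at h1
  have h2 : a ∣ ∑ i ∈ Finset.range p.natDegree, (p.scaleRoots a).coeff i * b ^ i := by
    refine Finset.dvd_sum fun i hi => ?_
    rw [Polynomial.coeff_scaleRoots]
    exact ((dvd_pow_self a (by have := Finset.mem_range.1 hi; lia)).mul_left _).mul_right _
  obtain ⟨c, hc⟩ := h2
  refine ⟨p.natDegree, -c, ?_⟩
  rw [hc, map_add] at h1
  rw [mul_neg, map_neg]; linear_combination h1

theorem exists_primeCompl_mul_eq_zero [IsNoetherianRing A] {O : Type} [CommRing O] [Algebra A O] (Q : Ideal O)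
    [Q.IsPrime] : ∃ s : Q.primeCompl, ∀ a, algebraMap A (Localization.AtPrime Q) a = 0 →
      (s : O) * algebraMap A O a = 0 := by
  have hmemker : ∀ a, algebraMap A (Localization.AtPrime Q) a = 0 ↔
      ∃ s : Q.primeCompl, (s : O) * algebraMap A O a = 0 := by
    intro a
    rw [IsScalarTower.algebraMap_apply A O (Localization.AtPrime Q), IsLocalization.map_eq_zero_iff Q.primeCompl]
  obtain ⟨G, hG⟩ := IsNoetherian.noetherian (RingHom.ker (algebraMap A (Localization.AtPrime Q)))
  have hG' : ∀ g : G, ∃ s : Q.primeCompl, (s : O) * algebraMap A O (g : A) = 0 := by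
    intro g
    rw [← hmemker, ← RingHom.mem_ker, ← hG]
    exact Ideal.subset_span g.2
  choose σ hσ using hG'
  classical
  refine ⟨∏ g, σ g, fun a ha => ?_⟩
  replace ha : a ∈ Ideal.span (G : Set A) := by
    rw [← Ideal.submodule_span_eq, hG]; exact ha
  induction ha using Submodule.span_induction with
  | mem g hg =>
    rw [← Finset.mul_prod_erase _ _ (Finset.mem_univ ⟨g, hg⟩), Submonoid.coe_mul, mul_right_comm, hσ ⟨g, hg⟩, zero_mul]
  | zero => simp
  | add a b _ _ ha hb => rw [map_add, mul_add, ha, hb, add_zero]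
  | smul c a _ ha => rw [smul_eq_mul, map_mul, mul_left_comm, ha, mul_zero]

namespace IsStrictSuperficial
variable {K : Ideal A} {w : A} {L : Type} [CommRing L] [Algebra A L] [IsLocalization.Away w L]

theorem finite_quotient_and_isMaximal [IsLocalRing A] [IsNoetherianRing A] (hw : IsStrictSuperficial K w)
    {Q : Ideal (blowupAlgebra K w hw.mem L)} [hQ : Q.IsPrime]
    (hmQ : ∀ a ∈ maximalIdeal A, algebraMap A (blowupAlgebra K w hw.mem L) a ∈ Q)
    (hwQ : algebraMap A _ w ∈ Q) {x : A} {M q r : ℕ}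
    (hx : ∀ b ∈ K ^ (M + 1), ∃ g ∈ K.icF M, ∃ f ∈ K.icF (M + 2), b * x = w * g + f) (hrq : r < q)
    {t : blowupAlgebra K w hw.mem L}
    (ht : (t : L) = algebraMap A L x ^ q * (IsLocalization.Away.invSelf w : L) ^ r) (htQ : t ∉ Q) :
    Module.Finite A (blowupAlgebra K w hw.mem L ⧸ Q) ∧ Q.IsMaximal := by
  set v : L := IsLocalization.Away.invSelf w with hv
  have hle : ∀ j, blowupPiece K w L j ≤ Subalgebra.toSubmodule (blowupAlgebra K w hw.mem L) := fun j z hz => ⟨j, hz⟩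
  let P : ℕ → Submodule A (blowupAlgebra K w hw.mem L ⧸ Q) := fun j =>
    LinearMap.range ((Ideal.Quotient.mkₐ A Q).toLinearMap.comp (Submodule.inclusion (hle j)))
  have hP : ∀ j y, y ∈ P j ↔ ∃ z : blowupAlgebra K w hw.mem L, (z : L) ∈ blowupPiece K w L j ∧ Ideal.Quotient.mk Q z = y := by
    intro j y
    constructor
    · rintro ⟨z, rfl⟩; exact ⟨⟨z, hle j z.2⟩, z.2, rfl⟩
    · rintro ⟨z, hz, rfl⟩; exact ⟨⟨z, hz⟩, rfl⟩
  obtain ⟨n₀, hn₀⟩ := hw.linearBound.exists_stable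
  have key : ∀ s, ∀ f ∈ K ^ (q * (M + 1)) * K.icF s, ∃ z : blowupAlgebra K w hw.mem L,
      (z : L) ∈ blowupPiece K w L (q * M + r + s) ∧
      algebraMap A L f * v ^ (q * (M + 1) + s) * t - z ∈ hw.idealPiece Q := by
    intro s f hf
    refine Submodule.mul_induction_on hf (fun b hb g hg => ?_) fun y z hy hz => ?_
    · obtain ⟨g', hg', h⟩ := hw.exists_sub_mem_idealPiece hwQ hx hrq (ht ▸ t.2) b (by rwa [← pow_mul, mul_comm])
      have hgO : algebraMap A L g * v ^ s ∈ blowupAlgebra K w hw.mem L := ⟨s, mem_blowupPiece.2 ⟨g, hg, rfl⟩⟩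
      have h' := hw.mul_mem_idealPiece hgO h
      have hz : algebraMap A L (g' * g) * v ^ (q * M + r + s) ∈ blowupPiece K w L (q * M + r + s) :=
        mem_blowupPiece.2 ⟨_, Ideal.icF_mul_le _ _ _ (Ideal.mul_mem_mul hg' hg), rfl⟩
      refine ⟨⟨algebraMap A L (g' * g) * v ^ (q * M + r + s), hle _ hz⟩, hz, ?_⟩
      convert h' using 1
      change _ - algebraMap A L (g' * g) * v ^ (q * M + r + s) = _
      rw [ht, map_mul, map_mul, pow_add, pow_add]; ring
    · obtain ⟨y', hy', hy⟩ := hy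
      obtain ⟨z', hz', hz⟩ := hz
      refine ⟨y' + z', add_mem hy' hz', ?_⟩
      convert add_mem hy hz using 1
      rw [map_add]; push_cast; ring
  have hcl := finite_and_isField_of_mul_le (A := A) (Λ := blowupAlgebra K w hw.mem L ⧸ Q)
    (fun a ha => Ideal.Quotient.eq_zero_iff_mem.2 (hmQ a ha)) P
    (fun i j hij y hy => by
      rw [hP] at hy ⊢
      obtain ⟨z, hz, rfl⟩ := hy
      exact ⟨z, blowupPiece_mono hw.mem hij hz, rfl⟩)
    (fun j => by
      have : Module.Finite A (blowupPiece K w L j) :=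
        Module.Finite.iff_fg.2 (Submodule.FG.map _ (IsNoetherian.noetherian (K.icF j)))
      exact Module.Finite.iff_fg.1 inferInstance)
    (fun y => by
      obtain ⟨z, rfl⟩ := Ideal.Quotient.mk_surjective y
      obtain ⟨j, hj⟩ := z.2
      exact ⟨j, (hP j _).2 ⟨z, hj, rfl⟩⟩)
    (t := Ideal.Quotient.mk Q t) (fun h => htQ (Ideal.Quotient.eq_zero_iff_mem.1 h))
    (j₀ := n₀ + q * (M + 1))
    (fun j hj y hy => by
      rw [hP] at hy ⊢
      obtain ⟨z, hz, rfl⟩ := hy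
      rw [mem_blowupPiece] at hz
      obtain ⟨f, hf, hz⟩ := hz
      obtain ⟨s, hs⟩ : ∃ s, j + 1 = s + q * (M + 1) := ⟨j + 1 - q * (M + 1), by lia⟩
      rw [hs, hn₀ s (by lia)] at hf
      obtain ⟨y, hy, y', hy', hye⟩ := key s f hf
      refine ⟨y, blowupPiece_mono hw.mem ?_ hy, ?_⟩
      · have : q * (M + 1) = q * M + q := by ring
        lia
      · rw [eq_comm, ← map_mul, Ideal.Quotient.eq]
        have hye : (y' : L) = algebraMap A L f * v ^ (q * (M + 1) + s) * t - y := hye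
        have : t * z - y = y' := Subtype.ext (by
          change (t : L) * z - y = y'
          rw [hye, ← hz, hs, add_comm s]; ring)
        rwa [this])
  exact ⟨hcl.1, Ideal.Quotient.maximal_of_isField _ hcl.2⟩

theorem mem_icF_one_of_isLocalization (L : Type) [CommRing L] [Algebra A L] [IsLocalization.Away w L] [IsLocalRing A] [IsNoetherianRing A] [IsAdicComplete (maximalIdeal A) A]
    (hw : IsStrictSuperficial K w) (hK : K ≤ maximalIdeal A) {N : ℕ} (hN : maximalIdeal A ^ N ≤ K)
    {x₁ x₂ : A} (hx₁ : x₁ ∈ K) (hx₂ : x₂ ∈ K) (hreg : IsRegularPair x₁ x₂) {x : A} {M : ℕ}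
    (hx : ∀ b ∈ K ^ (M + 1), ∃ g ∈ K.icF M, ∃ f ∈ K.icF (M + 2), b * x = w * g + f) :
    x ∈ K.icF 1 := by
  let v : L := IsLocalization.Away.invSelf w
  by_contra hcon
  have := hw.isNoetherianRing_blowupAlgebra (L := L)
  have hKO : ∀ a ∈ K, algebraMap A (blowupAlgebra K w hw.mem L) w ∣ algebraMap A _ a := by
    intro a ha
    have ha' : algebraMap A L a * v ^ 1 ∈ blowupAlgebra K w hw.mem L :=
      ⟨1, mem_blowupPiece.2 ⟨a, by simpa using K.pow_le_icF 1 (by simpa using ha), rfl⟩⟩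
    refine ⟨⟨_, ha'⟩, Subtype.ext ?_⟩
    change algebraMap A L a = algebraMap A L w * (algebraMap A L a * v ^ 1)
    linear_combination (-algebraMap A L a) * algebraMap_pow_mul_invSelf_pow (w := w) (L := L) 1
  have hndvd : ¬ algebraMap A (blowupAlgebra K w hw.mem L) w ∣ algebraMap A _ x := by
    rintro ⟨z, hz⟩
    have hz : algebraMap A L x = algebraMap A L w * z := congrArg Subtype.val hz
    refine hcon (hw.mem_icF_of_mem_blowupAlgebra (L := L) ?_)
    have : algebraMap A L x * v ^ 1 = z := by
      linear_combination v * hz + z * algebraMap_pow_mul_invSelf_pow (w := w) (L := L) 1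
    change algebraMap A L x * v ^ 1 ∈ _
    rw [this]; exact z.2
  obtain ⟨Q, hQ, hwQ, ⟨p, hpQ, hmax⟩, q, r, t, hrq, ht, htQ⟩ := PrincipalClosed.exists_prime_of_not_dvd
    hw.algebraMap_mem_nonZeroDivisors hw.powersClosed hndvd
  have hmQ : ∀ a ∈ maximalIdeal A, algebraMap A (blowupAlgebra K w hw.mem L) a ∈ Q := by
    intro a ha
    refine hQ.mem_of_pow_mem N ?_
    rw [← map_pow]
    exact Ideal.mem_of_dvd _ (hKO _ (hN (Ideal.pow_mem_pow ha N))) hwQ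
  have htL : (t : L) = algebraMap A L x ^ q * v ^ r := by
    have : algebraMap A L x ^ q = algebraMap A L w ^ r * t := congrArg Subtype.val ht
    linear_combination (-t : L) * algebraMap_pow_mul_invSelf_pow (w := w) (L := L) r - v ^ r * this
  obtain ⟨hfin, hQmax⟩ := hw.finite_quotient_and_isMaximal hmQ hwQ hx hrq htL htQ
  set W := Localization.AtPrime Q with hW
  have hw0 : algebraMap A W w ≠ 0 := by
    intro h
    rw [IsScalarTower.algebraMap_apply A (blowupAlgebra K w hw.mem L) W, IsLocalization.map_eq_zero_iff Q.primeCompl] at h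
    obtain ⟨s, hs⟩ := h
    have := mem_nonZeroDivisors_iff_right.1 (hw.algebraMap_mem_nonZeroDivisors (L := L)) s hs
    exact s.2 (this ▸ Q.zero_mem)
  have hfinW := finite_localization Q hmax (hK hw.mem) hw0 hmQ
  have hinj := hw.algebraMap_injective (L := L)
  obtain ⟨s, hs⟩ := exists_primeCompl_mul_eq_zero (A := A) Q
  obtain ⟨n, f, hf⟩ : ∃ n f, algebraMap A L f * v ^ n = s := by
    obtain ⟨j, hj⟩ := (s : blowupAlgebra K w hw.mem L).2
    obtain ⟨f, -, hf⟩ := mem_blowupPiece.1 hj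
    exact ⟨j, f, hf⟩
  have hfker : ∀ a, algebraMap A W a = 0 → f * a = 0 := by
    intro a ha
    have h1 : ((s : blowupAlgebra K w hw.mem L) : L) * algebraMap A L a = 0 := congrArg Subtype.val (hs a ha)
    refine hw.algebraMap_injective (L := L) ?_
    rw [map_mul, map_zero]
    linear_combination algebraMap A L w ^ n * h1 - algebraMap A L f * algebraMap A L a *
      algebraMap_pow_mul_invSelf_pow (w := w) (L := L) n + algebraMap A L w ^ n * algebraMap A L a * hf
  have hf0 : f ≠ 0 := by
    rintro rfl
    have : (s : blowupAlgebra K w hw.mem L) = 0 := Subtype.ext (by rw [← hf]; simp)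
    exact s.2 (this ▸ Q.zero_mem)
  have hx₁0 : algebraMap A W x₁ ≠ 0 := fun h =>
    hf0 ((mul_right_mem_nonZeroDivisors_eq_zero_iff hreg.nzd).1 (hfker _ h))
  obtain ⟨k, u, hu, hk⟩ := IsLocalRing.exists_eq_unit_mul_pow hmax hx₁0
  have hx₂m : algebraMap A W x₂ ∈ maximalIdeal W := by
    rw [IsScalarTower.algebraMap_apply A (blowupAlgebra K w hw.mem L) W, ← Localization.AtPrime.map_eq_maximalIdeal]
    exact Ideal.mem_map_of_mem _ (hmQ _ (hK hx₂))
  rw [hmax, Ideal.mem_span_singleton] at hx₂m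
  obtain ⟨z, hz⟩ := hx₂m
  obtain ⟨u', hu'⟩ := hu.exists_left_inv
  obtain ⟨d, c, hdc⟩ := IsIntegral.exists_pow_eq_mul (a := x₁) (b := x₂ ^ k) (y := u' * z ^ k)
    (Algebra.IsIntegral.isIntegral (R := A) _) (by
      rw [map_pow, hz, mul_pow, hk]; linear_combination (algebraMap _ W p ^ k * z ^ k) * hu')
  have h0 := hfker (x₂ ^ (k * d) - x₁ * c) (by rw [map_sub, pow_mul, hdc, sub_self])
  exact hf0 ((hreg.pow_right (k * d)).eq_zero_of_mul_eq (hK hx₁) (c := c) (by linear_combination h0))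

theorem mem_icF_one [IsLocalRing A] [IsNoetherianRing A] [IsAdicComplete (maximalIdeal A) A]
    (hw : IsStrictSuperficial K w) (hK : K ≤ maximalIdeal A) {N : ℕ} (hN : maximalIdeal A ^ N ≤ K)
    {x₁ x₂ : A} (hx₁ : x₁ ∈ K) (hx₂ : x₂ ∈ K) (hreg : IsRegularPair x₁ x₂) {x : A} {M : ℕ}
    (hx : ∀ b ∈ K ^ (M + 1), ∃ g ∈ K.icF M, ∃ f ∈ K.icF (M + 2), b * x = w * g + f) :
    x ∈ K.icF 1 :=
  mem_icF_one_of_isLocalization (Localization.Away w) hw hK hN hx₁ hx₂ hreg hx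

end IsStrictSuperficial

end

theorem Ideal.pow_mul_le_of_mul_le {K : Ideal A} {Q : ℕ → Ideal A} (hQ : ∀ n, K * Q n ≤ Q (n + 1)) (m n : ℕ) :
    K ^ m * Q n ≤ Q (n + m) := by
  induction m with
  | zero => simp
  | succ m ih =>
    rw [pow_succ', mul_assoc]
    exact (Ideal.mul_mono_right ih).trans (hQ _)

theorem Ideal.exists_torsion_bound [IsNoetherianRing A] (K : Ideal A) (F Q : ℕ → Ideal A) (hF : ∀ n, F (n + 1) ≤ F n)
    (hQ : ∀ n, Q (n + 1) ≤ Q n) (hKF : ∀ n, K * F n ≤ F (n + 1)) (hKQ : ∀ n, K * Q n ≤ Q (n + 1))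
    (hb : ∃ c, ∀ n, F (n + c) ≤ K ^ n) :
    ∃ c, ∀ j ≥ c, ∀ g ∈ F j, (∃ M, ∀ b ∈ K ^ M, b * g ∈ Q (j + M)) → g ∈ Q j := by
  obtain ⟨c, hc⟩ := hb
  have hmono : ∀ {j M M' : ℕ} {g : A}, M ≤ M' → (∀ b ∈ K ^ M, b * g ∈ Q (j + M)) → ∀ b ∈ K ^ M', b * g ∈ Q (j + M') := by
    intro j M M' g hM h b hb
    obtain ⟨e, rfl⟩ := Nat.exists_eq_add_of_le hM
    rw [pow_add] at hb
    refine Submodule.mul_induction_on hb (fun x hx y hy => ?_) fun x y hx hy => ?_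
    · rw [mul_comm x, mul_assoc, ← add_assoc]
      exact Ideal.pow_mul_le_of_mul_le hKQ e (j + M) (Ideal.mul_mem_mul hy (h x hx))
    · rw [add_mul]; exact add_mem hx hy
  let H : ℕ → Ideal A := fun j =>
    { carrier := {g | g ∈ F j ∧ ∃ M, ∀ b ∈ K ^ M, b * g ∈ Q (j + M)}
      zero_mem' := ⟨zero_mem _, 0, fun b _ => by simp⟩
      add_mem' := by
        rintro x y ⟨hx, M, hM⟩ ⟨hy, M', hM'⟩
        refine ⟨add_mem hx hy, max M M', fun b hb => ?_⟩
        rw [mul_add]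
        exact add_mem (hmono (le_max_left _ _) hM b hb) (hmono (le_max_right _ _) hM' b hb)
      smul_mem' := by
        rintro a x ⟨hx, M, hM⟩
        refine ⟨Ideal.mul_mem_left _ _ hx, M, fun b hb => ?_⟩
        rw [smul_eq_mul, mul_left_comm]
        exact Ideal.mul_mem_left _ _ (hM b hb) }
  obtain ⟨n₀, hn₀⟩ := Ideal.exists_stable_of_le_pow K H
    (fun n x hx => ⟨hF _ hx.1, hx.2.imp fun M hM b hb => by
      have := hM b hb
      rw [add_right_comm] at this
      exact hQ _ this⟩)
    (fun n => Ideal.mul_le.2 fun k hk x hx => ⟨hKF _ (Ideal.mul_mem_mul hk hx.1), hx.2.imp fun M hM b hb => by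
      rw [mul_left_comm, add_right_comm]
      exact hKQ _ (Ideal.mul_mem_mul hk (hM b hb))⟩) c
    (fun n x hx => hc n hx.1)
  have hpow : ∀ i, H (n₀ + i) = K ^ i * H n₀ := by
    intro i
    induction i with
    | zero => simp
    | succ i ih => rw [← add_assoc, hn₀ _ (by lia), ih, pow_succ', mul_assoc]
  obtain ⟨M, hM⟩ : ∃ M, ∀ g ∈ H n₀, ∀ b ∈ K ^ M, b * g ∈ Q (n₀ + M) := by
    obtain ⟨G, hG⟩ := IsNoetherian.noetherian (H n₀)
    have hG' : ∀ g : G, ∃ M, ∀ b ∈ K ^ M, b * (g : A) ∈ Q (n₀ + M) := fun g =>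
      (hG ▸ Ideal.subset_span g.2 : (g : A) ∈ H n₀).2
    choose M hM using hG'
    refine ⟨Finset.univ.sup M, fun g hg => ?_⟩
    rw [← hG] at hg
    induction hg using Submodule.span_induction with
    | mem g hg => exact hmono (Finset.le_sup (f := M) (Finset.mem_univ ⟨g, hg⟩)) (hM ⟨g, hg⟩)
    | zero => simp
    | add x y _ _ hx hy => exact fun b hb => by rw [mul_add]; exact add_mem (hx b hb) (hy b hb)
    | smul a x _ hx =>
      intro b hb
      rw [smul_eq_mul, mul_left_comm]
      exact Ideal.mul_mem_left _ _ (hx b hb)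
  refine ⟨n₀ + M, fun j hj g hg hgM => ?_⟩
  obtain ⟨e, rfl⟩ := Nat.exists_eq_add_of_le hj
  have hgH : g ∈ H (n₀ + (e + M)) := by rw [← add_assoc, add_right_comm]; exact ⟨hg, hgM⟩
  rw [hpow, pow_add, mul_assoc] at hgH
  have hle : K ^ M * H n₀ ≤ Q (n₀ + M) := Ideal.mul_le.2 fun b hb x hx => hM x hx b hb
  exact ((Ideal.mul_mono_right hle).trans (Ideal.pow_mul_le_of_mul_le hKQ e _)) hgH

/-- Iterated Dedekind–Mertens. -/
theorem dedekindMertens_pow (a : ℕ → A) (s : ℕ) (Q : ℕ → Ideal A)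
    (hQ : ∀ n, Ideal.span (a '' Set.Iio s) * Q n ≤ Q (n + 1)) (D d : ℕ) :
    ∃ e, ∀ (g : A[X]) n, g.degree < d → genPoly a s ^ D * g ∈ (Q n).map C →
      ∀ x ∈ Ideal.span (a '' Set.Iio s) ^ (D + e), C x * g ∈ (Q (n + e)).map (C : A →+* A[X]) := by
  induction D with
  | zero => exact ⟨0, fun g n _ hg x _ => Ideal.mul_mem_left _ _ (by simpa using hg)⟩
  | succ D ih =>
    obtain ⟨e, he⟩ := ih
    by_cases hw : genPoly a s = 0
    · have h0 : Ideal.span (a '' Set.Iio s) = ⊥ := by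
        rw [Ideal.span_eq_bot]
        rintro _ ⟨i, hi, rfl⟩
        have := genPoly_coeff a s i
        rw [hw, coeff_zero, if_pos (show i < s from hi)] at this
        exact this.symm
      refine ⟨0, fun g n _ _ x hx => ?_⟩
      rw [h0, Ideal.bot_pow (by lia)] at hx
      rw [Ideal.mem_bot.1 hx]; simp
    obtain ⟨M, hM⟩ := dedekindMertens a s (D * s + d)
    have hdeg : (genPoly a s).natDegree < s := by
      rw [Polynomial.natDegree_lt_iff_degree_lt hw, degree_lt_iff_coeff_zero]
      intro m hm
      rw [genPoly_coeff, if_neg (by lia)]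
    refine ⟨e + M, fun g n hg hgQ x hx => ?_⟩
    rw [show D + 1 + (e + M) = (D + e) + (M + 1) by ring, pow_add] at hx
    refine Submodule.mul_induction_on hx (fun y hy z hz => ?_) fun y z hy hz => ?_
    · have h1 := hM (Q n) (genPoly a s ^ D * g) (by
        by_cases hg0 : genPoly a s ^ D * g = 0
        · rw [hg0, degree_zero]; exact WithBot.bot_lt_coe _
        have hg0' : g ≠ 0 := by rintro rfl; simp at hg0
        rw [← Polynomial.natDegree_lt_iff_degree_lt hg0]
        rw [← Polynomial.natDegree_lt_iff_degree_lt hg0'] at hg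
        refine (natDegree_mul_le.trans (Nat.add_le_add_right natDegree_pow_le _)).trans_lt ?_
        have := Nat.mul_le_mul_left D hdeg.le
        lia) (by rw [← mul_assoc, ← pow_succ']; exact hgQ) z hz
      have h2 := he (C z * g) (n + M) (by
        refine lt_of_le_of_lt ?_ hg
        rw [← smul_eq_C_mul]; exact degree_smul_le _ _) (by
          rw [mul_left_comm]
          exact Ideal.map_mono (Ideal.pow_mul_le_of_mul_le hQ M n) h1) y hy
      rw [map_mul, mul_assoc, add_comm e, ← add_assoc]; exact h2
    · rw [map_add, add_mul]; exact add_mem hy hz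

/-- The degree `n` part of the ideal generated by `w` and elements of higher degree. -/
def superficialSum (K : Ideal A) (w : A) (n : ℕ) : Ideal A :=
  Ideal.span {w} * K.icF (n - 1) ⊔ K.icF (n + 1)

theorem superficialSum_anti (K : Ideal A) (w : A) (n : ℕ) : superficialSum K w (n + 1) ≤ superficialSum K w n :=
  sup_le_sup (Ideal.mul_mono_right (K.icF_anti (by lia))) (K.icF_anti (by lia))

theorem mul_superficialSum_le (K : Ideal A) (w : A) (n : ℕ) :
    K * superficialSum K w n ≤ superficialSum K w (n + 1) := by
  rw [superficialSum, Ideal.mul_sup]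
  have h := fun m => K.pow_mul_icF_le 1 m
  simp only [pow_one] at h
  refine sup_le_sup ?_ ((h _).trans (K.icF_anti (by lia)))
  rw [mul_left_comm]
  exact Ideal.mul_mono_right ((h _).trans (K.icF_anti (by lia)))

theorem mem_superficialSum {K : Ideal A} {w x : A} {n : ℕ} : x ∈ superficialSum K w n ↔
    ∃ g ∈ K.icF (n - 1), ∃ f ∈ K.icF (n + 1), x = w * g + f := by
  rw [superficialSum, Submodule.mem_sup]
  constructor
  · rintro ⟨y, hy, f, hf, rfl⟩
    obtain ⟨g, hg, rfl⟩ := Ideal.mem_span_singleton_mul.1 hy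
    exact ⟨g, hg, f, hf, rfl⟩
  · rintro ⟨g, hg, f, hf, rfl⟩
    exact ⟨_, Ideal.mem_span_singleton_mul.2 ⟨g, hg, rfl⟩, f, hf, rfl⟩

/-- Properties of `w₀, w₁` ensuring that `w₁ + w₀ X` is superficial with good quotient. -/
structure IsSuperficialPair (K : Ideal A) (w₀ w₁ : A) : Prop where
  strict : IsStrictSuperficial K w₀
  mem : w₁ ∈ K
  dvd : ∀ z, w₀ ∣ w₁ * z → w₀ ∣ z
  torsion : ∃ c, ∀ j ≥ c, ∀ g ∈ K.icF j, w₁ * g ∈ superficialSum K w₀ (j + 1) → g ∈ superficialSum K w₀ j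
  adic : ∃ c, ∀ j ≥ c, ∀ g ∈ K ^ j, w₁ * g ∈ K ^ (j + 2) → g ∈ K ^ (j + 1)
  pow : ∀ D g, 0 < D → w₁ ^ D * g ∈ superficialSum K w₀ D → g ∈ K.icF 1

theorem IsStrictSuperficial.map_C {K : Ideal A} {w : A} (hw : IsStrictSuperficial K w) :
    IsStrictSuperficial (K.map (C : A →+* A[X])) (C w) where
  linearBound := by
    obtain ⟨c, hc⟩ := hw.linearBound
    refine ⟨c, fun n => ?_⟩
    rw [Ideal.icF_map_C, ← Ideal.map_pow]
    exact Ideal.map_mono (hc n)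
  mem := Ideal.mem_map_of_mem _ hw.mem
  nzd := by
    rw [mem_nonZeroDivisors_iff_right]
    intro z hz
    ext j
    have := congrArg (fun p => p.coeff j) hz
    simp only [coeff_mul_C, coeff_zero] at this
    rw [coeff_zero]
    exact (mem_nonZeroDivisors_iff_right.1 hw.nzd) _ this
  colon n a ha := by
    rw [Ideal.icF_map_C, Ideal.mem_map_C_iff] at *
    intro j
    have := ha j
    rw [coeff_C_mul] at this
    exact hw.colon _ _ this

theorem superficialSum_map_C (K : Ideal A) (w : A) (n : ℕ) :
    superficialSum (K.map (C : A →+* A[X])) (C w) n = (superficialSum K w n).map C := by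
  rw [superficialSum, superficialSum, Ideal.icF_map_C, Ideal.icF_map_C, Ideal.map_sup, Ideal.map_mul,
    Ideal.map_span, Set.image_singleton]

theorem Polynomial.degree_lt_natDegree_succ (g : A[X]) : g.degree < ((g.natDegree + 1 : ℕ) : WithBot ℕ) :=
  degree_le_natDegree.trans_lt (by exact_mod_cast Nat.lt_succ_self _)

theorem dvd_of_dvd_genPoly_mul {K : Ideal A} {w : A} (hdvd : ∀ M z, (∀ b ∈ K ^ M, w ∣ b * z) → w ∣ z)
    (a : ℕ → A) (s : ℕ) (ha : Ideal.span (a '' Set.Iio s) = K) (z : A[X]) (hz : C w ∣ genPoly a s * z) : C w ∣ z := by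
  obtain ⟨e, he⟩ := dedekindMertens_pow a s (fun _ => Ideal.span {w}) (fun _ => Ideal.mul_le_right) 1 (z.natDegree + 1)
  rw [← Ideal.mem_span_singleton, ← Set.image_singleton, ← Ideal.map_span] at hz
  rw [ha] at he
  have h := he z 0 (degree_lt_natDegree_succ _) (by rwa [pow_one])
  rw [← Ideal.mem_span_singleton, ← Set.image_singleton, ← Ideal.map_span, Ideal.mem_map_C_iff]
  intro j
  rw [Ideal.mem_span_singleton]
  refine hdvd (1 + e) _ fun b hb => ?_
  have := Ideal.mem_map_C_iff.1 (h b hb) j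
  rwa [coeff_C_mul, Ideal.mem_span_singleton] at this

theorem IsStrictSuperficial.torsion_genPoly [IsNoetherianRing A] {K : Ideal A} {w : A} (hw : IsStrictSuperficial K w)
    (a : ℕ → A) (s : ℕ) (ha : Ideal.span (a '' Set.Iio s) = K) : ∃ c, ∀ j ≥ c, ∀ g ∈ (K.map (C : A →+* A[X])).icF j,
    genPoly a s * g ∈ superficialSum (K.map C) (C w) (j + 1) → g ∈ superficialSum (K.map C) (C w) j := by
  obtain ⟨c, hc⟩ := Ideal.exists_torsion_bound K K.icF (superficialSum K w) (fun n => K.icF_anti n.le_succ)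
    (superficialSum_anti K w) (fun n => by simpa [add_comm] using K.pow_mul_icF_le 1 n) (mul_superficialSum_le K w)
    hw.linearBound
  refine ⟨c, fun j hj g hg h => ?_⟩
  obtain ⟨e, he⟩ := dedekindMertens_pow a s (superficialSum K w) (ha ▸ mul_superficialSum_le K w) 1 (g.natDegree + 1)
  rw [ha] at he
  rw [superficialSum_map_C] at h ⊢
  have h := he g (j + 1) (degree_lt_natDegree_succ _) (by rwa [pow_one])
  rw [Ideal.icF_map_C, Ideal.mem_map_C_iff] at hg
  rw [Ideal.mem_map_C_iff]
  refine fun i => hc j hj _ (hg i) ⟨1 + e, fun b hb => ?_⟩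
  have := Ideal.mem_map_C_iff.1 (h b hb) i
  rwa [coeff_C_mul, add_assoc] at this

theorem adic_genPoly [IsNoetherianRing A] {K : Ideal A}
    (a : ℕ → A) (s : ℕ) (ha : Ideal.span (a '' Set.Iio s) = K) : ∃ c, ∀ j ≥ c, ∀ g ∈ (K.map (C : A →+* A[X])) ^ j,
    genPoly a s * g ∈ (K.map C) ^ (j + 2) → g ∈ (K.map C) ^ (j + 1) := by
  have hmul : ∀ n, K * K ^ (n + 1) ≤ K ^ (n + 1 + 1) := fun n => by rw [pow_succ' K (n + 1)]
  have hmul' : ∀ n, K * K ^ n ≤ K ^ (n + 1) := fun n => by rw [pow_succ' K n]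
  have hle : ∀ n, K ^ (n + 1) ≤ K ^ n := fun n => Ideal.pow_le_pow_right n.le_succ
  obtain ⟨c, hc⟩ := Ideal.exists_torsion_bound K (fun n => K ^ n) (fun n => K ^ (n + 1)) hle
    (fun n => hle (n + 1)) hmul' hmul ⟨0, fun n => by rw [add_zero]⟩
  refine ⟨c, fun j hj g hg h => ?_⟩
  have hQ : ∀ n, Ideal.span (a '' Set.Iio s) * K ^ (n + 1) ≤ K ^ (n + 1 + 1) := by rw [ha]; exact hmul
  obtain ⟨e, he⟩ := dedekindMertens_pow a s (fun n => K ^ (n + 1)) hQ 1 (g.natDegree + 1)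
  rw [ha] at he
  rw [← Ideal.map_pow] at h ⊢
  have h : ∀ x ∈ K ^ (1 + e), C x * g ∈ (K ^ (j + 1 + e + 1)).map C :=
    he g (j + 1) (degree_lt_natDegree_succ _) (by rw [pow_one]; exact h)
  rw [← Ideal.map_pow, Ideal.mem_map_C_iff] at hg
  rw [Ideal.mem_map_C_iff]
  refine fun i => hc j hj _ (hg i) ⟨1 + e, fun b hb => ?_⟩
  have := Ideal.mem_map_C_iff.1 (h b hb) i
  rw [coeff_C_mul] at this
  rw [show j + (1 + e) + 1 = j + 1 + e + 1 by ring]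
  exact this

theorem mem_icF_one_of_genPoly_pow_mul [IsLocalRing A] [IsNoetherianRing A] [IsAdicComplete (maximalIdeal A) A]
    {K : Ideal A} {w : A} (hw : IsStrictSuperficial K w) (hK : K ≤ maximalIdeal A) {N : ℕ}
    (hN : maximalIdeal A ^ N ≤ K) {x₁ x₂ : A} (hx₁ : x₁ ∈ K) (hx₂ : x₂ ∈ K) (hreg : IsRegularPair x₁ x₂)
    (a : ℕ → A) (s : ℕ) (ha : Ideal.span (a '' Set.Iio s) = K) (D : ℕ) (g : A[X]) (hD : 0 < D)
    (h : genPoly a s ^ D * g ∈ superficialSum (K.map C) (C w) D) : g ∈ (K.map (C : A →+* A[X])).icF 1 := by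
  obtain ⟨e, he⟩ := dedekindMertens_pow a s (superficialSum K w) (ha ▸ mul_superficialSum_le K w) D (g.natDegree + 1)
  rw [ha] at he
  rw [superficialSum_map_C] at h
  have h := he g D (degree_lt_natDegree_succ _) h
  rw [Ideal.icF_map_C, Ideal.mem_map_C_iff]
  obtain ⟨M, hM⟩ : ∃ M, D + e = M + 1 := ⟨D + e - 1, by lia⟩
  refine fun i => hw.mem_icF_one hK hN hx₁ hx₂ hreg (M := M) fun b hb => ?_
  rw [hM] at h
  have := Ideal.mem_map_C_iff.1 (h b hb) i
  rwa [coeff_C_mul, mem_superficialSum] at this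

theorem isSuperficialPair_genPoly [IsLocalRing A] [IsNoetherianRing A] [IsAdicComplete (maximalIdeal A) A]
    {K : Ideal A} {w : A} (hw : IsStrictSuperficial K w) (hK : K ≤ maximalIdeal A) {N : ℕ}
    (hN : maximalIdeal A ^ N ≤ K) {x₁ x₂ : A} (hx₁ : x₁ ∈ K) (hx₂ : x₂ ∈ K) (hreg : IsRegularPair x₁ x₂)
    (hdvd : ∀ M z, (∀ b ∈ K ^ M, w ∣ b * z) → w ∣ z)
    (a : ℕ → A) (s : ℕ) (ha : Ideal.span (a '' Set.Iio s) = K) :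
    IsSuperficialPair (K.map (C : A →+* A[X])) (C w) (genPoly a s) where
  strict := hw.map_C
  mem := ha ▸ genPoly_mem_map_C a s
  dvd := dvd_of_dvd_genPoly_mul hdvd a s ha
  torsion := hw.torsion_genPoly a s ha
  adic := adic_genPoly a s ha
  pow := mem_icF_one_of_genPoly_pow_mul hw hK hN hx₁ hx₂ hreg a s ha

section

theorem Ideal.hasLinearBound_of_mul_mem [IsNoetherianRing A] {I : Ideal A} {u : A} (hu : u ∈ nonZeroDivisors A)
    {c : ℕ} (h : ∀ n, ∀ x ∈ I.icF (n + c), u * x ∈ I ^ n) : I.HasLinearBound := by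
  obtain ⟨k, hk⟩ := Ideal.exists_pow_inf_eq_pow_smul I (Ideal.span {u})
  refine ⟨k + c, fun n x hx => ?_⟩
  have h1 : u * x ∈ I ^ (n + k) • (⊤ : Ideal A) ⊓ Ideal.span {u} :=
    ⟨by simpa using h (n + k) x (by rwa [add_assoc]), Ideal.mem_span_singleton.2 (dvd_mul_right _ _)⟩
  rw [hk _ (Nat.le_add_left _ _), Nat.add_sub_cancel] at h1
  have h2 : I ^ n • (I ^ k • (⊤ : Ideal A) ⊓ Ideal.span {u}) ≤ Ideal.span {u} * I ^ n := by
    rw [smul_eq_mul, mul_comm]; exact Ideal.mul_mono_left inf_le_right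
  obtain ⟨z, hz, he⟩ := Ideal.mem_span_singleton_mul.1 (h2 h1)
  rwa [(mul_cancel_left_mem_nonZeroDivisors hu).1 he] at hz

/-- The linear polynomial `w₁ + w₀ X`. -/
def pencil (w₀ w₁ : A) : A[X] := C w₁ + C w₀ * X

theorem coeff_pencil_mul_zero (w₀ w₁ : A) (z : A[X]) : (pencil w₀ w₁ * z).coeff 0 = w₁ * z.coeff 0 := by
  rw [pencil, add_mul, mul_assoc, coeff_add, coeff_C_mul, coeff_C_mul, coeff_X_mul_zero, mul_zero, add_zero]

theorem coeff_pencil_mul_succ (w₀ w₁ : A) (z : A[X]) (i : ℕ) :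
    (pencil w₀ w₁ * z).coeff (i + 1) = w₁ * z.coeff (i + 1) + w₀ * z.coeff i := by
  rw [pencil, add_mul, mul_assoc, coeff_add, coeff_C_mul, coeff_C_mul, coeff_X_mul]

namespace IsSuperficialPair
variable {K : Ideal A} {w₀ w₁ : A}

theorem mem_map_icF_of_pencil_mul (h : IsSuperficialPair K w₀ w₁) {n : ℕ} {z : A[X]}
    (hz : pencil w₀ w₁ * z ∈ (K.icF (n + 1)).map C) : z ∈ (K.icF n).map (C : A →+* A[X]) := by
  rw [Ideal.mem_map_C_iff] at hz ⊢
  have key : ∀ k i, z.natDegree < i + k → z.coeff i ∈ K.icF n := by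
    intro k
    induction k with
    | zero => intro i hi; rw [coeff_eq_zero_of_natDegree_lt (by simpa using hi)]; exact zero_mem _
    | succ k ih =>
      intro i hi
      refine h.strict.colon _ _ ?_
      have h1 := hz (i + 1)
      rw [coeff_pencil_mul_succ] at h1
      refine (Ideal.add_mem_iff_right _ ?_).1 h1
      have := K.icF_mul_le 1 n (Ideal.mul_mem_mul (K.pow_le_icF 1 (by rw [pow_one]; exact h.mem)) (ih (i + 1) (by lia)))
      rwa [add_comm 1] at this
  exact fun i => key (z.natDegree + 1) i (by lia)

theorem exists_mem_map_pow_of_pencil_mul (h : IsSuperficialPair K w₀ w₁) : ∃ c, ∀ n ≥ c, ∀ z : A[X],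
    z ∈ (K ^ c).map (C : A →+* A[X]) → pencil w₀ w₁ * z ∈ (K ^ (n + 1)).map (C : A →+* A[X]) →
    z ∈ (K ^ n).map (C : A →+* A[X]) := by
  obtain ⟨c, hc⟩ := h.adic
  refine ⟨c, fun n hn z hz hyz => ?_⟩
  rw [Ideal.mem_map_C_iff] at hyz
  have key : ∀ k, c + k ≤ n → z ∈ (K ^ (c + k)).map (C : A →+* A[X]) := by
    intro k
    induction k with
    | zero => exact fun _ => hz
    | succ k ih =>
      intro hk
      have hz := ih (by lia)
      rw [Ideal.mem_map_C_iff] at hz ⊢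
      have hle : K ^ (n + 1) ≤ K ^ (c + k + 2) := Ideal.pow_le_pow_right (by lia)
      intro i
      induction i with
      | zero =>
        refine hc _ (by lia) _ (hz 0) (hle ?_)
        have := hyz 0
        rwa [coeff_pencil_mul_zero] at this
      | succ i ih =>
        refine hc _ (by lia) _ (hz _) ?_
        have h1 := hle (hyz (i + 1))
        rw [coeff_pencil_mul_succ] at h1
        refine (Ideal.add_mem_iff_left _ ?_).1 h1
        rw [pow_succ']
        exact Ideal.mul_mem_mul h.strict.mem ih
  obtain ⟨k, rfl⟩ := Nat.exists_eq_add_of_le hn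
  exact key k le_rfl

theorem mem_span_pencil_of_mul (h : IsSuperficialPair K w₀ w₁) {z : A[X]}
    (hz : C w₀ * z ∈ Ideal.span {pencil w₀ w₁}) : z ∈ Ideal.span {pencil w₀ w₁} := by
  obtain ⟨g, hg⟩ := Ideal.mem_span_singleton.1 hz
  have key : ∀ i, w₀ ∣ g.coeff i := by
    intro i
    refine h.dvd _ ?_
    have h1 := congrArg (fun p => p.coeff i) hg
    simp only [coeff_C_mul] at h1
    cases i with
    | zero =>
      rw [coeff_pencil_mul_zero] at h1
      exact ⟨_, h1.symm⟩
    | succ i =>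
      rw [coeff_pencil_mul_succ] at h1
      exact ⟨z.coeff (i + 1) - g.coeff i, by rw [mul_sub, h1]; ring⟩
  obtain ⟨g', rfl⟩ := (C_dvd_iff_dvd_coeff w₀ g).2 key
  have hn := h.strict.map_C.nzd
  rw [mul_left_comm] at hg
  rw [(mul_cancel_left_mem_nonZeroDivisors hn).1 hg]
  exact Ideal.mem_span_singleton.2 (dvd_mul_right _ _)

section Blowup
variable (L : Type) [CommRing L] [Algebra A L] [IsLocalization.Away w₀ L]

/-- Evaluation of polynomials at `-w₁ / w₀`. -/
def evalNegDiv (w₀ w₁ : A) (L : Type) [CommRing L] [Algebra A L] [IsLocalization.Away w₀ L] : A[X] →ₐ[A] L :=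
  aeval (algebraMap A L (-w₁) * (IsLocalization.Away.invSelf w₀ : L))

theorem evalNegDiv_pencil : evalNegDiv w₀ w₁ L (pencil w₀ w₁) = 0 := by
  have h := algebraMap_pow_mul_invSelf_pow (w := w₀) (L := L) 1
  rw [pow_one, pow_one] at h
  rw [pencil, evalNegDiv, map_add, map_mul, aeval_C, aeval_C, aeval_X]
  linear_combination (-algebraMap A L w₁) * h + (algebraMap A L w₀ * IsLocalization.Away.invSelf w₀) * (map_neg (algebraMap A L) w₁)

theorem evalNegDiv_C_mul_X_pow (a : A) (D : ℕ) : evalNegDiv w₀ w₁ L (C a * X ^ D) =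
    algebraMap A L (a * (-w₁) ^ D) * (IsLocalization.Away.invSelf w₀ : L) ^ D := by
  rw [evalNegDiv, map_mul, map_pow, aeval_C, aeval_X, mul_pow, map_mul, map_pow, mul_assoc]

/-- The homogenization of `z` evaluated at `(-w₁, w₀)`. -/
theorem sum_mem_icF (h : IsSuperficialPair K w₀ w₁) {z : A[X]} {D n : ℕ} (hz : z.degree < ((D + 1 : ℕ) : WithBot ℕ))
    (ho : evalNegDiv w₀ w₁ L z * (IsLocalization.Away.invSelf w₀ : L) ^ n ∈ blowupAlgebra K w₀ h.strict.mem L) :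
    (∑ i ∈ Finset.range (D + 1), z.coeff i * (-w₁) ^ i * w₀ ^ (D - i)) ∈ K.icF (n + D) := by
  refine h.strict.mem_icF_of_mem_blowupAlgebra (L := L) ?_
  convert ho using 1
  rw [as_sum_range' z (D + 1) (by
    by_cases h0 : z = 0
    · simp [h0]
    · exact (natDegree_lt_iff_degree_lt h0).2 hz), map_sum, map_sum, Finset.sum_mul, Finset.sum_mul]
  refine Finset.sum_congr rfl fun i hi => ?_
  rw [← as_sum_range' z (D + 1) (by
    by_cases h0 : z = 0
    · simp [h0]
    · exact (natDegree_lt_iff_degree_lt h0).2 hz), ← C_mul_X_pow_eq_monomial, evalNegDiv_C_mul_X_pow]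
  have hi : i ≤ D := Nat.lt_succ_iff.1 (Finset.mem_range.1 hi)
  obtain ⟨k, rfl⟩ := Nat.exists_eq_add_of_le hi
  rw [Nat.add_sub_cancel_left, map_mul _ _ (w₀ ^ k), map_pow, pow_add, pow_add]
  have := algebraMap_pow_mul_invSelf_pow (w := w₀) (L := L) k
  linear_combination (algebraMap A L (z.coeff i * (-w₁) ^ i) * IsLocalization.Away.invSelf w₀ ^ n * IsLocalization.Away.invSelf w₀ ^ i) * this

theorem evalNegDiv_mem (h : IsSuperficialPair K w₀ w₁) {a : A} {n : ℕ} (ha : a ∈ K.icF n) (D : ℕ) :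
    evalNegDiv w₀ w₁ L (C a * X ^ D) * (IsLocalization.Away.invSelf w₀ : L) ^ n ∈ blowupAlgebra K w₀ h.strict.mem L := by
  rw [evalNegDiv_C_mul_X_pow, mul_assoc, ← pow_add]
  refine ⟨D + n, mem_blowupPiece.2 ⟨_, ?_, rfl⟩⟩
  rw [mul_comm a]
  exact K.icF_mul_le _ _ (Ideal.mul_mem_mul (K.pow_le_icF _ (Ideal.pow_mem_pow (neg_mem h.mem) D)) ha)

theorem exists_pow_mul_coeff (h : IsSuperficialPair K w₀ w₁) {z : A[X]} {D n : ℕ} (hz : z.degree < ((D + 1 : ℕ) : WithBot ℕ))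
    (ho : evalNegDiv w₀ w₁ L z * (IsLocalization.Away.invSelf w₀ : L) ^ n ∈ blowupAlgebra K w₀ h.strict.mem L) :
    ∃ a ∈ K.icF (D - 1), ∃ f ∈ K.icF (n + D), w₁ ^ D * z.coeff D = w₀ * a + f := by
  have h1 := h.sum_mem_icF L hz ho
  rw [Finset.sum_range_succ, Nat.sub_self, pow_zero, mul_one] at h1
  have h2 : ∑ i ∈ Finset.range D, z.coeff i * (-w₁) ^ i * w₀ ^ (D - i) =
      w₀ * ∑ i ∈ Finset.range D, z.coeff i * (-w₁) ^ i * w₀ ^ (D - 1 - i) := by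
    rw [Finset.mul_sum]
    refine Finset.sum_congr rfl fun i hi => ?_
    have := Finset.mem_range.1 hi
    rw [show D - i = (D - 1 - i) + 1 by lia, pow_succ]; ring
  have h3 : ∑ i ∈ Finset.range D, z.coeff i * (-w₁) ^ i * w₀ ^ (D - 1 - i) ∈ K.icF (D - 1) := by
    refine Ideal.sum_mem _ fun i hi => K.pow_le_icF _ ?_
    have := Finset.mem_range.1 hi
    rw [mul_assoc]
    refine Ideal.mul_mem_left _ _ ?_
    have hh := Ideal.mul_mem_mul (Ideal.pow_mem_pow (neg_mem h.mem) i) (Ideal.pow_mem_pow h.strict.mem (D - 1 - i))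
    rwa [← pow_add, show i + (D - 1 - i) = D - 1 by lia] at hh
  rw [h2] at h1
  refine ⟨(-1) ^ D * (- _), Ideal.mul_mem_left _ _ (neg_mem h3), (-1) ^ D * _, Ideal.mul_mem_left _ _ h1, ?_⟩
  rw [neg_pow w₁]
  have : ((-1 : A) ^ D) * (-1) ^ D = 1 := by rw [← mul_pow]; simp
  linear_combination (-w₁ ^ D * z.coeff D) * this

theorem mem_map_icF_one (h : IsSuperficialPair K w₀ w₁) {z : A[X]}
    (ho : evalNegDiv w₀ w₁ L z * (IsLocalization.Away.invSelf w₀ : L) ^ 1 ∈ blowupAlgebra K w₀ h.strict.mem L) :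
    z ∈ (K.icF 1).map (C : A →+* A[X]) := by
  have key : ∀ (D : ℕ) (z : A[X]), z.degree < (D : WithBot ℕ) →
      evalNegDiv w₀ w₁ L z * (IsLocalization.Away.invSelf w₀ : L) ^ 1 ∈ blowupAlgebra K w₀ h.strict.mem L →
      z ∈ (K.icF 1).map (C : A →+* A[X]) := by
    intro D
    induction D with
    | zero =>
      intro z hz _
      have : z = 0 := by
        ext i
        exact (degree_lt_iff_coeff_zero z 0).1 hz i i.zero_le
      rw [this]; exact zero_mem _
    | succ D ih =>
      intro z hz ho
      have hc : z.coeff D ∈ K.icF 1 := by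
        obtain ⟨a, ha, f, hf, he⟩ := h.exists_pow_mul_coeff L hz ho
        rcases Nat.eq_zero_or_pos D with rfl | hD
        · have := h.sum_mem_icF L hz ho
          simpa using this
        · exact h.pow D _ hD (mem_superficialSum.2 ⟨a, ha, f, by rwa [add_comm 1] at hf, he⟩)
      obtain ⟨z', hz', he⟩ := eq_add_C_mul_X_pow_of_degree_lt hz
      rw [he] at ho ⊢
      refine add_mem (ih z' hz' ?_) (Ideal.mul_mem_right _ _ (Ideal.mem_map_of_mem _ hc))
      rw [map_add, add_mul] at ho
      exact (add_mem_cancel_right (h.evalNegDiv_mem L hc D)).1 ho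
  exact key _ z (degree_lt_natDegree_succ z) ho

theorem exists_eq_mul_add (h : IsSuperficialPair K w₀ w₁) : ∃ c, ∀ D n j g, c < j → j ≤ n → g ∈ K.icF j →
    (∃ a, ∃ f ∈ K.icF (n + D), w₁ ^ D * g = w₀ * a + f) → ∃ b ∈ K.icF (j - 1), ∃ e ∈ K.icF n, g = w₀ * b + e := by
  obtain ⟨c, hc⟩ := h.torsion
  refine ⟨c, fun D n j g hj hjn => ?_⟩
  obtain ⟨k, rfl⟩ := Nat.exists_eq_add_of_le hjn
  induction k generalizing j g with
  | zero => exact fun hg _ => ⟨0, zero_mem _, g, hg, by simp⟩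
  | succ k ih =>
    rintro hg ⟨a, f, hf, he⟩
    have hpow : ∀ i, w₁ ^ i * g ∈ K.icF (j + i) := fun i => by
      rw [add_comm]
      exact K.icF_mul_le _ _ (Ideal.mul_mem_mul (K.pow_le_icF _ (Ideal.pow_mem_pow h.mem i)) hg)
    have hdesc : ∀ d i, i + d = D → w₁ ^ i * g ∈ superficialSum K w₀ (j + i) := by
      intro d
      induction d with
      | zero =>
        rintro i rfl
        refine mem_superficialSum.2 ⟨a, h.strict.colon _ _ ?_, f, K.icF_anti (by lia) hf, he⟩
        have h1 := sub_mem (hpow i) (K.icF_anti (by lia : j + i ≤ j + (k + 1) + i) hf)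
        rw [show j + i - 1 + 1 = j + i by lia]
        convert h1 using 1
        linear_combination -he
      | succ d ihd =>
        intro i hi
        refine hc _ (by lia) _ (hpow i) ?_
        rw [← mul_assoc, ← pow_succ', add_assoc]
        exact ihd _ (by lia)
    have h0 := hdesc D 0 (by simp)
    rw [pow_zero, one_mul, add_zero, mem_superficialSum] at h0
    obtain ⟨b, hb, g', hg', rfl⟩ := h0
    obtain ⟨b', hb', e, hE, rfl⟩ := ih (j + 1) g' (by lia) (by lia) hg' ⟨a - w₁ ^ D * b, f, (show j + (k + 1) + D = j + 1 + k + D by lia) ▸ hf, by linear_combination he⟩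
    exact ⟨b + b', add_mem hb (K.icF_anti (by lia) hb'), e, (show j + 1 + k = j + (k + 1) by lia) ▸ hE, by ring⟩

end Blowup
end IsSuperficialPair

end

section

namespace IsSuperficialPair
variable {K : Ideal A} {w₀ w₁ : A}

theorem exists_mem_map_icF_add (L : Type) [CommRing L] [Algebra A L] [IsLocalization.Away w₀ L]
    (h : IsSuperficialPair K w₀ w₁) : ∃ c, ∀ n (z : A[X]), z ∈ (K.icF c).map (C : A →+* A[X]) →
    evalNegDiv w₀ w₁ L z * (IsLocalization.Away.invSelf w₀ : L) ^ n ∈ blowupAlgebra K w₀ h.strict.mem L →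
    z ∈ (K.icF n).map (C : A →+* A[X]) ⊔ Ideal.span {pencil w₀ w₁} := by
  obtain ⟨c, hc⟩ := h.exists_eq_mul_add
  refine ⟨c + 1, fun n => ?_⟩
  have key : ∀ (D : ℕ) (z : A[X]), z.degree < (D : WithBot ℕ) → z ∈ (K.icF (c + 1)).map (C : A →+* A[X]) →
      evalNegDiv w₀ w₁ L z * (IsLocalization.Away.invSelf w₀ : L) ^ n ∈ blowupAlgebra K w₀ h.strict.mem L →
      z ∈ (K.icF n).map (C : A →+* A[X]) ⊔ Ideal.span {pencil w₀ w₁} := by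
    intro D
    induction D with
    | zero =>
      intro z hz _ _
      have : z = 0 := by
        ext i
        exact (degree_lt_iff_coeff_zero z 0).1 hz i i.zero_le
      rw [this]; exact zero_mem _
    | succ D ih =>
      intro z hz hzc ho
      rcases le_total n (c + 1) with hn | hn
      · exact Ideal.mem_sup_left (Ideal.map_mono (K.icF_anti hn) hzc)
      obtain ⟨a, -, f, hf, he⟩ := h.exists_pow_mul_coeff L hz ho
      rcases Nat.eq_zero_or_pos D with rfl | hD
      · refine Ideal.mem_sup_left ?_
        rw [Ideal.mem_map_C_iff]
        intro i
        cases i with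
        | zero => simpa using h.sum_mem_icF L hz ho
        | succ i => rw [(degree_lt_iff_coeff_zero z 1).1 (by simpa using hz) (i + 1) (by lia)]; exact zero_mem _
      obtain ⟨b, hb, e, hE, hbe⟩ := hc D n (c + 1) (z.coeff D) (by lia) hn (Ideal.mem_map_C_iff.1 hzc D) ⟨a, f, hf, he⟩
      obtain ⟨D, rfl⟩ : ∃ D', D = D' + 1 := ⟨D - 1, by lia⟩
      have hmem : C e * X ^ (D + 1) + C b * X ^ D * pencil w₀ w₁ ∈
          (K.icF n).map (C : A →+* A[X]) ⊔ Ideal.span {pencil w₀ w₁} :=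
        add_mem (Ideal.mem_sup_left (Ideal.mul_mem_right _ _ (Ideal.mem_map_of_mem _ hE)))
          (Ideal.mem_sup_right (Ideal.mul_mem_left _ _ (Ideal.mem_span_singleton_self _)))
      obtain ⟨z', hz', hzz⟩ := eq_add_C_mul_X_pow_of_degree_lt hz
      have hdec : z = (z' - C (b * w₁) * X ^ D) + (C e * X ^ (D + 1) + C b * X ^ D * pencil w₀ w₁) := by
        rw [hzz, hbe, pencil]
        simp only [map_add, map_mul]
        ring
      have hbw : b * w₁ ∈ K.icF (c + 1) := by
        rw [mul_comm, add_comm c]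
        exact K.icF_mul_le _ _ (Ideal.mul_mem_mul (K.pow_le_icF 1 (by rw [pow_one]; exact h.mem)) hb)
      rw [hdec]
      refine add_mem (ih _ ?_ ?_ ?_) hmem
      · refine (degree_sub_le _ _).trans_lt (max_lt hz' ((degree_C_mul_X_pow_le _ _).trans_lt ?_))
        exact_mod_cast Nat.lt_succ_self D
      · refine sub_mem ?_ (Ideal.mul_mem_right _ _ (Ideal.mem_map_of_mem _ hbw))
        rw [eq_sub_of_add_eq hzz.symm]
        exact sub_mem hzc (Ideal.mul_mem_right _ _ (Ideal.mem_map_of_mem _ (Ideal.mem_map_C_iff.1 hzc _)))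
      · rw [eq_sub_of_add_eq hdec.symm, map_sub, map_add, map_mul _ _ (pencil w₀ w₁), evalNegDiv_pencil, mul_zero, add_zero, sub_mul]
        exact sub_mem ho (h.evalNegDiv_mem L hE _)
  exact fun z hz ho => key _ z (degree_lt_natDegree_succ z) hz ho

theorem evalNegDiv_mem_of_mk_mem (L : Type) [CommRing L] [Algebra A L] [IsLocalization.Away w₀ L]
    (h : IsSuperficialPair K w₀ w₁) {z : A[X]} {n : ℕ}
    (hz : Ideal.Quotient.mk (Ideal.span {pencil w₀ w₁}) z ∈
      ((K.map (C : A →+* A[X])).map (Ideal.Quotient.mk (Ideal.span {pencil w₀ w₁}))).icF n) :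
    evalNegDiv w₀ w₁ L z * (IsLocalization.Away.invSelf w₀ : L) ^ n ∈ blowupAlgebra K w₀ h.strict.mem L := by
  have hv : ∀ k ∈ K, algebraMap A L k * (IsLocalization.Away.invSelf w₀ : L) ∈ blowupAlgebra K w₀ h.strict.mem L :=
    fun k hk => ⟨1, mem_blowupPiece.2 ⟨k, K.pow_le_icF 1 (by rwa [pow_one]), by rw [pow_one]⟩⟩
  let f : A[X] →ₐ[A] blowupAlgebra K w₀ h.strict.mem L := aeval ⟨_, hv _ (neg_mem h.mem)⟩
  have hf : ∀ p, ((f p : blowupAlgebra K w₀ h.strict.mem L) : L) = evalNegDiv w₀ w₁ L p := by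
    intro p
    have : (blowupAlgebra K w₀ h.strict.mem L).val.comp f = evalNegDiv w₀ w₁ L := by
      ext
      simp [f, evalNegDiv]
    exact DFunLike.congr_fun this p
  have hf0 : ∀ p ∈ Ideal.span {pencil w₀ w₁}, (f : A[X] →+* blowupAlgebra K w₀ h.strict.mem L) p = 0 := by
    intro p hp
    obtain ⟨q, rfl⟩ := Ideal.mem_span_singleton.1 hp
    refine Subtype.ext ?_
    rw [RingHom.coe_coe, hf, map_mul, evalNegDiv_pencil, zero_mul]; rfl
  let g := Ideal.Quotient.lift _ _ hf0
  have hg := Ideal.map_icF_le g _ n (Ideal.mem_map_of_mem g hz)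
  have hle : ((K.map (C : A →+* A[X])).map (Ideal.Quotient.mk (Ideal.span {pencil w₀ w₁}))).map g ≤
      Ideal.span {algebraMap A (blowupAlgebra K w₀ h.strict.mem L) w₀} := by
    rw [Ideal.map_map, Ideal.map_map, Ideal.map_le_iff_le_comap]
    intro k hk
    rw [Ideal.mem_comap, Ideal.mem_span_singleton]
    refine ⟨⟨_, hv k hk⟩, Subtype.ext ?_⟩
    have h1 := algebraMap_pow_mul_invSelf_pow (w := w₀) (L := L) 1
    rw [pow_one, pow_one] at h1
    have h2 : ((g (Ideal.Quotient.mk _ (C k)) : blowupAlgebra K w₀ h.strict.mem L) : L) = algebraMap A L k := by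
      rw [Ideal.Quotient.lift_mk, RingHom.coe_coe, hf, evalNegDiv, aeval_C]
    rw [RingHom.comp_apply, RingHom.comp_apply, h2]
    change _ = algebraMap A L w₀ * (algebraMap A L k * _)
    linear_combination (-algebraMap A L k) * h1
  have hg2 := h.strict.powersClosed (L := L) n (Ideal.icF_mono hle n hg)
  rw [Ideal.span_singleton_pow, Ideal.mem_span_singleton] at hg2
  obtain ⟨o, ho⟩ := hg2
  have ho' := congrArg Subtype.val ho
  have h2 : ((g (Ideal.Quotient.mk _ z) : blowupAlgebra K w₀ h.strict.mem L) : L) = evalNegDiv w₀ w₁ L z := by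
    rw [Ideal.Quotient.lift_mk, RingHom.coe_coe, hf]
  rw [h2] at ho'
  rw [ho']
  change (algebraMap A L w₀ ^ n * (o : L)) * _ ∈ _
  have h1 := algebraMap_pow_mul_invSelf_pow (w := w₀) (L := L) n
  rw [mul_right_comm, h1, one_mul]
  exact o.2

theorem icF_one_quotient_le (h : IsSuperficialPair K w₀ w₁) :
    ((K.map (C : A →+* A[X])).map (Ideal.Quotient.mk (Ideal.span {pencil w₀ w₁}))).icF 1 ≤
      ((K.icF 1).map (C : A →+* A[X])).map (Ideal.Quotient.mk (Ideal.span {pencil w₀ w₁})) := by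
  intro x hx
  obtain ⟨z, rfl⟩ := Ideal.Quotient.mk_surjective x
  exact Ideal.mem_map_of_mem _ (h.mem_map_icF_one (Localization.Away w₀) (h.evalNegDiv_mem_of_mk_mem _ hx))

theorem hasLinearBound_quotient [IsNoetherianRing A] (h : IsSuperficialPair K w₀ w₁) :
    ((K.map (C : A →+* A[X])).map (Ideal.Quotient.mk (Ideal.span {pencil w₀ w₁}))).HasLinearBound := by
  obtain ⟨c, hc⟩ := h.exists_mem_map_icF_add (Localization.Away w₀)
  obtain ⟨c₁, hc₁⟩ := h.strict.linearBound
  have hu : Ideal.Quotient.mk (Ideal.span {pencil w₀ w₁}) (C w₀) ∈ nonZeroDivisors (A[X] ⧸ Ideal.span {pencil w₀ w₁}) := by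
    rw [mem_nonZeroDivisors_iff_left]
    intro x hx
    obtain ⟨z, rfl⟩ := Ideal.Quotient.mk_surjective x
    rw [← map_mul, Ideal.Quotient.eq_zero_iff_mem] at hx
    exact Ideal.Quotient.eq_zero_iff_mem.2 (h.mem_span_pencil_of_mul hx)
  refine Ideal.hasLinearBound_of_mul_mem (pow_mem hu c) (c := c₁) fun n x hx => ?_
  obtain ⟨z, rfl⟩ := Ideal.Quotient.mk_surjective x
  have ho := h.evalNegDiv_mem_of_mk_mem (Localization.Away w₀) hx
  have hz := hc (n + c₁) (C w₀ ^ c * z) (Ideal.mul_mem_right _ _ (by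
    rw [← map_pow]
    exact Ideal.mem_map_of_mem _ (h.strict.pow_mem c))) (by
    rw [map_mul, mul_assoc]
    refine mul_mem ?_ ho
    rw [← map_pow, evalNegDiv, aeval_C]
    exact Subalgebra.algebraMap_mem _ _)
  obtain ⟨p, hp, q, hq, hpq⟩ := Submodule.mem_sup.1 hz
  rw [← map_pow, ← map_mul, ← hpq, map_add, Ideal.Quotient.eq_zero_iff_mem.2 hq, add_zero, ← Ideal.map_pow, ← Ideal.map_pow]
  exact Ideal.mem_map_of_mem _ (Ideal.map_mono (hc₁ n) hp)

end IsSuperficialPair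

end

section

theorem Ideal.mem_icF_of_pow_eq_zero (I : Ideal A) {x : A} {k : ℕ} (h : x ^ k = 0) (n : ℕ) : x ∈ I.icF n := by
  refine Ideal.mem_icF_of_monic (X ^ k) (monic_X_pow k) (fun j => ?_) (by simpa using h)
  rw [coeff_X_pow]
  split_ifs with hj
  · rcases subsingleton_or_nontrivial A with hA | hA
    · rw [Subsingleton.elim (1 : A) 0]; exact zero_mem _
    rw [natDegree_X_pow, hj, Nat.sub_self, mul_zero, Ideal.icF_zero]; trivial
  · exact zero_mem _

theorem Ideal.intCl_icF_le (I : Ideal A) (n : ℕ) : (I.icF n).intCl ≤ I.icF n := by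
  intro x hx
  rcases subsingleton_or_nontrivial A with hA | hA
  · rw [Subsingleton.elim x 0]; exact zero_mem _
  obtain ⟨N, c, hN, hc, he⟩ := (Ideal.mem_intCl_iff _ _).1 hx
  let d : ℕ → A := fun j => if j = N then 1 else c (N - j)
  let p : A[X] := ∑ j ∈ Finset.range (N + 1), C (d j) * X ^ j
  have hp : ∀ j, p.coeff j = if j < N + 1 then d j else 0 := by
    intro j
    simp only [p, finsetSum_coeff, coeff_C_mul_X_pow]
    rw [Finset.sum_ite_eq]
    simp only [Finset.mem_range]
  have hpm : p.natDegree ≤ N := natDegree_le_iff_coeff_eq_zero.2 fun j hj => by rw [hp, if_neg (by lia)]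
  have hmon : p.Monic := monic_of_natDegree_le_of_coeff_eq_one N hpm (by rw [hp, if_pos (by lia)]; exact if_pos rfl)
  have hdeg : p.natDegree = N := le_antisymm hpm (le_natDegree_of_ne_zero (by
    rw [hp, if_pos (by lia), show d N = 1 from if_pos rfl]; exact one_ne_zero))
  refine Ideal.mem_icF_of_monic p hmon (fun j => ?_) ?_
  · rw [hp, hdeg]
    split_ifs with hj
    · by_cases hjN : j = N
      · rw [hjN, Nat.sub_self, mul_zero, Ideal.icF_zero]; trivial
      · rw [show d j = c (N - j) from if_neg hjN]
        exact I.icF_pow_le _ _ (hc _ (Finset.mem_Icc.2 ⟨by lia, by lia⟩))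
    · exact zero_mem _
  · rw [← he, eval_finsetSum, Finset.sum_range_succ, add_comm]
    congr 1
    · simp [d]
    · refine Finset.sum_bij' (fun j _ => N - j) (fun j _ => N - j) ?_ ?_ ?_ ?_ ?_ <;>
        intro j hj <;> simp only [Finset.mem_range, Finset.mem_Icc] at hj ⊢ <;> try lia
      rw [eval_mul, eval_C, eval_pow, eval_X, show d j = c (N - j) from if_neg (by lia), Nat.sub_sub_self (by lia)]

theorem Ideal.HasLinearBound.isReduced {I : Ideal A} (h : I.HasLinearBound) [IsHausdorff I A] : IsReduced A where
  eq_zero x hx := by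
    obtain ⟨k, hk⟩ := hx
    obtain ⟨c, hc⟩ := h
    exact IsHausdorff.eq_zero_of_forall_mem_pow (I := I) fun n => hc n (I.mem_icF_of_pow_eq_zero hk _)

theorem IsHausdorff.of_ideal_le {I J : Ideal A} (h : I ≤ J) [IsHausdorff J A] : IsHausdorff I A :=
  isHausdorff_of_forall fun _ hx => IsHausdorff.eq_zero_of_forall_mem_pow (I := J) fun n => Ideal.pow_right_mono h n (hx n)

theorem Ideal.HasLinearBound.isReduced_adicCompletion [IsLocalRing A] [IsNoetherianRing A] {I : Ideal A}
    (h : I.HasLinearBound) (hI : I ≤ maximalIdeal A) (hN : ∃ N, maximalIdeal A ^ N ≤ I) :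
    IsReduced (AdicCompletion (maximalIdeal A) A) := by
  have hg := AdicCompletion.isGoodExtension A
  have hle : I.map (algebraMap A (AdicCompletion (maximalIdeal A) A)) ≤ maximalIdeal _ := by
    rw [← hg.map_max]; exact Ideal.map_mono hI
  have := AdicCompletion.isNoetherianRing A
  have := IsHausdorff.of_ideal_le hle
  exact (hg.hasLinearBound hN h).isReduced

theorem IsLocalization.mem_map_of_mul_mem_map {B : Type} [CommRing B] [Algebra A B] (M : Submonoid A)
    [IsLocalization M B] {y : A} {I J T : Ideal A} (h : ∀ z ∈ T, y * z ∈ I → z ∈ J) {b : B}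
    (hb : b ∈ T.map (algebraMap A B)) (hyb : algebraMap A B y * b ∈ I.map (algebraMap A B)) :
    b ∈ J.map (algebraMap A B) := by
  obtain ⟨⟨z, s⟩, hz⟩ := IsLocalization.surj M b
  have h1 : algebraMap A B z ∈ T.map (algebraMap A B) := by rw [← hz]; exact Ideal.mul_mem_right _ _ hb
  have h2 : algebraMap A B (y * z) ∈ I.map (algebraMap A B) := by
    rw [map_mul, ← hz, ← mul_assoc]; exact Ideal.mul_mem_right _ _ hyb
  rw [IsLocalization.algebraMap_mem_map_algebraMap_iff M] at h1 h2
  obtain ⟨m, hm, hmz⟩ := h1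
  obtain ⟨m', hm', hmz'⟩ := h2
  have h3 := h (m' * (m * z)) (Ideal.mul_mem_left _ _ hmz) (by
    rw [show y * (m' * (m * z)) = m * (m' * (y * z)) by ring]; exact Ideal.mul_mem_left _ _ hmz')
  have h4 : algebraMap A B z ∈ J.map (algebraMap A B) := by
    rw [IsLocalization.algebraMap_mem_map_algebraMap_iff M]
    exact ⟨m' * m, mul_mem hm' hm, by rwa [mul_assoc]⟩
  rw [← hz] at h4
  exact (Ideal.mul_unit_mem_iff_mem _ (IsLocalization.map_units B s)).1 h4

theorem isSuperficialFor_of_mul {F : ℕ → Ideal A} {y : A} {c : ℕ} (hF : ∀ {m n}, m ≤ n → F n ≤ F m)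
    (hy : ∀ n, ∀ x ∈ F n, y * x ∈ F (n + 1)) (h : ∀ n ≥ c, ∀ x ∈ F c, y * x ∈ F (n + 1) → x ∈ F n) :
    IsSuperficialFor F y := by
  refine ⟨c, fun n hn => le_antisymm ?_ fun x hx => ⟨?_, hF hn hx⟩⟩
  · rintro x ⟨hx, hxc⟩
    have hx' := Ideal.mem_colon_span_singleton.1 hx
    exact h n hn x hxc (by rwa [mul_comm])
  · exact Ideal.mem_colon_span_singleton.2 (by rw [mul_comm]; exact hy n x hx)

theorem Ideal.map_icF_of_isLocalization {B : Type} [CommRing B] [Algebra A B] (M : Submonoid A)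
    [IsLocalization M B] (I : Ideal A) (n : ℕ) : (I.map (algebraMap A B)).icF n = (I.icF n).map (algebraMap A B) := by
  rw [icF, icF, ← Ideal.map_pow, Ideal.intCl_map_of_isLocalization M]

namespace IsSuperficialPair
variable {K : Ideal A} {w₀ w₁ : A} (B : Type) [CommRing B] [Algebra A[X] B]

theorem pencil_mem (h : IsSuperficialPair K w₀ w₁) : pencil w₀ w₁ ∈ K.map (C : A →+* A[X]) :=
  add_mem (Ideal.mem_map_of_mem _ h.mem) (Ideal.mul_mem_right _ _ (Ideal.mem_map_of_mem _ h.strict.mem))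

theorem isSuperficialFor_icF (M : Submonoid A[X]) [IsLocalization M B]
    (h : IsSuperficialPair K w₀ w₁) :
    IsSuperficialFor ((K.map (C : A →+* A[X])).map (algebraMap A[X] B)).icF (algebraMap A[X] B (pencil w₀ w₁)) := by
  refine isSuperficialFor_of_mul (c := 0) (Ideal.icF_anti _) (fun n x hx => ?_) fun n _ x _ hx => ?_
  · rw [add_comm]
    exact Ideal.icF_mul_le _ _ _ (Ideal.mul_mem_mul (Ideal.pow_le_icF _ 1 (by
      rw [pow_one]; exact Ideal.mem_map_of_mem _ h.pencil_mem)) hx)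
  · rw [Ideal.map_icF_of_isLocalization M] at hx ⊢
    rw [Ideal.icF_map_C] at hx ⊢
    exact IsLocalization.mem_map_of_mul_mem_map M (T := ⊤) (fun z _ => h.mem_map_icF_of_pencil_mul)
      (by rw [Ideal.map_top]; trivial) hx

theorem isSuperficialFor_pow (M : Submonoid A[X]) [IsLocalization M B]
    (h : IsSuperficialPair K w₀ w₁) :
    IsSuperficialFor (fun n => ((K.map (C : A →+* A[X])).map (algebraMap A[X] B)) ^ n)
      (algebraMap A[X] B (pencil w₀ w₁)) := by
  obtain ⟨c, hc⟩ := h.exists_mem_map_pow_of_pencil_mul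
  refine isSuperficialFor_of_mul (c := c) (fun h => Ideal.pow_le_pow_right h) (fun n x hx => ?_) fun n hn x hx hyx => ?_
  · rw [pow_succ']
    exact Ideal.mul_mem_mul (Ideal.mem_map_of_mem _ h.pencil_mem) hx
  · simp only [← Ideal.map_pow] at hx hyx ⊢
    exact IsLocalization.mem_map_of_mul_mem_map M (fun z => hc n hn z) hx hyx

theorem map_quotient_mk (I : Ideal A[X]) (J : Ideal A[X]) :
    (J.map (algebraMap A[X] B)).map (Ideal.Quotient.mk (I.map (algebraMap A[X] B))) =
      (J.map (Ideal.Quotient.mk I)).map (algebraMap (A[X] ⧸ I) (B ⧸ I.map (algebraMap A[X] B))) := by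
  rw [Ideal.map_map, Ideal.map_map]
  rfl

theorem hasLinearBound_localization (M : Submonoid A[X]) [IsLocalization M B]
    [IsNoetherianRing A] (h : IsSuperficialPair K w₀ w₁) (J : Ideal B)
    (hJ : J = (Ideal.span {pencil w₀ w₁}).map (algebraMap A[X] B)) :
    (((K.map (C : A →+* A[X])).map (algebraMap A[X] B)).map (Ideal.Quotient.mk J)).HasLinearBound := by
  subst hJ
  obtain ⟨c, hc⟩ := h.hasLinearBound_quotient
  refine ⟨c, fun n => ?_⟩
  rw [map_quotient_mk, Ideal.map_icF_of_isLocalization (Algebra.algebraMapSubmonoid (A[X] ⧸ Ideal.span {pencil w₀ w₁}) M),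
    ← Ideal.map_pow]
  exact Ideal.map_mono (hc n)

theorem intCl_quotient (M : Submonoid A[X]) [IsLocalization M B]
    (h : IsSuperficialPair K w₀ w₁) (J : Ideal B)
    (hJ : J = (Ideal.span {pencil w₀ w₁}).map (algebraMap A[X] B)) :
    ((((K.map (C : A →+* A[X])).map (algebraMap A[X] B)).intCl).map (Ideal.Quotient.mk J)).intCl =
      (((K.map (C : A →+* A[X])).map (algebraMap A[X] B)).intCl).map (Ideal.Quotient.mk J) := by
  subst hJ
  set I := (K.map (C : A →+* A[X])).map (algebraMap A[X] B)
  have hI : I.intCl = I.icF 1 := by rw [Ideal.icF, pow_one]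
  refine le_antisymm (fun x hx => ?_) ?_
  · have h1 : ((I.intCl).map (Ideal.Quotient.mk ((Ideal.span {pencil w₀ w₁}).map (algebraMap A[X] B)))) ≤
        (I.map (Ideal.Quotient.mk ((Ideal.span {pencil w₀ w₁}).map (algebraMap A[X] B)))).icF 1 := by
      rw [hI]; exact Ideal.map_icF_le _ _ 1
    have h2 := Ideal.intCl_mono h1 hx
    have h3 : x ∈ (I.map (Ideal.Quotient.mk ((Ideal.span {pencil w₀ w₁}).map (algebraMap A[X] B)))).icF 1 :=
      Ideal.intCl_icF_le _ _ h2
    rw [map_quotient_mk, Ideal.map_icF_of_isLocalization (Algebra.algebraMapSubmonoid (A[X] ⧸ Ideal.span {pencil w₀ w₁}) M)] at h3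
    have h4 := Ideal.map_mono h.icF_one_quotient_le h3
    rw [← map_quotient_mk] at h4
    rw [hI, Ideal.map_icF_of_isLocalization M, Ideal.icF_map_C]
    exact h4
  · have := Ideal.pow_le_icF (I.intCl.map (Ideal.Quotient.mk ((Ideal.span {pencil w₀ w₁}).map (algebraMap A[X] B)))) 1
    rwa [Ideal.icF, pow_one] at this

theorem isReduced_adicCompletion_quotient (M : Submonoid A[X]) [IsLocalization M B]
    [IsNoetherianRing A] [IsLocalRing B] (h : IsSuperficialPair K w₀ w₁)
    (hI : (K.map (C : A →+* A[X])).map (algebraMap A[X] B) ≤ maximalIdeal B)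
    (hN : ∃ N, maximalIdeal B ^ N ≤ (K.map (C : A →+* A[X])).map (algebraMap A[X] B)) :
    IsReduced (AdicCompletion ((maximalIdeal B).map (Ideal.Quotient.mk (Ideal.span {algebraMap A[X] B (pencil w₀ w₁)})))
      (B ⧸ Ideal.span {algebraMap A[X] B (pencil w₀ w₁)})) := by
  set J := Ideal.span {algebraMap A[X] B (pencil w₀ w₁)}
  have hJ : J = (Ideal.span {pencil w₀ w₁}).map (algebraMap A[X] B) := by
    rw [Ideal.map_span, Set.image_singleton]
  have hb := h.hasLinearBound_localization B M J hJ
  have hJm : J ≤ maximalIdeal B := by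
    rw [Ideal.span_singleton_le_iff_mem]
    exact hI (Ideal.mem_map_of_mem _ h.pencil_mem)
  have : Nontrivial (B ⧸ J) := Ideal.Quotient.nontrivial_iff.2 fun ht =>
    (maximalIdeal.isMaximal B).ne_top (top_le_iff.1 (ht ▸ hJm))
  have : IsLocalRing (B ⧸ J) := IsLocalRing.of_surjective' (Ideal.Quotient.mk J) Ideal.Quotient.mk_surjective
  have hm := IsLocalRing.map_maximalIdeal_of_surjective (Ideal.Quotient.mk J) Ideal.Quotient.mk_surjective
  have : IsNoetherianRing B := IsLocalization.isNoetherianRing M B inferInstance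
  rw [hm]
  refine hb.isReduced_adicCompletion ?_ ?_
  · rw [← hm]; exact Ideal.map_mono hI
  · obtain ⟨N, hN⟩ := hN
    refine ⟨N, ?_⟩
    rw [← hm, ← Ideal.map_pow]; exact Ideal.map_mono hN

end IsSuperficialPair

end

section

namespace IsRegularPair
variable {x y : A}

theorem pow_left (h : IsRegularPair x y) (n : ℕ) : IsRegularPair (x ^ n) y := by
  refine ⟨pow_mem h.nzd n, ?_⟩
  induction n with
  | zero => exact fun a b _ => by simp
  | succ n ih =>
    intro a b hab
    obtain ⟨a, rfl⟩ := h.dvd a (x ^ n * b) (by rw [hab]; ring)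
    rw [pow_succ']
    exact mul_dvd_mul_left _ (ih a b ((mul_cancel_left_mem_nonZeroDivisors h.nzd).1 (by linear_combination hab)))

theorem dvd_of_forall_dvd_mul (h : IsRegularPair x y) {K : Ideal A} (hx : x ∈ K) (hy : y ∈ K) {w : A}
    (hw : w ∈ nonZeroDivisors A) (M : ℕ) (z : A) (hz : ∀ b ∈ K ^ M, w ∣ b * z) : w ∣ z := by
  obtain ⟨u, hu⟩ := hz _ (Ideal.pow_mem_pow hx M)
  obtain ⟨v, hv⟩ := hz _ (Ideal.pow_mem_pow hy M)
  have hp := (h.pow_left M).pow_right M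
  obtain ⟨t, rfl⟩ := hp.dvd u v ((mul_cancel_left_mem_nonZeroDivisors hw).1 (by linear_combination y ^ M * hu.symm - x ^ M * hv.symm))
  exact ⟨t, (mul_cancel_left_mem_nonZeroDivisors hp.nzd).1 (by linear_combination hu)⟩

end IsRegularPair

section Flat
variable {S : Type} [CommRing S] [Algebra A S] [Module.Flat A S]

theorem algebraMap_mem_nonZeroDivisors_of_flat {x : A} (hx : x ∈ nonZeroDivisors A) :
    algebraMap A S x ∈ nonZeroDivisors S := by
  rw [mem_nonZeroDivisors_iff_left]
  intro z hz
  have := Ideal.mem_map_of_mul_mem_map (I := ⊥) (J := ⊥) (w := x) (b := z)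
    (fun a ha => (mul_right_mem_nonZeroDivisors_eq_zero_iff hx).1 (by rwa [mul_comm] at ha)) (by rw [hz]; exact zero_mem _)
  rwa [Ideal.map_bot] at this

theorem IsRegularPair.map {x y : A} (h : IsRegularPair x y) :
    IsRegularPair (algebraMap A S x) (algebraMap A S y) where
  nzd := algebraMap_mem_nonZeroDivisors_of_flat h.nzd
  dvd a b hab := by
    have := Ideal.mem_map_of_mul_mem_map (I := Ideal.span {x}) (J := Ideal.span {x}) (w := y) (b := a)
      (fun a ha => by
        obtain ⟨b, hb⟩ := Ideal.mem_span_singleton.1 ha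
        exact Ideal.mem_span_singleton.2 (h.dvd a b hb)) (by
        rw [Ideal.map_span, Set.image_singleton, Ideal.mem_span_singleton]
        exact ⟨b, hab⟩)
    rwa [Ideal.map_span, Set.image_singleton, Ideal.mem_span_singleton] at this

end Flat

theorem HasDepthGE.exists_isRegularPair [IsLocalRing A] (h : HasDepthGE A 2) :
    ∃ x ∈ maximalIdeal A, ∃ y ∈ maximalIdeal A, IsRegularPair x y := by
  obtain ⟨rs, hl, hm, hr⟩ := h
  obtain ⟨x, y, rfl⟩ := List.length_eq_two.1 hl
  have hw := hr.1
  rw [RingTheory.Sequence.isWeaklyRegular_cons_iff, RingTheory.Sequence.isWeaklyRegular_cons_iff] at hw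
  obtain ⟨hx, hy, -⟩ := hw
  refine ⟨x, hm _ (by simp), y, hm _ (by simp), ?_, fun a b hab => ?_⟩
  · rw [mem_nonZeroDivisors_iff_left]
    exact fun z hz => isSMulRegular_iff_right_eq_zero_of_smul.1 hx z hz
  · have h0 : (Submodule.Quotient.mk a : QuotSMulTop x A) = 0 := by
      refine isSMulRegular_iff_right_eq_zero_of_smul.1 hy _ ?_
      rw [← Submodule.Quotient.mk_smul, Submodule.Quotient.mk_eq_zero, smul_eq_mul, hab]
      exact Submodule.smul_mem_pointwise_smul b x ⊤ trivial
    rw [Submodule.Quotient.mk_eq_zero] at h0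
    obtain ⟨c, -, hc⟩ := (Submodule.mem_smul_pointwise_iff_exists _ _ _).1 h0
    exact ⟨c, hc.symm⟩

theorem isStrictSuperficial_genPoly [IsNoetherianRing A] {K : Ideal A} (hK : K.HasLinearBound) {x : A} (hx : x ∈ K)
    (hx' : x ∈ nonZeroDivisors A) (a : ℕ → A) (s : ℕ) (ha : Ideal.span (a '' Set.Iio s) = K) :
    IsStrictSuperficial (K.map (C : A →+* A[X])) (genPoly a s) where
  linearBound := by
    obtain ⟨c, hc⟩ := hK
    refine ⟨c, fun n => ?_⟩
    rw [Ideal.icF_map_C, ← Ideal.map_pow]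
    exact Ideal.map_mono (hc n)
  mem := ha ▸ genPoly_mem_map_C a s
  nzd := by
    rw [mem_nonZeroDivisors_iff_left]
    intro g hg
    obtain ⟨M, hM⟩ := dedekindMertens a s (g.natDegree + 1)
    have h1 := hM ⊥ g (degree_lt_natDegree_succ g) (by rw [hg]; exact zero_mem _)
    rw [ha, Ideal.mul_bot, Ideal.map_bot] at h1
    ext i
    refine Ideal.pow_faithful hx hx' (M + 1) _ fun y hy => ?_
    have := congrArg (fun p => p.coeff i) (h1 y hy)
    simpa [mul_comm] using this
  colon n g hg := by
    obtain ⟨M, hM⟩ := dedekindMertens a s (g.natDegree + 1)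
    rw [Ideal.icF_map_C] at hg ⊢
    have h1 := hM _ g (degree_lt_natDegree_succ g) hg
    rw [ha] at h1
    rw [Ideal.mem_map_C_iff]
    refine fun i => hK.mem_icF_of_mul_pow hx hx' (m := M + 1) fun y hy => ?_
    have h2 := Ideal.mem_map_C_iff.1 (h1 y hy) i
    rw [coeff_C_mul] at h2
    rw [mul_comm (g.coeff i), show n + (M + 1) = M + (n + 1) by ring]
    exact K.pow_mul_icF_le _ _ h2

theorem IsStrictSuperficial.of_isLocalization {K : Ideal A} {w : A} (h : IsStrictSuperficial K w) {B : Type}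
    [CommRing B] [Algebra A B] (M : Submonoid A) [IsLocalization M B] :
    IsStrictSuperficial (K.map (algebraMap A B)) (algebraMap A B w) where
  linearBound := by
    obtain ⟨c, hc⟩ := h.linearBound
    refine ⟨c, fun n => ?_⟩
    rw [Ideal.map_icF_of_isLocalization M, ← Ideal.map_pow]
    exact Ideal.map_mono (hc n)
  mem := Ideal.mem_map_of_mem _ h.mem
  nzd := by
    have := IsLocalization.flat B M
    exact algebraMap_mem_nonZeroDivisors_of_flat h.nzd
  colon n a ha := by
    rw [Ideal.map_icF_of_isLocalization M] at ha ⊢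
    have := IsLocalization.flat B M
    exact Ideal.mem_map_of_mul_mem_map (h.colon n) ha

theorem IsStrictSuperficial.of_isGoodExtension {K : Ideal A} {w : A} (h : IsStrictSuperficial K w) {B : Type}
    [CommRing B] [Algebra A B] [IsLocalRing A] [IsLocalRing B] (hg : IsGoodExtension A B)
    (hN : ∃ N, maximalIdeal A ^ N ≤ K) : IsStrictSuperficial (K.map (algebraMap A B)) (algebraMap A B w) where
  linearBound := hg.hasLinearBound hN h.linearBound
  mem := Ideal.mem_map_of_mem _ h.mem
  nzd := by
    have := hg.flat
    exact algebraMap_mem_nonZeroDivisors_of_flat h.nzd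
  colon n a ha := by
    rw [hg.icF_map K hN] at ha ⊢
    have := hg.flat
    exact Ideal.mem_map_of_mul_mem_map (h.colon n) ha

theorem Ideal.exists_span_image_Iio_eq [IsNoetherianRing A] (K : Ideal A) :
    ∃ (a : ℕ → A) (s : ℕ), Ideal.span (a '' Set.Iio s) = K := by
  obtain ⟨n, f, hf⟩ := Submodule.fg_iff_exists_fin_generating_family.1 (IsNoetherian.noetherian K)
  refine ⟨fun i => if h : i < n then f ⟨i, h⟩ else 0, n, ?_⟩
  rw [← hf]
  congr 1
  ext x
  constructor
  · rintro ⟨i, hi, rfl⟩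
    exact ⟨⟨i, hi⟩, by simp [show i < n from hi]⟩
  · rintro ⟨i, rfl⟩
    exact ⟨i, i.2, by simp⟩

theorem exists_isGoodExtension_trans {R T S : Type} [CommRing R] [CommRing T] [CommRing S] [IsLocalRing R]
    [IsLocalRing T] [IsLocalRing S] [Algebra R T] [Algebra T S] (hT : IsGoodExtension R T)
    (hS : IsGoodExtension T S) :
    ∃ _ : Algebra R S, algebraMap R S = (algebraMap T S).comp (algebraMap R T) ∧ IsGoodExtension R S := by
  let alg : Algebra R S := ((algebraMap T S).comp (algebraMap R T)).toAlgebra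
  have tower : IsScalarTower R T S := IsScalarTower.of_algebraMap_eq' rfl
  exact ⟨alg, rfl, hT.trans hS⟩

/-- A complete good extension with a strictly superficial element. -/
theorem exists_isGoodExtension_isStrictSuperficial (R : Type) [CommRing R] [IsLocalRing R] [IsNoetherianRing R]
    (K : Ideal R) (hN : ∃ N, maximalIdeal R ^ N ≤ K) (hK : K.HasLinearBound) {x : R} (hx : x ∈ K)
    (hx' : x ∈ nonZeroDivisors R) :
    ∃ (S : Type) (_ : CommRing S) (_ : IsLocalRing S) (_ : IsNoetherianRing S) (_ : IsAdicComplete (maximalIdeal S) S)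
      (_ : Algebra R S), IsGoodExtension R S ∧ ∃ w, IsStrictSuperficial (K.map (algebraMap R S)) w := by
  obtain ⟨a, s, ha⟩ := K.exists_span_image_Iio_eq
  have h := isStrictSuperficial_genPoly hK hx hx' a s ha
  let q : Ideal R[X] := (maximalIdeal R).map (C : R →+* R[X])
  have : q.IsPrime := Ideal.isPrime_map_C_of_isPrime
  let T := Localization.AtPrime q
  have hT : IsGoodExtension R T := isGoodExtension_of_isLocalization (P := R[X])
    (fun I n => Ideal.icF_map_C I n) q rfl
  have h2 : IsStrictSuperficial (K.map (algebraMap R T)) (algebraMap R[X] T (genPoly a s)) := by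
    rw [IsScalarTower.algebraMap_eq R R[X] T, ← Ideal.map_map]
    exact h.of_isLocalization q.primeCompl
  have hTn : IsNoetherianRing T := IsLocalization.isNoetherianRing q.primeCompl T inferInstance
  let S := AdicCompletion (maximalIdeal T) T
  have hS := AdicCompletion.isGoodExtension T
  have hN2 : ∃ N, maximalIdeal T ^ N ≤ K.map (algebraMap R T) := by
    obtain ⟨N, hN⟩ := hN
    exact ⟨N, hT.pow_le hN⟩
  have h3 := h2.of_isGoodExtension hS hN2
  have hSn : IsNoetherianRing S := AdicCompletion.isNoetherianRing T
  have hSc : IsAdicComplete (maximalIdeal S) S := by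
    rw [← hS.map_max]
    exact AdicCompletion.isAdicComplete_self _ (IsNoetherian.noetherian _)
  obtain ⟨alg, halg, hg⟩ := exists_isGoodExtension_trans hT hS
  rw [Ideal.map_map, ← halg] at h3
  exact ⟨S, inferInstance, inferInstance, hSn, hSc, alg, hg, _, h3⟩

end

theorem IsGoodExtension.nonempty_goodFlatExtension [IsLocalRing A] {S : Type} [CommRing S] [IsLocalRing S]
    [Algebra A S] [IsNoetherianRing S] [IsAdicComplete (maximalIdeal S) S] (hS : IsGoodExtension A S) {K : Ideal A}
    (hK : K ≤ maximalIdeal A) (hN : ∃ N, maximalIdeal A ^ N ≤ K) {w : S}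
    (hw : IsStrictSuperficial (K.map (algebraMap A S)) w) {x₁ x₂ : S} (hx₁ : x₁ ∈ K.map (algebraMap A S))
    (hx₂ : x₂ ∈ K.map (algebraMap A S)) (hreg : IsRegularPair x₁ x₂) : Nonempty (GoodFlatExtension K) := by
  obtain ⟨a, s, ha⟩ := (K.map (algebraMap A S)).exists_span_image_Iio_eq
  have hK' : K.map (algebraMap A S) ≤ maximalIdeal S := by
    rw [← hS.map_max]
    exact Ideal.map_mono hK
  have hN' := hN
  obtain ⟨N, hN0⟩ := hN'
  have hpair := isSuperficialPair_genPoly hw hK' (hS.pow_le hN0) hx₁ hx₂ hreg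
    (fun M z => hreg.dvd_of_forall_dvd_mul hx₁ hx₂ hw.nzd M z) a s ha
  let q : Ideal S[X][X] := ((maximalIdeal S).map (C : S →+* S[X])).map (C : S[X] →+* S[X][X])
  have hq0 : ((maximalIdeal S).map (C : S →+* S[X])).IsPrime := Ideal.isPrime_map_C_of_isPrime
  have hq : q.IsPrime := Ideal.isPrime_map_C_of_isPrime
  let B := Localization.AtPrime q
  have hCC : algebraMap S S[X][X] = (C : S[X] →+* S[X][X]).comp (C : S →+* S[X]) := rfl
  have hflat : Module.Flat S S[X][X] := Module.Flat.trans S S[X] S[X][X]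
  have hSB : IsGoodExtension S B := isGoodExtension_of_isLocalization (P := S[X][X])
    (fun I n => by
      rw [hCC, ← Ideal.map_map, ← Ideal.map_map, Ideal.icF_map_C, Ideal.icF_map_C]) q
    (by rw [hCC, ← Ideal.map_map])
  have hAB := hS.trans hSB
  have hKB : K.map (algebraMap A B) =
      (((K.map (algebraMap A S)).map (C : S →+* S[X])).map (C : S[X] →+* S[X][X])).map (algebraMap S[X][X] B) := by
    rw [IsScalarTower.algebraMap_eq A S B, IsScalarTower.algebraMap_eq S S[X][X] B, hCC]
    simp only [Ideal.map_map]
    rfl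
  have hle : K.map (algebraMap A B) ≤ maximalIdeal B := by
    rw [← hAB.map_max]
    exact Ideal.map_mono hK
  have hNB : ∃ N, maximalIdeal B ^ N ≤ K.map (algebraMap A B) := ⟨N, hAB.pow_le hN0⟩
  refine ⟨{
    B := B
    flat := hAB.flat
    localHom := hAB.isLocalHom
    map_maximal := hAB.map_max
    y := algebraMap S[X][X] B (pencil (C w) (genPoly a s))
    y_mem := ?_
    quotient_unramified := ?_
    superficial_adic := ?_
    superficial_intCl := ?_
    quotient_integrally_closed := ?_
    map_intCl := ?_ }⟩
  · rw [hKB]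
    exact Ideal.mem_map_of_mem _ hpair.pencil_mem
  · rw [hKB] at hle hNB
    exact hpair.isReduced_adicCompletion_quotient B q.primeCompl hle hNB
  · rw [hKB]
    exact hpair.isSuperficialFor_pow B q.primeCompl
  · rw [hKB]
    exact hpair.isSuperficialFor_icF B q.primeCompl
  · rw [hKB]
    exact hpair.intCl_quotient B q.primeCompl _ (by rw [Ideal.map_span, Set.image_singleton])
  · exact fun n _ => (hAB.icF_map K hN n).symm

theorem nonempty_goodFlatExtension_of_hasLinearBound [IsLocalRing A] [IsNoetherianRing A]
    (hdepth : HasDepthGE A 2) {K : Ideal A} (hK : K.IsMPrimary)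
    (h : (K.map (algebraMap A (AdicCompletion (maximalIdeal A) A))).HasLinearBound) :
    Nonempty (GoodFlatExtension K) := by
  have hKm : K ≤ maximalIdeal A := hK ▸ Ideal.le_radical
  obtain ⟨N, hN⟩ : ∃ N, maximalIdeal A ^ N ≤ K := by
    obtain ⟨N, hN⟩ := Ideal.exists_radical_pow_le_of_fg K (IsNoetherian.noetherian _)
    rw [hK] at hN
    exact ⟨N, hN⟩
  obtain ⟨x, hx, y, hy, hxy⟩ := hdepth.exists_isRegularPair
  let R := AdicCompletion (maximalIdeal A) A
  have hR : IsGoodExtension A R := AdicCompletion.isGoodExtension A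
  have hRn : IsNoetherianRing R := AdicCompletion.isNoetherianRing A
  have hxK : x ^ N ∈ K := hN (Ideal.pow_mem_pow hx N)
  have hyK : y ^ N ∈ K := hN (Ideal.pow_mem_pow hy N)
  have hp := (hxy.pow_left N).pow_right N
  have := hR.flat
  have hpR := hp.map (S := R)
  obtain ⟨S, _, _, _, _, _, hS, w, hw⟩ := exists_isGoodExtension_isStrictSuperficial R
    (K.map (algebraMap A R)) ⟨N, hR.pow_le hN⟩ h (Ideal.mem_map_of_mem _ hxK) hpR.nzd
  obtain ⟨alg, halg, hg⟩ := exists_isGoodExtension_trans hR hS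
  rw [Ideal.map_map, ← halg] at hw
  have := hg.flat
  exact hg.nonempty_goodFlatExtension hKm ⟨N, hN⟩ hw (Ideal.mem_map_of_mem _ hxK) (Ideal.mem_map_of_mem _ hyK) hp.map

/-- A square-zero extension of a field of characteristic `p` by a ring of characteristic `p` splits. -/
theorem exists_subring_of_square_zero_of_prime {R k : Type} [CommRing R] [Field k] (π : R →+* k)
    (hπ : Function.Surjective π) (hsq : ∀ x y, π x = 0 → π y = 0 → x * y = 0) {p : ℕ} (hp : p.Prime)
    (hpR : (p : R) = 0) :
    ∃ T : Subring R, (∀ t ∈ T, π t = 0 → t = 0) ∧ ∀ c, ∃ t ∈ T, π t = c := by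
  have hfact : Fact p.Prime := ⟨hp⟩
  have hnt : Nontrivial R := π.domain_nontrivial
  have hchar : CharP R p := (CharP.charP_iff_prime_eq_zero hp).2 hpR
  have hker : ∀ x, π x = 0 → x ^ p = 0 := fun x hx => by
    rw [← Nat.sub_add_cancel hp.two_le, pow_add, pow_two, hsq x x hx hx, mul_zero]
  let 𝒮 : Set (Subring R) := {T | (∀ x, x ^ p ∈ T) ∧ ∀ t ∈ T, π t = 0 → t = 0}
  have h0 : (frobenius R p).range ∈ 𝒮 := by
    refine ⟨fun x => ⟨x, frobenius_def p x⟩, ?_⟩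
    rintro _ ⟨x, rfl⟩ hx
    rw [frobenius_def, map_pow] at hx
    exact hker x (pow_eq_zero_iff hp.ne_zero |>.1 hx)
  obtain ⟨T, -, hT⟩ := zorn_le_nonempty₀ 𝒮 (fun c hc hchain T hTc => by
    have hd : DirectedOn (· ≤ ·) c := hchain.directedOn
    refine ⟨sSup c, ⟨fun x => ?_, fun t ht => ?_⟩, fun T' hT' => le_sSup hT'⟩
    · exact (le_sSup hTc : T ≤ sSup c) ((hc hTc).1 x)
    · obtain ⟨T', hT', h⟩ := (Subring.mem_sSup_of_directedOn ⟨T, hTc⟩ hd).1 ht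
      exact (hc hT').2 t h) _ h0
  refine ⟨T, hT.prop.2, ?_⟩
  let F : Subfield k :=
    { T.map π with
      inv_mem' := by
        rintro _ ⟨t, ht, rfl⟩
        obtain ⟨s, hs⟩ := hπ (π t)⁻¹
        refine ⟨t ^ (p - 1) * s ^ p, mul_mem (pow_mem ht _) (hT.prop.1 s), ?_⟩
        rw [map_mul, map_pow, map_pow, hs]
        by_cases h : π t = 0
        · simp [h, hp.ne_zero]
        · rw [inv_pow, ← div_eq_mul_inv, div_eq_iff (pow_ne_zero _ h), ← Nat.sub_add_cancel hp.one_le, pow_succ']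
          simp [h] }
  by_contra hcon
  push Not at hcon
  obtain ⟨c, hc⟩ := hcon
  obtain ⟨e, rfl⟩ := hπ c
  have heF : π e ∉ F := fun ⟨t, ht, h⟩ => hc t ht h
  let j : T →+* F := (π.comp T.subtype).codRestrict F fun t => ⟨t, t.2, rfl⟩
  have hj : Function.Injective j := by
    rw [injective_iff_map_eq_zero]
    exact fun t ht => Subtype.ext (hT.prop.2 t t.2 (congrArg Subtype.val ht))
  let ep : T := ⟨e ^ p, hT.prop.1 e⟩
  have hirr : Irreducible (X ^ p - C (j ep)) := by
    refine X_pow_sub_C_irreducible_of_prime hp fun b hb => heF ?_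
    have hb' : (b : k) ^ p = π e ^ p := by
      rw [← map_pow]
      exact congrArg Subtype.val hb
    have hck : CharP k p := (CharP.charP_iff_prime_eq_zero hp).2 (by rw [← map_natCast π, hpR, map_zero])
    rw [← frobenius_inj k p hb']
    exact b.2
  have hmin : X ^ p - C (j ep) = minpoly F (π e) := by
    refine minpoly.eq_of_irreducible_of_monic hirr ?_ (monic_X_pow_sub_C _ hp.ne_zero)
    simp only [map_sub, map_pow, aeval_X, aeval_C]
    exact sub_eq_zero.2 (map_pow π e p).symm
  have hT' : (Algebra.adjoin T {e}).toSubring ∈ 𝒮 := by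
    refine ⟨fun x => (Algebra.adjoin T {e}).algebraMap_mem ⟨x ^ p, hT.prop.1 x⟩, fun t ht h => ?_⟩
    obtain ⟨f, rfl⟩ := (Algebra.adjoin_singleton_eq_range_aeval T e ▸ ht : t ∈ (aeval (R := T) e).range)
    have hm := monic_X_pow_sub_C ep hp.ne_zero
    have hev : aeval e (X ^ p - C ep) = 0 := by
      simp only [map_sub, map_pow, aeval_X, aeval_C]
      exact sub_self _
    have hf : aeval e f = aeval e (f %ₘ (X ^ p - C ep)) := by
      conv_lhs => rw [← modByMonic_add_div f (X ^ p - C ep), map_add, map_mul, hev, zero_mul, add_zero]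
    change π (aeval e f) = 0 at h
    change aeval e f = 0
    rw [hf] at h ⊢
    set r := f %ₘ (X ^ p - C ep)
    have hr : (r.map j) = 0 := by
      refine eq_zero_of_dvd_of_degree_lt (p := minpoly F (π e)) (minpoly.dvd F _ ?_) ?_
      · rw [aeval_def, eval₂_map]
        rw [aeval_def, hom_eval₂] at h
        exact h
      · rw [← hmin, degree_X_pow_sub_C hp.pos, degree_map_eq_of_injective hj]
        have := degree_modByMonic_lt f hm
        rwa [degree_X_pow_sub_C hp.pos] at this
    rw [(Polynomial.map_eq_zero_iff hj).1 hr, map_zero]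
  have hle : T ≤ (Algebra.adjoin T {e}).toSubring := fun t ht => (Algebra.adjoin T {e}).algebraMap_mem ⟨t, ht⟩
  exact hc e (hT.le_of_ge hT' hle (Algebra.self_mem_adjoin_singleton T e)) rfl

/-- A square-zero extension of a field of characteristic zero splits. -/
theorem exists_subring_of_square_zero_of_charZero {R k : Type} [CommRing R] [Field k] [CharZero k] (π : R →+* k)
    (hπ : Function.Surjective π) (hsq : ∀ x y, π x = 0 → π y = 0 → x * y = 0) :
    ∃ T : Subring R, (∀ t ∈ T, π t = 0 → t = 0) ∧ ∀ c, ∃ t ∈ T, π t = c := by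
  have hunit : ∀ n : nonZeroDivisors ℤ, IsUnit (Int.castRingHom R n) := fun n => by
    obtain ⟨s, hs⟩ := hπ ((n : ℤ) : k)⁻¹
    have hn : ((n : ℤ) : k) ≠ 0 := Int.cast_ne_zero.2 (nonZeroDivisors.ne_zero n.2)
    have h1 : π (Int.castRingHom R n * s - 1) = 0 := by
      rw [map_sub, map_mul, hs, map_one, eq_intCast, map_intCast, mul_inv_cancel₀ hn, sub_self]
    have h2 := hsq _ _ h1 h1
    refine IsUnit.of_mul_eq_one (s * (2 - Int.castRingHom R n * s)) ?_
    linear_combination -h2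
  let f : ℚ →+* R := IsLocalization.lift (M := nonZeroDivisors ℤ) hunit
  let algR : Algebra ℚ R := f.toAlgebra
  let πa : R →ₐ[ℚ] k := { π with commutes' := fun q => by simp }
  obtain ⟨s, hs⟩ := exists_isTranscendenceBasis ℚ k
  have halg : Algebra.IsAlgebraic (IntermediateField.adjoin ℚ (Set.range ((↑) : s → k))) k := hs.isAlgebraic_field
  have hsm : Algebra.FormallySmooth ℚ k := Algebra.FormallySmooth.of_algebraicIndependent_of_isSeparable hs.1
  have hnil : IsNilpotent (RingHom.ker (πa : R →+* k)) := by
    refine ⟨2, ?_⟩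
    rw [pow_two, Ideal.zero_eq_bot, eq_bot_iff, Ideal.mul_le]
    exact fun x hx y hy => hsq x y hx hy
  let σ := Algebra.FormallySmooth.liftOfSurjective (AlgHom.id ℚ k) πa hπ hnil
  have hσ : ∀ c, π (σ c) = c := Algebra.FormallySmooth.liftOfSurjective_apply (AlgHom.id ℚ k) πa hπ hnil
  refine ⟨(σ : k →+* R).range, ?_, fun c => ⟨σ c, ⟨c, rfl⟩, hσ c⟩⟩
  rintro _ ⟨c, rfl⟩ h
  rw [show c = 0 from (hσ c).symm.trans h, map_zero]

section

theorem exists_subring_of_square_zero {R k : Type} [CommRing R] [Field k] (π : R →+* k)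
    (hπ : Function.Surjective π) (hsq : ∀ x y, π x = 0 → π y = 0 → x * y = 0) (q : ℕ) [CharP k q]
    (hq : (q : R) = 0) :
    ∃ T : Subring R, (∀ t ∈ T, π t = 0 → t = 0) ∧ ∀ c, ∃ t ∈ T, π t = c := by
  rcases CharP.char_is_prime_or_zero k q with h | rfl
  · exact exists_subring_of_square_zero_of_prime π hπ hsq h hq
  · have := CharP.charP_to_charZero k
    exact exists_subring_of_square_zero_of_charZero π hπ hsq

section CoefficientRing
variable {E : Type} [CommRing E] [IsLocalRing E]

/-- A subring of a local ring whose image modulo `𝔪 ^ n` is a coefficient ring. -/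
structure IsApproxCoefficientRing (q n : ℕ) (W : Subring E) : Prop where
  pow : ∀ x ∈ maximalIdeal E ^ n, x ∈ W
  surj : ∀ e, ∃ w ∈ W, e - w ∈ maximalIdeal E
  ker : ∀ w ∈ W, w ∈ maximalIdeal E → ∃ u ∈ W, w - q * u ∈ maximalIdeal E ^ n

theorem natCast_mem_maximalIdeal (q : ℕ) [CharP (ResidueField E) q] : (q : E) ∈ maximalIdeal E := by
  rw [← residue_eq_zero_iff, map_natCast, CharP.cast_eq_zero]

namespace IsApproxCoefficientRing
variable {q : ℕ} [CharP (ResidueField E) q] {n : ℕ} {W : Subring E}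

theorem exists_le (hn : 1 ≤ n) (h : IsApproxCoefficientRing q n W) :
    ∃ W' ≤ W, IsApproxCoefficientRing q (n + 1) W' ∧ ∀ w ∈ W, ∃ w' ∈ W', w - w' ∈ maximalIdeal E ^ n := by
  have hqm := natCast_mem_maximalIdeal (E := E) q
  let 𝔞 : Ideal W := Ideal.span {(q : W)} ⊔ (maximalIdeal E ^ (n + 1)).comap W.subtype
  have hmem : ∀ w : W, w ∈ 𝔞 ↔ ∃ u ∈ W, (w : E) - q * u ∈ maximalIdeal E ^ (n + 1) := by
    intro w
    rw [Ideal.mem_span_singleton_sup]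
    constructor
    · rintro ⟨a, b, hb, rfl⟩
      refine ⟨a, a.2, ?_⟩
      have : ((a * (q : W) + b : W) : E) - q * a = b := by push_cast; ring
      rwa [this]
    · rintro ⟨u, hu, h⟩
      refine ⟨⟨u, hu⟩, w - ⟨u, hu⟩ * q, ?_, by ring⟩
      rw [Ideal.mem_comap]
      have : W.subtype (w - ⟨u, hu⟩ * q) = (w : E) - q * u := by simp [mul_comm]
      rwa [this]
  let π : W ⧸ 𝔞 →+* ResidueField E := Ideal.Quotient.lift 𝔞 ((residue E).comp W.subtype) fun w hw => by
    obtain ⟨u, hu, hwu⟩ := (hmem w).1 hw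
    refine (residue_eq_zero_iff _).2 ?_
    have := add_mem (Ideal.pow_le_self (by omega) hwu) (Ideal.mul_mem_right u _ hqm)
    rwa [sub_add_cancel] at this
  have hπ0 : ∀ w : W, π (Ideal.Quotient.mk 𝔞 w) = 0 ↔ (w : E) ∈ maximalIdeal E := fun w => residue_eq_zero_iff _
  have hπs : Function.Surjective π := fun c => by
    obtain ⟨e, rfl⟩ := residue_surjective c
    obtain ⟨w, hw, hew⟩ := h.surj e
    refine ⟨Ideal.Quotient.mk 𝔞 ⟨w, hw⟩, ?_⟩
    change residue E w = residue E e
    rw [eq_comm, ← sub_eq_zero, ← map_sub, residue_eq_zero_iff]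
    exact hew
  have hsq : ∀ x y, π x = 0 → π y = 0 → x * y = 0 := fun x y hx hy => by
    obtain ⟨x, rfl⟩ := Ideal.Quotient.mk_surjective x
    obtain ⟨y, rfl⟩ := Ideal.Quotient.mk_surjective y
    obtain ⟨u, hu, hxu⟩ := h.ker x x.2 ((hπ0 x).1 hx)
    obtain ⟨v, hv, hyv⟩ := h.ker y y.2 ((hπ0 y).1 hy)
    rw [← map_mul, Ideal.Quotient.eq_zero_iff_mem, hmem]
    refine ⟨u * y + (x - q * u) * v, add_mem (mul_mem hu y.2) (mul_mem (h.pow _ hxu) hv), ?_⟩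
    have : ((x * y : W) : E) - q * (u * y + (x - q * u) * v) = (x - q * u) * (y - q * v) := by
      push_cast; ring
    rw [this]
    exact Ideal.pow_le_pow_right (by omega) (pow_add (maximalIdeal E) n n ▸ Ideal.mul_mem_mul hxu hyv)
  obtain ⟨T, hT, hTs⟩ := exists_subring_of_square_zero π hπs hsq q ((map_natCast (Ideal.Quotient.mk 𝔞) q).symm.trans
    (Ideal.Quotient.eq_zero_iff_mem.2 (Ideal.mem_sup_left (Ideal.mem_span_singleton_self _))))
  let W' : Subring E := (T.comap (Ideal.Quotient.mk 𝔞)).map W.subtype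
  have hW' : ∀ w : W, Ideal.Quotient.mk 𝔞 w ∈ T → (w : E) ∈ W' := fun w hw => ⟨w, hw, rfl⟩
  have h𝔞 : ∀ w ∈ 𝔞, (w : E) ∈ W' := fun w hw => hW' w (by
    rw [Ideal.Quotient.eq_zero_iff_mem.2 hw]; exact zero_mem T)
  have hle : W' ≤ W := by
    rintro _ ⟨w, -, rfl⟩
    exact w.2
  have hpow : ∀ x ∈ maximalIdeal E ^ (n + 1), x ∈ W' := fun x hx =>
    h𝔞 ⟨x, h.pow x (Ideal.pow_le_pow_right (by omega) hx)⟩ (Ideal.mem_sup_right hx)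
  have hqW : ∀ u ∈ W, q * u ∈ W' := fun u hu =>
    h𝔞 ((q : W) * ⟨u, hu⟩) (Ideal.mem_sup_left (Ideal.mul_mem_right _ _ (Ideal.mem_span_singleton_self _)))
  have hsurj : ∀ e, ∃ w ∈ W', e - w ∈ maximalIdeal E := fun e => by
    obtain ⟨t, ht, hte⟩ := hTs (residue E e)
    obtain ⟨w, rfl⟩ := Ideal.Quotient.mk_surjective t
    refine ⟨w, hW' w ht, ?_⟩
    rw [← residue_eq_zero_iff, map_sub, sub_eq_zero]
    exact hte.symm
  have hmod : ∀ w ∈ W, ∃ w' ∈ W', w - w' ∈ maximalIdeal E ^ n := fun w hw => by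
    obtain ⟨w', hw', hww⟩ := hsurj w
    obtain ⟨u, hu, h1⟩ := h.ker (w - w') (sub_mem hw (hle hw')) hww
    refine ⟨w' + q * u, add_mem hw' (hqW u hu), ?_⟩
    rwa [← sub_sub]
  refine ⟨W', hle, ⟨hpow, hsurj, ?_⟩, hmod⟩
  rintro _ ⟨w, hw, rfl⟩ hwm
  have hw0 := hT _ hw ((hπ0 w).2 hwm)
  obtain ⟨u, hu, h1⟩ := (hmem w).1 (Ideal.Quotient.eq_zero_iff_mem.1 hw0)
  obtain ⟨u', hu', h2⟩ := hmod u hu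
  refine ⟨u', hu', ?_⟩
  have : W.subtype w - q * u' = (w - q * u) + q * (u - u') := by
    rw [Subring.subtype_apply]; ring
  rw [this]
  refine add_mem h1 ?_
  rw [pow_succ']
  exact Ideal.mul_mem_mul hqm h2

end IsApproxCoefficientRing

theorem exists_seq_isApproxCoefficientRing (q : ℕ) [CharP (ResidueField E) q] :
    ∃ W : ℕ → Subring E, ∀ n, W (n + 1) ≤ W n ∧ IsApproxCoefficientRing q (n + 1) (W n) ∧
      ∀ w ∈ W n, ∃ w' ∈ W (n + 1), w - w' ∈ maximalIdeal E ^ (n + 1) := by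
  have h0 : IsApproxCoefficientRing (E := E) q 1 ⊤ :=
    ⟨fun _ _ => trivial, fun e => ⟨e, trivial, by simp⟩, fun w _ hw => ⟨0, zero_mem _, by simpa using hw⟩⟩
  let step (n : ℕ) (W : {W : Subring E // IsApproxCoefficientRing q (n + 1) W}) :
      {W : Subring E // IsApproxCoefficientRing q (n + 2) W} :=
    ⟨(W.2.exists_le (by omega)).choose, (W.2.exists_le (by omega)).choose_spec.2.1⟩
  let W (n : ℕ) : {W : Subring E // IsApproxCoefficientRing q (n + 1) W} := Nat.rec ⟨⊤, h0⟩ step n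
  refine ⟨fun n => (W n).1, fun n => ⟨?_, (W n).2, ?_⟩⟩
  · exact ((W n).2.exists_le (by omega)).choose_spec.1
  · exact ((W n).2.exists_le (by omega)).choose_spec.2.2

end CoefficientRing

end

theorem Ideal.mem_of_forall_mem_sup_pow {R : Type} [CommRing R] [IsLocalRing R] [IsNoetherianRing R] {I : Ideal R}
    {x : R} (h : ∀ n, x ∈ I ⊔ maximalIdeal R ^ n) : x ∈ I := by
  have hH : IsHausdorff (maximalIdeal R) (R ⧸ I) :=
    IsHausdorff.of_le_jacobson _ _ (by rw [IsLocalRing.jacobson_eq_maximalIdeal _ bot_ne_top])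
  rw [← Ideal.Quotient.eq_zero_iff_mem]
  refine hH.haus _ fun n => ?_
  rw [SModEq.zero]
  obtain ⟨a, ha, b, hb, rfl⟩ := Submodule.mem_sup.1 (h n)
  rw [map_add, Ideal.Quotient.eq_zero_iff_mem.2 ha, zero_add]
  have : Ideal.Quotient.mk I b = b • (1 : R ⧸ I) := by
    rw [Algebra.smul_def, mul_one]; rfl
  rw [this]
  exact Submodule.smul_mem_smul hb trivial

theorem exists_coefficientRing (E : Type) [CommRing E] [IsDomain E] [IsLocalRing E] [IsNoetherianRing E]
    [IsAdicComplete (maximalIdeal E) E] (q : ℕ) [CharP (ResidueField E) q] :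
    ∃ V : Subring E, (∀ e, ∃ v ∈ V, e - v ∈ maximalIdeal E) ∧
      (∀ v ∈ V, v ∈ maximalIdeal E → ∃ u ∈ V, v = q * u) ∧ (∀ v ∈ V, v ∉ maximalIdeal E → ∃ u ∈ V, v * u = 1) ∧
      ∀ e, (∀ n, ∃ v ∈ V, e - v ∈ maximalIdeal E ^ n) → e ∈ V := by
  have hqm := natCast_mem_maximalIdeal (E := E) q
  obtain ⟨W, hW⟩ := exists_seq_isApproxCoefficientRing (E := E) q
  have hanti : Antitone W := antitone_nat_of_succ_le fun n => (hW n).1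
  have hV : ∀ x, x ∈ ⨅ n, W n ↔ ∀ n, x ∈ W n := fun x => Subring.mem_iInf
  have hsurj : ∀ e, ∃ v ∈ ⨅ n, W n, e - v ∈ maximalIdeal E := by
    intro e
    obtain ⟨w0, hw0, he⟩ := (hW 0).2.1.surj e
    have hstep : ∀ n, ∀ w : W n, ∃ w' : W (n + 1), (w : E) - w' ∈ maximalIdeal E ^ (n + 1) := fun n w =>
      let ⟨w', h, h'⟩ := (hW n).2.2 w w.2
      ⟨⟨w', h⟩, h'⟩
    choose step hstep using hstep
    let w (n : ℕ) : W n := Nat.rec ⟨w0, hw0⟩ step n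
    have hw : ∀ n, (w n).1 - (w (n + 1)).1 ∈ maximalIdeal E ^ (n + 1) := fun n => hstep n (w n)
    obtain ⟨L, hL⟩ := IsPrecomplete.exists_limit (I := maximalIdeal E) (fun n => (w n).1) fun n => by
      rw [← neg_sub]
      exact neg_mem (Ideal.pow_le_pow_right (Nat.le_succ n) (hw n))
    refine ⟨L, (hV L).2 fun n => ?_, ?_⟩
    · have := sub_mem ((hW n).1 (w (n + 1)).2) ((hW n).2.1.pow _ (hL (n + 1)))
      rwa [sub_sub_cancel] at this
    · have h1 := hw 0
      have h2 := hL 1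
      rw [zero_add, pow_one] at h1
      rw [pow_one] at h2
      have := add_mem (add_mem he h1) h2
      have h3 : e - w0 + ((w 0).1 - (w 1).1) + ((w 1).1 - L) = e - L := by
        change e - w0 + (w0 - (w 1).1) + ((w 1).1 - L) = e - L
        ring
      rwa [h3] at this
  refine ⟨⨅ n, W n, hsurj, fun v hv hvm => ?_, fun v hv hvm => ?_, fun e he => (hV e).2 fun n => ?_⟩
  · rw [hV] at hv
    have hn : ∀ n, ∃ u ∈ W n, v - q * u ∈ maximalIdeal E ^ (n + 1) := fun n => (hW n).2.1.ker v (hv n) hvm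
    have hvq : v ∈ Ideal.span {(q : E)} := by
      refine Ideal.mem_of_forall_mem_sup_pow fun n => ?_
      obtain ⟨u, -, h⟩ := hn n
      have := add_mem (Ideal.mem_sup_left (Ideal.mul_mem_right u _ (Ideal.mem_span_singleton_self (q : E))))
        (Ideal.mem_sup_right (Ideal.pow_le_pow_right (Nat.le_succ n) h))
      rwa [add_sub_cancel] at this
    obtain ⟨e, rfl⟩ := Ideal.mem_span_singleton.1 hvq
    by_cases hq0 : (q : E) = 0
    · exact ⟨0, zero_mem _, by rw [hq0, zero_mul, zero_mul]⟩
    refine ⟨e, (hV e).2 fun n => ?_, rfl⟩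
    obtain ⟨c, hc⟩ := Ideal.exists_pow_inf_eq_pow_smul (maximalIdeal E) (Ideal.span {(q : E)})
    obtain ⟨u, hu, h⟩ := hn (n + c)
    rw [← mul_sub] at h
    have h1 : (q : E) * (e - u) ∈ maximalIdeal E ^ (n + c + 1) • (⊤ : Ideal E) ⊓ Ideal.span {(q : E)} :=
      ⟨by rwa [smul_eq_mul, Ideal.mul_top], Ideal.mul_mem_right _ _ (Ideal.mem_span_singleton_self _)⟩
    rw [hc _ (by omega), show n + c + 1 - c = n + 1 by omega] at h1
    have h2 := Submodule.smul_mono le_rfl inf_le_right h1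
    rw [smul_eq_mul, mul_comm, Ideal.mem_span_singleton_mul] at h2
    obtain ⟨z, hz, hzq⟩ := h2
    have h3 := (hW n).2.1.pow _ hz
    rw [mul_left_cancel₀ hq0 hzq] at h3
    have := add_mem h3 (hanti (Nat.le_add_right n c) hu)
    rwa [sub_add_cancel] at this
  · obtain ⟨v', hv'⟩ := isUnit_iff_exists_inv.1 (not_not.1 (mt (mem_maximalIdeal v).2 hvm))
    obtain ⟨w, hw, h⟩ := hsurj v'
    refine ⟨v', (hV _).2 fun n => ?_, hv'⟩
    have hx : 1 - v * w ∈ maximalIdeal E := by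
      rw [← hv', ← mul_sub]
      exact Ideal.mul_mem_left _ _ h
    have key : v' = w * ∑ i ∈ Finset.range (n + 1), (1 - v * w) ^ i + v' * (1 - v * w) ^ (n + 1) := by
      have := mul_neg_geom_sum (1 - v * w) (n + 1)
      linear_combination -v' * this + (w * ∑ i ∈ Finset.range (n + 1), (1 - v * w) ^ i) * hv'
    rw [key]
    rw [hV] at hv hw
    refine add_mem (mul_mem (hw n) (sum_mem fun i _ => pow_mem (sub_mem (one_mem _) (mul_mem (hv n) (hw n))) i))
      ((hW n).2.1.pow _ (Ideal.mul_mem_left _ _ (Ideal.pow_mem_pow hx _)))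
  · obtain ⟨v, hv, h⟩ := he (n + 1)
    have := add_mem ((hW n).2.1.pow _ h) ((hV v).1 hv n)
    rwa [sub_add_cancel] at this

theorem exists_isPrincipalIdealRing_coefficientRing (E : Type) [CommRing E] [IsDomain E] [IsLocalRing E]
    [IsNoetherianRing E] [IsAdicComplete (maximalIdeal E) E] (q : ℕ) [CharP (ResidueField E) q] :
    ∃ (V : Subring E) (_ : IsLocalRing V), IsPrincipalIdealRing V ∧ maximalIdeal V = Ideal.span {(q : V)} ∧
      IsAdicComplete (maximalIdeal V) V ∧ ∀ e : E, ∃ v : V, e - (v : E) ∈ maximalIdeal E := by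
  obtain ⟨V, hsurj, hker, hunit, hclosed⟩ := exists_coefficientRing E q
  have hqm := natCast_mem_maximalIdeal (E := E) q
  have hHaus : IsHausdorff (maximalIdeal E) E := inferInstance
  have isUnit_iff : ∀ v : V, IsUnit v ↔ (v : E) ∉ maximalIdeal E := by
    intro v
    constructor
    · intro h
      have : IsUnit (v : E) := h.map V.subtype
      simpa using this
    · intro h
      obtain ⟨u, hu, h⟩ := hunit v v.2 h
      exact IsUnit.of_mul_eq_one ⟨u, hu⟩ (Subtype.ext h)
  have nonunit_iff : ∀ v : V, ¬ IsUnit v ↔ (q : V) ∣ v := by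
    intro v
    rw [isUnit_iff, not_not]
    constructor
    · intro h
      obtain ⟨u, hu, h⟩ := hker v v.2 h
      exact ⟨⟨u, hu⟩, Subtype.ext (by simpa using h)⟩
    · rintro ⟨u, rfl⟩
      simpa using Ideal.mul_mem_right (u : E) _ hqm
  have hloc : IsLocalRing V := by
    refine IsLocalRing.of_isUnit_or_isUnit_one_sub_self fun a => ?_
    by_contra! h
    obtain ⟨b, hb⟩ := (nonunit_iff _).1 h.1
    obtain ⟨c, hc⟩ := (nonunit_iff _).1 h.2
    exact (nonunit_iff 1).2 ⟨b + c, by rw [mul_add, ← hb, ← hc]; ring⟩ isUnit_one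
  have hmax : maximalIdeal V = Ideal.span {(q : V)} := by
    ext v
    rw [mem_maximalIdeal, mem_nonunits_iff, nonunit_iff, Ideal.mem_span_singleton]
  have hfact : ∀ v : V, v ≠ 0 → ∃ j, Associated ((q : V) ^ j) v := by
    intro v hv
    have hex : ∃ j, ¬ (q : V) ^ j ∣ v := by
      by_contra! h
      refine hv (Subtype.ext ?_)
      refine IsHausdorff.eq_zero_of_forall_mem_pow (I := maximalIdeal E) fun n => ?_
      obtain ⟨u, hu⟩ := h n
      rw [hu]
      push_cast
      exact Ideal.mul_mem_right _ _ (Ideal.pow_mem_pow hqm n)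
    classical
    obtain ⟨j, hj⟩ : ∃ j, Nat.find hex = j + 1 := by
      refine Nat.exists_eq_succ_of_ne_zero fun h0 => ?_
      have := Nat.find_spec hex
      rw [h0, pow_zero] at this
      exact this (one_dvd _)
    have h1 : (q : V) ^ j ∣ v := not_not.1 (Nat.find_min hex (show j < Nat.find hex by omega))
    have h2 := Nat.find_spec hex
    rw [hj] at h2
    obtain ⟨u, rfl⟩ := h1
    have hu : IsUnit u := by
      by_contra hu
      obtain ⟨w, rfl⟩ := (nonunit_iff u).1 hu
      exact h2 ⟨w, by ring⟩
    exact ⟨j, hu.unit, rfl⟩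
  have hPIR : IsPrincipalIdealRing V := by
    by_cases hq : (q : V) = 0
    · have hf : IsField V :=
        { exists_pair_ne := ⟨0, 1, zero_ne_one⟩
          mul_comm := mul_comm
          mul_inv_cancel := fun {a} ha => by
            have : IsUnit a := by
              by_contra h
              obtain ⟨w, hw⟩ := (nonunit_iff a).1 h
              exact ha (by rw [hw, hq, zero_mul])
            exact isUnit_iff_exists_inv.1 this }
      exact hf.isPrincipalIdealRing
    · have hq' : ¬ IsUnit (q : V) := (nonunit_iff _).2 dvd_rfl
      have hirr : Irreducible (q : V) := by
        refine ⟨hq', fun a b hab => ?_⟩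
        by_contra! h
        obtain ⟨a', rfl⟩ := (nonunit_iff a).1 h.1
        obtain ⟨b', rfl⟩ := (nonunit_iff b).1 h.2
        have : (q : V) * 1 = q * (q * (a' * b')) := by
          rw [mul_one]
          linear_combination hab
        exact hq' (IsUnit.of_mul_eq_one _ (mul_left_cancel₀ hq this).symm)
      have := IsDiscreteValuationRing.ofHasUnitMulPowIrreducibleFactorization (R := V)
        ⟨q, hirr, fun {x} hx => hfact x hx⟩
      infer_instance
  refine ⟨V, hloc, hPIR, hmax, ?_, fun e => ?_⟩
  swap
  · obtain ⟨v, hv, h⟩ := hsurj e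
    exact ⟨⟨v, hv⟩, h⟩
  have hdesc : ∀ (m : ℕ) (v : V) (e : E), (v : E) = q ^ m * e → (q : V) ^ m ∣ v := by
    intro m
    induction m with
    | zero => intro v e _; rw [pow_zero]; exact one_dvd _
    | succ m ih =>
      intro v e he
      have hv : ¬ IsUnit v := by
        rw [isUnit_iff, not_not, he, pow_succ', mul_assoc]
        exact Ideal.mul_mem_right _ _ hqm
      obtain ⟨u, rfl⟩ := (nonunit_iff v).1 hv
      by_cases hq : (q : E) = 0
      · have : (q : V) = 0 := Subtype.ext (by simpa using hq)
        rw [this, zero_mul]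
        exact dvd_zero _
      · have : (u : E) = q ^ m * e := by
          refine mul_left_cancel₀ hq ?_
          push_cast at he
          rw [he]
          ring
        rw [pow_succ']
        exact mul_dvd_mul_left _ (ih u e this)
  have hmem : ∀ (n : ℕ) (v : V), v ∈ maximalIdeal V ^ n ↔ (q : V) ^ n ∣ v := fun n v => by
    rw [hmax, Ideal.span_singleton_pow, Ideal.mem_span_singleton]
  have hle : ∀ (n : ℕ) (v : V), v ∈ maximalIdeal V ^ n → (v : E) ∈ maximalIdeal E ^ n := fun n v hv => by
    obtain ⟨u, rfl⟩ := (hmem n v).1 hv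
    push_cast
    exact Ideal.mul_mem_right _ _ (Ideal.pow_mem_pow hqm n)
  refine isAdicComplete_of_forall (fun x hx => Subtype.ext ?_) fun f hf => ?_
  · exact IsHausdorff.eq_zero_of_forall_mem_pow (I := maximalIdeal E) fun n => hle n x (hx n)
  · obtain ⟨L, hL⟩ := IsPrecomplete.exists_limit (I := maximalIdeal E) (fun n => (f n : E)) fun n =>
      hle n _ (hf n (n + 1) (Nat.le_succ n))
    have hLV : L ∈ V := hclosed L fun n => ⟨f n, (f n).2, by rw [← neg_sub]; exact neg_mem (hL n)⟩
    refine ⟨⟨L, hLV⟩, fun n => (hmem _ _).2 ?_⟩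
    have : ((f n : E) - L) ∈ Ideal.span {(q : E) ^ n} := by
      refine Ideal.mem_of_forall_mem_sup_pow fun k => ?_
      obtain ⟨u, hu⟩ := (hmem _ _).1 (hf n (n + k) (Nat.le_add_right n k))
      have hu' : (f (n + k) : E) - f n = q ^ n * u := by
        have := congrArg Subtype.val hu
        simpa using this
      have h1 : (f n : E) - f (n + k) ∈ Ideal.span {(q : E) ^ n} :=
        Ideal.mem_span_singleton.2 ⟨-u, by linear_combination -hu'⟩
      have := add_mem (Ideal.mem_sup_left h1)
        (Ideal.mem_sup_right (Ideal.pow_le_pow_right (Nat.le_add_left k n) (hL (n + k))))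
      rwa [sub_add_sub_cancel] at this
    obtain ⟨e, he⟩ := Ideal.mem_span_singleton.1 this
    exact hdesc n (f n - ⟨L, hLV⟩) e (by simpa using he)

section

section

variable {Q : Type} [CommRing Q] [IsLocalRing Q] [IsNoetherianRing Q]

theorem exists_pow_maximalIdeal_le_span_card_eq_ringKrullDim (Q : Type) [CommRing Q] [IsLocalRing Q]
    [IsNoetherianRing Q] : ∃ s : Finset Q, Ideal.span (s : Set Q) ≤ maximalIdeal Q ∧
      (∃ N, maximalIdeal Q ^ N ≤ Ideal.span (s : Set Q)) ∧ (s.card : WithBot ℕ∞) = ringKrullDim Q := by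
  obtain ⟨s, hs, hc⟩ := Ideal.exists_finset_card_eq_height_of_isNoetherianRing (maximalIdeal Q)
  refine ⟨s, hs.1.2, ?_, ?_⟩
  · obtain ⟨N, hN⟩ := Ideal.exists_radical_pow_le_of_fg (Ideal.span (s : Set Q)) (IsNoetherian.noetherian _)
    refine ⟨N, le_trans (Ideal.pow_right_mono ?_ N) hN⟩
    rw [Ideal.radical_eq_sInf]
    exact le_sInf fun J hJ => hs.2 ⟨hJ.2, hJ.1⟩ (IsLocalRing.le_maximalIdeal hJ.2.ne_top)
  · rw [← IsLocalRing.maximalIdeal_height_eq_ringKrullDim, ← hc]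
    rfl

theorem ringKrullDim_le_card_of_pow_maximalIdeal_le (s : Finset Q) (hs : Ideal.span (s : Set Q) ≤ maximalIdeal Q)
    {N : ℕ} (hN : maximalIdeal Q ^ N ≤ Ideal.span (s : Set Q)) : ringKrullDim Q ≤ s.card := by
  rw [← IsLocalRing.maximalIdeal_height_eq_ringKrullDim]
  have : maximalIdeal Q ∈ (Ideal.span (s : Set Q)).minimalPrimes := by
    refine ⟨⟨inferInstance, hs⟩, fun J hJ hle => ?_⟩
    have := hJ.1
    exact this.le_of_pow_le (hN.trans hJ.2)
  exact_mod_cast Ideal.height_le_card_of_mem_minimalPrimes_span_finset this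

theorem ringKrullDim_powerSeries_le (S : Type) [CommRing S] [IsNoetherianRing S] [IsLocalRing S] :
    ringKrullDim (PowerSeries S) ≤ ringKrullDim S + 1 := by
  have h1 : ((maximalIdeal (PowerSeries S)).height : WithBot ℕ∞) ≤
      ringKrullDim (PowerSeries S ⧸ Ideal.span {(PowerSeries.X : PowerSeries S)}) + 1 := by
    refine Ideal.height_le_ringKrullDim_quotient_add_one ?_
    rw [mem_maximalIdeal, mem_nonunits_iff, PowerSeries.isUnit_iff_constantCoeff]
    simp
  rw [IsLocalRing.maximalIdeal_height_eq_ringKrullDim] at h1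
  refine h1.trans ?_
  gcongr
  refine ringKrullDim_le_of_surjective ((Ideal.Quotient.mk _).comp PowerSeries.C) fun x => ?_
  obtain ⟨f, rfl⟩ := Ideal.Quotient.mk_surjective x
  refine ⟨PowerSeries.constantCoeff f, ?_⟩
  rw [RingHom.comp_apply, Ideal.Quotient.eq, Ideal.mem_span_singleton, PowerSeries.X_dvd_iff]
  simp

theorem ringKrullDim_mvPowerSeries_le (S : Type) [CommRing S] [IsNoetherianRing S] [IsLocalRing S] (n : ℕ) :
    ringKrullDim (MvPowerSeries (Fin n) S) ≤ ringKrullDim S + n := by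
  induction n with
  | zero =>
    rw [ringKrullDim_eq_of_ringEquiv (MvPowerSeries.isEmptyEquiv (Fin 0) S).toRingEquiv]
    simp
  | succ n ih =>
    rw [ringKrullDim_eq_of_ringEquiv (MvPowerSeries.finSuccEquiv S n).toRingEquiv]
    refine (ringKrullDim_powerSeries_le _).trans ?_
    push_cast
    rw [← add_assoc]
    gcongr

theorem exists_fin_forall_sub_mem_pow {V E : Type} [CommRing V] [CommRing E] [IsLocalRing E] [IsNoetherianRing E]
    [Algebra V E] (hsurj : ∀ e : E, ∃ v : V, e - algebraMap V E v ∈ maximalIdeal E) (N : ℕ) :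
    ∃ (k : ℕ) (e : Fin k → E), ∀ x, ∃ c : Fin k → V, x - ∑ i, c i • e i ∈ maximalIdeal E ^ N := by
  suffices ∃ S : Submodule V E, S.FG ∧ ∀ x : E, ∃ s ∈ S, x - s ∈ maximalIdeal E ^ N by
    obtain ⟨S, hS, h⟩ := this
    obtain ⟨k, e, rfl⟩ := Submodule.fg_iff_exists_fin_generating_family.1 hS
    refine ⟨k, e, fun x => ?_⟩
    obtain ⟨s, hs, hx⟩ := h x
    obtain ⟨c, rfl⟩ := (Submodule.mem_span_range_iff_exists_fun V).1 hs
    exact ⟨c, hx⟩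
  induction N with
  | zero => exact ⟨⊥, Submodule.fg_bot, fun x => ⟨0, zero_mem _, by simp⟩⟩
  | succ N ih =>
    obtain ⟨S, hS, h⟩ := ih
    obtain ⟨t, a, ha⟩ := Submodule.fg_iff_exists_fin_generating_family.1
      (IsNoetherian.noetherian (maximalIdeal E ^ N))
    refine ⟨S ⊔ Submodule.span V (Set.range a), hS.sup (Submodule.fg_span (Set.finite_range a)), fun x => ?_⟩
    obtain ⟨s, hs, hx⟩ := h x
    rw [← ha] at hx
    obtain ⟨c, hc⟩ := (Submodule.mem_span_range_iff_exists_fun E).1 hx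
    choose v hv using hsurj
    refine ⟨s + ∑ i, v (c i) • a i, Submodule.add_mem_sup hs
      ((Submodule.mem_span_range_iff_exists_fun V).2 ⟨fun i => v (c i), rfl⟩), ?_⟩
    rw [← sub_sub, ← hc, ← Finset.sum_sub_distrib]
    refine sum_mem fun i _ => ?_
    rw [smul_eq_mul, Algebra.smul_def, ← sub_mul, pow_succ']
    refine Ideal.mul_mem_mul (hv _) ?_
    rw [← ha]
    exact Submodule.subset_span ⟨i, rfl⟩

end

end

section

section

variable {V E : Type} [CommRing V] [IsLocalRing V] [CommRing E] [IsLocalRing E] [IsNoetherianRing E]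
  [IsAdicComplete (maximalIdeal E) E] [Algebra V E]

theorem exists_mvPowerSeries_finite [IsAdicComplete (maximalIdeal V) V]
    (hm : (maximalIdeal V).map (algebraMap V E) ≤ maximalIdeal E)
    (hsurj : ∀ e : E, ∃ v : V, e - algebraMap V E v ∈ maximalIdeal E) (n : ℕ) (y : Fin n → E)
    (hy : ∀ i, y i ∈ maximalIdeal E) {N : ℕ}
    (hN : maximalIdeal E ^ N ≤ (maximalIdeal V).map (algebraMap V E) ⊔ Ideal.span (Set.range y)) :
    ∃ φ : MvPowerSeries (Fin n) V →+* E, (∀ v, φ (MvPowerSeries.C v) = algebraMap V E v) ∧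
      (∀ i, φ (MvPowerSeries.X i) = y i) ∧ φ.Finite := by
  obtain ⟨φ, hC, hX⟩ := MvPowerSeries.exists_evalHom (algebraMap V E) (maximalIdeal E) y hy
  refine ⟨φ, hC, hX, ?_⟩
  let _ : Algebra (MvPowerSeries (Fin n) V) E := φ.toAlgebra
  have hφ : ∀ x, algebraMap (MvPowerSeries (Fin n) V) E x = φ x := fun x => rfl
  have hyle : Ideal.span (Set.range y) ≤ maximalIdeal E := by
    rw [Ideal.span_le]
    rintro _ ⟨i, rfl⟩
    exact hy i
  have hJ : (Ideal.span (Set.range MvPowerSeries.X) : Ideal (MvPowerSeries (Fin n) V)).map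
      (algebraMap (MvPowerSeries (Fin n) V) E) = Ideal.span (Set.range y) := by
    rw [Ideal.map_span, ← Set.range_comp]
    congr 2
    funext i
    exact hX i
  obtain ⟨k, e, he⟩ := exists_fin_forall_sub_mem_pow hsurj N
  let E₁ := E ⧸ Ideal.span (Set.range y)
  have hmap : (maximalIdeal V).map (algebraMap V E₁) =
      ((maximalIdeal V).map (algebraMap V E)).map (Ideal.Quotient.mk (Ideal.span (Set.range y))) := by
    rw [Ideal.map_map]
    rfl
  have hlocal : IsLocalRing E₁ := by
    have : Nontrivial E₁ := Ideal.Quotient.nontrivial_iff.2 fun h =>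
      (maximalIdeal.isMaximal E).ne_top (top_le_iff.1 (h ▸ hyle))
    exact IsLocalRing.of_surjective' (Ideal.Quotient.mk _) Ideal.Quotient.mk_surjective
  have hH1 : IsHausdorff ((maximalIdeal V).map (algebraMap V E₁)) E₁ := by
    refine IsHausdorff.of_le_jacobson _ _ ?_
    rw [IsLocalRing.jacobson_eq_maximalIdeal _ bot_ne_top]
    have : IsLocalHom (Ideal.Quotient.mk (Ideal.span (Set.range y))) :=
      IsLocalHom.of_surjective _ Ideal.Quotient.mk_surjective
    rw [hmap]
    refine (Ideal.map_mono hm).trans ?_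
    exact ((IsLocalRing.local_hom_TFAE (Ideal.Quotient.mk (Ideal.span (Set.range y)))).out 0 2).1 this
  have h1 := Module.Finite.of_isPrecomplete (P := V) (E := E₁) (maximalIdeal V) k
    (fun i => Ideal.Quotient.mk _ (e i)) fun x => by
      obtain ⟨x, rfl⟩ := Ideal.Quotient.mk_surjective x
      obtain ⟨c, hc⟩ := he x
      refine ⟨c, ?_⟩
      have h2 := Ideal.mem_map_of_mem (Ideal.Quotient.mk (Ideal.span (Set.range y))) (hN hc)
      rw [Ideal.map_sup, Ideal.map_quotient_self, sup_bot_eq, ← hmap, map_sub, map_sum] at h2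
      exact h2
  have hH2 : IsHausdorff ((Ideal.span (Set.range MvPowerSeries.X) : Ideal (MvPowerSeries (Fin n) V)).map
      (algebraMap (MvPowerSeries (Fin n) V) E)) E := by
    refine IsHausdorff.of_le_jacobson _ _ ?_
    rw [IsLocalRing.jacobson_eq_maximalIdeal _ bot_ne_top, hJ]
    exact hyle
  have h2 := Module.Finite.of_isPrecomplete (P := MvPowerSeries (Fin n) V) (E := E)
    (Ideal.span (Set.range MvPowerSeries.X)) k e fun x => by
      obtain ⟨c, hc⟩ := h1 (Ideal.Quotient.mk _ x)
      refine ⟨fun i => MvPowerSeries.C (c i), ?_⟩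
      rw [hJ, ← Ideal.Quotient.eq, hc, map_sum]
      refine Finset.sum_congr rfl fun i _ => ?_
      rw [Algebra.smul_def (R := MvPowerSeries (Fin n) V), hφ, hC, map_mul, Algebra.smul_def]
      rfl
  refine ⟨Submodule.fg_iff_exists_fin_generating_family.2 ⟨k, e, ?_⟩⟩
  rw [eq_top_iff]
  intro x _
  obtain ⟨c, rfl⟩ := h2 x
  refine sum_mem fun i _ => Submodule.smul_mem _ _ (Submodule.subset_span ⟨i, rfl⟩)

theorem exists_mvPowerSeries_injective_finite [IsDomain V] [IsNoetherianRing V] [IsDomain E]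
    [IsAdicComplete (maximalIdeal V) V] (π : V) (hπ : maximalIdeal V = Ideal.span {π})
    (hπE : algebraMap V E π ∈ maximalIdeal E) (hinj : Function.Injective (algebraMap V E))
    (hsurj : ∀ e : E, ∃ v : V, e - algebraMap V E v ∈ maximalIdeal E) :
    ∃ (n : ℕ) (φ : MvPowerSeries (Fin n) V →+* E), Function.Injective φ ∧ φ.Finite := by
  classical
  have hm : (maximalIdeal V).map (algebraMap V E) = Ideal.span {algebraMap V E π} := by
    rw [hπ, Ideal.map_span, Set.image_singleton]
  let Q := E ⧸ Ideal.span {algebraMap V E π}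
  have hπle : Ideal.span {algebraMap V E π} ≤ maximalIdeal E := (Ideal.span_singleton_le_iff_mem _).2 hπE
  have hlocal : IsLocalRing Q := by
    have : Nontrivial Q := Ideal.Quotient.nontrivial_iff.2 fun h =>
      (maximalIdeal.isMaximal E).ne_top (top_le_iff.1 (h ▸ hπle))
    exact IsLocalRing.of_surjective' (Ideal.Quotient.mk _) Ideal.Quotient.mk_surjective
  let mkQ : E →+* Q := Ideal.Quotient.mk (Ideal.span {algebraMap V E π})
  have hmkQ : Function.Surjective mkQ := Ideal.Quotient.mk_surjective
  have hlh : IsLocalHom mkQ := IsLocalHom.of_surjective _ hmkQ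
  obtain ⟨s, hs, ⟨N, hN⟩, hcard⟩ := exists_pow_maximalIdeal_le_span_card_eq_ringKrullDim Q
  let g : Q → E := Function.surjInv hmkQ
  have hg : ∀ z, mkQ (g z) = z := Function.surjInv_eq hmkQ
  let y : Fin s.card → E := fun i => g (s.equivFin.symm i)
  have hrange : mkQ '' Set.range y = (s : Set Q) := by
    ext z
    constructor
    · rintro ⟨_, ⟨i, rfl⟩, rfl⟩
      change mkQ (g _) ∈ _
      rw [hg]
      exact (s.equivFin.symm i).2
    · intro hz
      refine ⟨_, ⟨s.equivFin ⟨z, hz⟩, rfl⟩, ?_⟩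
      change mkQ (g _) = _
      rw [hg]
      simp
  have hy : ∀ i, y i ∈ maximalIdeal E := by
    intro i
    rw [mem_maximalIdeal, mem_nonunits_iff]
    intro h
    have h1 : mkQ (y i) ∈ maximalIdeal Q := hs (Ideal.subset_span (hrange ▸ ⟨y i, ⟨i, rfl⟩, rfl⟩))
    exact (mem_maximalIdeal _).1 h1 (h.map mkQ)
  have hNE : maximalIdeal E ^ N ≤ (maximalIdeal V).map (algebraMap V E) ⊔ Ideal.span (Set.range y) := by
    intro x hx
    have h1 : mkQ x ∈ maximalIdeal Q ^ N := by
      have := Ideal.mem_map_of_mem mkQ hx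
      rw [Ideal.map_pow] at this
      exact Ideal.pow_right_mono (((IsLocalRing.local_hom_TFAE mkQ).out 0 2).1 hlh) N this
    have h2 := hN h1
    rw [← hrange, ← Ideal.map_span] at h2
    obtain ⟨z, hz, hzx⟩ := (Ideal.mem_map_iff_of_surjective mkQ hmkQ).1 h2
    have h3 : x - z ∈ Ideal.span {algebraMap V E π} := Ideal.Quotient.eq.1 hzx.symm
    rw [hm, ← sub_add_cancel x z]
    exact Submodule.add_mem_sup h3 hz
  obtain ⟨φ, hC, hX, hfin⟩ := exists_mvPowerSeries_finite (hm ▸ hπle) hsurj s.card y hy hNE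
  refine ⟨s.card, φ, ?_, hfin⟩
  by_contra hker
  rw [injective_iff_map_eq_zero] at hker
  push Not at hker
  obtain ⟨f, hf0, hf⟩ := hker
  -- the quotient of the power series ring by the kernel
  let P := MvPowerSeries (Fin s.card) V
  have hPdom : IsDomain P := NoZeroDivisors.to_isDomain _
  let P' := P ⧸ RingHom.ker φ
  have hP' : IsLocalRing P' := by
    have : Nontrivial P' := Ideal.Quotient.nontrivial_iff.2 (RingHom.ker_ne_top φ)
    exact IsLocalRing.of_surjective' (Ideal.Quotient.mk _) Ideal.Quotient.mk_surjective
  have hdimP' : ringKrullDim P' + 1 ≤ ringKrullDim V + s.card := by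
    refine le_trans ?_ (ringKrullDim_mvPowerSeries_le V s.card)
    refine le_trans ?_ (ringKrullDim_quotient_succ_le_of_nonZeroDivisor (mem_nonZeroDivisors_of_ne_zero hf))
    gcongr
    exact ringKrullDim_le_of_surjective (Ideal.Quotient.factor ((Ideal.span_singleton_le_iff_mem _).2 hf0))
      (Ideal.Quotient.factor_surjective _)
  have hdimE : ringKrullDim V + s.card ≤ ringKrullDim E := by
    rw [hcard]
    by_cases hπ0 : π = 0
    · have h0 : ringKrullDim V ≤ 0 := by
        have := ringKrullDim_le_card_of_pow_maximalIdeal_le (Q := V) ∅ (by simp) (N := 1) (by simp [hπ, hπ0])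
        simpa using this
      calc ringKrullDim V + ringKrullDim Q ≤ 0 + ringKrullDim Q := by gcongr
        _ = ringKrullDim Q := zero_add _
        _ ≤ ringKrullDim E := ringKrullDim_quotient_le _
    · have h1 : ringKrullDim V ≤ 1 := by
        have := ringKrullDim_le_card_of_pow_maximalIdeal_le (Q := V) {π} (by simp [hπ]) (N := 1) (by simp [hπ])
        simpa using this
      calc ringKrullDim V + ringKrullDim Q ≤ 1 + ringKrullDim Q := by gcongr
        _ = ringKrullDim Q + 1 := add_comm _ _
        _ ≤ ringKrullDim E := ringKrullDim_quotient_succ_le_of_nonZeroDivisor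
          (mem_nonZeroDivisors_of_ne_zero ((map_ne_zero_iff _ hinj).2 hπ0))
  obtain ⟨t, ht, ⟨M, hM⟩, htc⟩ := exists_pow_maximalIdeal_le_span_card_eq_ringKrullDim P'
  have hle : ringKrullDim E ≤ t.card := by
    let ψ : P' →+* E := RingHom.kerLift φ
    have hψ : ∀ x, ψ (Ideal.Quotient.mk _ x) = φ x := fun x => RingHom.kerLift_mk φ x
    have hψinj : Function.Injective ψ := RingHom.kerLift_injective φ
    have hψint : ψ.IsIntegral := by
      intro x
      obtain ⟨p, hp, hp0⟩ := hfin.to_isIntegral x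
      refine ⟨p.map (Ideal.Quotient.mk _), hp.map _, ?_⟩
      rw [Polynomial.eval₂_map]
      exact hp0
    have hψloc : IsLocalHom ψ := hψint.isLocalHom hψinj
    have hψm : (maximalIdeal P').map ψ ≤ maximalIdeal E := ((IsLocalRing.local_hom_TFAE ψ).out 0 2).1 hψloc
    have hmem : ∀ x : P', ψ x ∈ maximalIdeal E → x ∈ maximalIdeal P' := fun x hx => by
      rw [mem_maximalIdeal, mem_nonunits_iff]
      exact fun h => (mem_maximalIdeal _).1 hx (h.map ψ)
    have hN' : maximalIdeal E ^ N ≤ (maximalIdeal P').map ψ := by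
      refine hNE.trans (sup_le ?_ ?_)
      · rw [hm, Ideal.span_singleton_le_iff_mem, ← hC, ← hψ]
        refine Ideal.mem_map_of_mem _ (hmem _ ?_)
        rwa [hψ, hC]
      · rw [Ideal.span_le]
        rintro _ ⟨i, rfl⟩
        rw [← hX, ← hψ]
        refine Ideal.mem_map_of_mem _ (hmem _ ?_)
        rw [hψ, hX]
        exact hy i
    have ht' : Ideal.span ((t.image ψ : Finset E) : Set E) = (Ideal.span (t : Set P')).map ψ := by
      rw [Ideal.map_span, Finset.coe_image]
    have := ringKrullDim_le_card_of_pow_maximalIdeal_le (t.image ψ)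
      (ht' ▸ (Ideal.map_mono ht).trans hψm) (N := N * M) (by
        rw [ht', pow_mul]
        refine (Ideal.pow_right_mono hN' M).trans ?_
        rw [← Ideal.map_pow]
        exact Ideal.map_mono hM)
    refine this.trans ?_
    exact_mod_cast Finset.card_image_le
  rw [← htc] at hdimP'
  have := hdimP'.trans (hdimE.trans hle)
  have h3 : ((t.card + 1 : ℕ) : WithBot ℕ∞) ≤ (t.card : ℕ) := by
    push_cast
    exact this
  have h4 : t.card + 1 ≤ t.card := by exact_mod_cast h3
  omega

end

end

section

/-- Every fraction `a / b` almost integral over the domain `S` lies in `S`. -/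
def IsAlmostIntegrallyClosed (S : Type) [CommRing S] : Prop :=
  ∀ a b c : S, c ≠ 0 → (∀ n, b ^ n ∣ c * a ^ n) → b ∣ a

namespace IsAlmostIntegrallyClosed

variable {S : Type} [CommRing S]

theorem of_isIntegrallyClosed [IsDomain S] [IsNoetherianRing S] [IsIntegrallyClosed S] :
    IsAlmostIntegrallyClosed S := by
  intro a b c hc h
  by_cases hb : b = 0
  · have := h 1
    rw [hb, pow_one, pow_one, zero_dvd_iff, mul_eq_zero] at this
    rw [hb, this.resolve_left hc]
  let F := FractionRing S
  have hbF : algebraMap S F b ≠ 0 := (map_ne_zero_iff _ (IsFractionRing.injective S F)).2 hb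
  have hai : IsAlmostIntegral S (algebraMap S F a / algebraMap S F b) := by
    refine ⟨c, mem_nonZeroDivisors_of_ne_zero hc, fun n => ?_⟩
    obtain ⟨r, hr⟩ := h n
    refine ⟨r, ?_⟩
    rw [Algebra.smul_def, div_pow, mul_div_assoc', eq_div_iff (pow_ne_zero _ hbF), ← map_pow, ← map_pow, ← map_mul,
      ← map_mul, hr, mul_comm]
  obtain ⟨y, hy⟩ := IsIntegrallyClosed.isIntegral_iff.1 (isAlmostIntegral_iff_isIntegral.1 hai)
  refine ⟨y, IsFractionRing.injective S F ?_⟩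
  rw [map_mul, hy, mul_div_cancel₀ _ hbF]

theorem isIntegrallyClosed [IsDomain S] (h : IsAlmostIntegrallyClosed S) : IsIntegrallyClosed S := by
  refine (isIntegrallyClosed_iff (FractionRing S)).2 fun {x} hx => ?_
  obtain ⟨c, hc, hx⟩ := hx.isAlmostIntegral
  obtain ⟨a, b, hb, rfl⟩ := IsFractionRing.div_surjective S x
  have hbF : algebraMap S (FractionRing S) b ≠ 0 :=
    (map_ne_zero_iff _ (IsFractionRing.injective S _)).2 (nonZeroDivisors.ne_zero hb)
  obtain ⟨y, rfl⟩ := h a b c (nonZeroDivisors.ne_zero hc) fun n => by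
    obtain ⟨r, hr⟩ := hx n
    refine ⟨r, IsFractionRing.injective S (FractionRing S) ?_⟩
    rw [Algebra.smul_def, div_pow, mul_div_assoc', eq_div_iff (pow_ne_zero _ hbF)] at hr
    rw [map_mul, map_mul, map_pow, map_pow, ← hr, mul_comm]
  exact ⟨y, by rw [map_mul, mul_div_cancel_left₀ _ hbF]⟩

theorem of_ringEquiv {T : Type} [CommRing T] (e : S ≃+* T) (h : IsAlmostIntegrallyClosed S) :
    IsAlmostIntegrallyClosed T := by
  intro a b c hc hn
  have := h (e.symm a) (e.symm b) (e.symm c) ((map_ne_zero_iff _ e.symm.injective).2 hc) fun n => by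
    rw [← map_pow, ← map_pow, ← map_mul]
    exact map_dvd e.symm (hn n)
  simpa using map_dvd e this

theorem powerSeries [IsDomain S] [IsNoetherianRing S] (h : IsAlmostIntegrallyClosed S) :
    IsAlmostIntegrallyClosed (PowerSeries S) := by
  have hX : Prime (PowerSeries.X : PowerSeries S) := PowerSeries.X_prime
  -- the main case
  have key : ∀ a b c : PowerSeries S, ¬ PowerSeries.X ∣ b → ¬ PowerSeries.X ∣ c → (∀ n, b ^ n ∣ c * a ^ n) →
      b ∣ a := by
    intro a b c hb hc hn
    have hstep : ∀ a : {a : PowerSeries S // ∀ n, b ^ n ∣ c * a ^ n},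
        ∃ (d : S) (a' : {a : PowerSeries S // ∀ n, b ^ n ∣ c * a ^ n}),
          a.1 = b * PowerSeries.C d + PowerSeries.X * a'.1 := by
      rintro ⟨a, ha⟩
      obtain ⟨d, hd⟩ := h (PowerSeries.constantCoeff a) (PowerSeries.constantCoeff b)
        (PowerSeries.constantCoeff c) (mt PowerSeries.X_dvd_iff.2 hc) fun n => by
          rw [← map_pow, ← map_pow, ← map_mul]
          exact map_dvd _ (ha n)
      obtain ⟨a', ha'⟩ : PowerSeries.X ∣ a - b * PowerSeries.C d := by
        rw [PowerSeries.X_dvd_iff, map_sub, map_mul, PowerSeries.constantCoeff_C, hd, sub_self]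
      refine ⟨d, ⟨a', fun n => ?_⟩, by rw [← ha', add_sub_cancel]⟩
      have h1 : b ^ n ∣ c * (a - b * PowerSeries.C d) ^ n := by
        rw [sub_eq_add_neg, add_pow, Finset.mul_sum]
        refine Finset.dvd_sum fun i hi => ?_
        have hin : i ≤ n := Nat.lt_succ_iff.1 (Finset.mem_range.1 hi)
        obtain ⟨r, hr⟩ := ha i
        refine ⟨r * (-PowerSeries.C d) ^ (n - i) * (n.choose i : PowerSeries S), ?_⟩
        have h2 : b ^ n = b ^ i * b ^ (n - i) := by rw [← pow_add, Nat.add_sub_cancel' hin]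
        rw [h2, ← mul_neg, mul_pow]
        linear_combination (b ^ (n - i) * (-PowerSeries.C d) ^ (n - i) * (n.choose i : PowerSeries S)) * hr
      rw [ha', mul_pow] at h1
      obtain ⟨r, hr⟩ := h1
      have h2 : PowerSeries.X ^ n ∣ b ^ n * r := ⟨c * a' ^ n, by rw [← hr]; ring⟩
      obtain ⟨r', rfl⟩ := hX.pow_dvd_of_dvd_mul_left n (fun h => hb (hX.dvd_of_dvd_pow h)) h2
      refine ⟨r', mul_left_cancel₀ (pow_ne_zero n hX.ne_zero) ?_⟩
      linear_combination hr
    choose d next hnext using hstep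
    let s : ℕ → {a : PowerSeries S // ∀ n, b ^ n ∣ c * a ^ n} := fun n => Nat.rec ⟨a, hn⟩ (fun _ x => next x) n
    have hs : ∀ n, (s n).1 = b * PowerSeries.C (d (s n)) + PowerSeries.X * (s (n + 1)).1 := fun n => hnext (s n)
    let D : ℕ → PowerSeries S := fun n => PowerSeries.mk fun i => d (s (n + i))
    have hD : ∀ n, D n = PowerSeries.C (d (s n)) + PowerSeries.X * D (n + 1) := by
      intro n
      ext m
      cases m with
      | zero => simp [D]
      | succ m =>
        rw [map_add, PowerSeries.coeff_succ_X_mul, PowerSeries.coeff_mk, PowerSeries.coeff_mk,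
          PowerSeries.coeff_C, if_neg (Nat.succ_ne_zero m), zero_add, show n + (m + 1) = n + 1 + m by omega]
    have hsum : ∀ n, a - b * D 0 = PowerSeries.X ^ n * ((s n).1 - b * D n) := by
      intro n
      induction n with
      | zero =>
        rw [pow_zero, one_mul]
        rfl
      | succ n ih =>
        rw [ih, hs n, hD n]
        ring
    refine ⟨D 0, sub_eq_zero.1 ?_⟩
    ext n
    rw [hsum (n + 1), map_zero]
    exact PowerSeries.X_pow_dvd_iff.1 (dvd_mul_right _ _) n (Nat.lt_succ_self n)
  intro a b c hc hn
  by_cases hb : b = 0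
  · have := hn 1
    rw [hb, pow_one, pow_one, zero_dvd_iff, mul_eq_zero] at this
    rw [hb, this.resolve_left hc]
  by_cases ha : a = 0
  · rw [ha]
    exact dvd_zero _
  obtain ⟨β, b', hb', rfl⟩ := WfDvdMonoid.max_power_factor hb hX.irreducible
  obtain ⟨γ, c', hc', rfl⟩ := WfDvdMonoid.max_power_factor hc hX.irreducible
  obtain ⟨α, a', ha', rfl⟩ := WfDvdMonoid.max_power_factor ha hX.irreducible
  have hle : β ≤ α := by
    by_contra! hlt
    have h1 : (PowerSeries.X : PowerSeries S) ^ (β * (γ + 1)) ∣ PowerSeries.X ^ (γ + α * (γ + 1)) * (c' * a' ^ (γ + 1)) := by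
      have := hn (γ + 1)
      rw [mul_pow, ← pow_mul] at this
      refine (dvd_of_mul_right_dvd this).trans (dvd_of_eq ?_)
      rw [mul_pow, ← pow_mul, pow_add]
      ring
    have h2 := hX.pow_dvd_of_dvd_mul_right _ (fun h => (hX.dvd_or_dvd h).elim hc' fun h => ha' (hX.dvd_of_dvd_pow h)) h1
    have h3 := (pow_dvd_pow_iff hX.ne_zero hX.not_isUnit).1 h2
    nlinarith
  obtain ⟨δ, rfl⟩ := Nat.exists_eq_add_of_le hle
  rw [pow_add, mul_assoc]
  refine mul_dvd_mul_left _ (key _ b' c' hb' hc' fun n => ?_)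
  obtain ⟨r, hr⟩ := hn n
  have h1 : b' ^ n * r = PowerSeries.X ^ γ * (c' * (PowerSeries.X ^ δ * a') ^ n) := by
    refine mul_left_cancel₀ (pow_ne_zero n (pow_ne_zero β hX.ne_zero)) ?_
    rw [pow_add, mul_assoc (PowerSeries.X ^ β), mul_pow (PowerSeries.X ^ β), mul_pow (PowerSeries.X ^ β)] at hr
    linear_combination -hr
  obtain ⟨r', rfl⟩ := hX.pow_dvd_of_dvd_mul_left γ (fun h => hb' (hX.dvd_of_dvd_pow h)) ⟨_, h1⟩
  refine ⟨r', mul_left_cancel₀ (pow_ne_zero γ hX.ne_zero) ?_⟩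
  rw [← h1]
  ring

end IsAlmostIntegrallyClosed

theorem MvPowerSeries.isDomain_fin (V : Type) [CommRing V] [IsDomain V] (n : ℕ) : IsDomain (MvPowerSeries (Fin n) V) :=
  NoZeroDivisors.to_isDomain _

theorem IsAlmostIntegrallyClosed.mvPowerSeries {V : Type} [CommRing V] [IsDomain V] [IsNoetherianRing V]
    (h : IsAlmostIntegrallyClosed V) (n : ℕ) : IsAlmostIntegrallyClosed (MvPowerSeries (Fin n) V) := by
  induction n with
  | zero => exact h.of_ringEquiv (MvPowerSeries.isEmptyEquiv (Fin 0) V).toRingEquiv.symm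
  | succ n ih =>
    have := MvPowerSeries.isDomain_fin V n
    exact ih.powerSeries.of_ringEquiv (MvPowerSeries.finSuccEquiv V n).toRingEquiv.symm

end

section

/-- There are enough additive maps `τ : S → S` with `τ (b ^ q * a) = b * τ a`. -/
def HasRootMaps (q : ℕ) (S : Type) [CommRing S] : Prop :=
  ∀ a : S, a ≠ 0 → ∃ τ : S →+ S, (∀ b x, τ (b ^ q * x) = b * τ x) ∧ τ a ≠ 0

namespace HasRootMaps

variable {S : Type} [CommRing S] {p : ℕ}

theorem one : HasRootMaps 1 S := fun a ha => ⟨AddMonoidHom.id S, fun b x => by simp, ha⟩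

theorem pow (h : HasRootMaps p S) (e : ℕ) : HasRootMaps (p ^ e) S := by
  induction e with
  | zero => exact one
  | succ e ih =>
    intro a ha
    obtain ⟨τ, hτ, hτa⟩ := h a ha
    obtain ⟨σ, hσ, hσa⟩ := ih _ hτa
    refine ⟨σ.comp τ, fun b x => ?_, hσa⟩
    rw [AddMonoidHom.comp_apply, AddMonoidHom.comp_apply, pow_succ, pow_mul, hτ, hσ]

theorem of_field (k : Type) [Field k] (p : ℕ) [Fact p.Prime] [CharP k p] : HasRootMaps p k := by
  intro a ha
  let F := (frobenius k p).fieldRange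
  let e : k ≃+* F := (frobenius k p).rangeRestrictFieldEquiv
  have he : ∀ b, ((e b : F) : k) = b ^ p := fun b => rfl
  obtain ⟨g, hg⟩ : ∃ g : Module.Dual F k, g a ≠ 0 := by
    by_contra! h
    exact ha ((Module.forall_dual_apply_eq_zero_iff F a).1 h)
  refine ⟨(e.symm : F →+* k).toAddMonoidHom.comp g.toAddMonoidHom, fun b x => ?_, ?_⟩
  · change e.symm (g (b ^ p * x)) = b * e.symm (g x)
    have : b ^ p * x = e b • x := by
      rw [Subfield.smul_def, he, smul_eq_mul]
    rw [this, map_smul, smul_eq_mul, map_mul, RingEquiv.symm_apply_apply]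
  · change e.symm (g a) ≠ 0
    exact (map_ne_zero_iff _ e.symm.injective).2 hg

theorem of_ringEquiv {T : Type} [CommRing T] (e : S ≃+* T) (h : HasRootMaps p S) : HasRootMaps p T := by
  intro a ha
  obtain ⟨τ, hτ, hτa⟩ := h (e.symm a) ((map_ne_zero_iff _ e.symm.injective).2 ha)
  refine ⟨((e : S →+* T).toAddMonoidHom.comp τ).comp (e.symm : T →+* S).toAddMonoidHom, fun b x => ?_, ?_⟩
  · change e (τ (e.symm (b ^ p * x))) = b * e (τ (e.symm x))
    rw [map_mul, map_pow, hτ, map_mul, RingEquiv.apply_symm_apply]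
  · change e (τ (e.symm a)) ≠ 0
    exact (map_ne_zero_iff _ e.injective).2 hτa

theorem powerSeries [hp : Fact p.Prime] [CharP S p] (h : HasRootMaps p S) : HasRootMaps p (PowerSeries S) := by
  intro f hf
  obtain ⟨m, hm⟩ : ∃ m, PowerSeries.coeff m f ≠ 0 := by
    by_contra! h
    exact hf (PowerSeries.ext h)
  obtain ⟨τ, hτ, hτm⟩ := h _ hm
  have hτ' : ∀ b x, τ (b ^ p * x) = b * τ x := hτ
  let T : PowerSeries S →+ PowerSeries S :=
    { toFun := fun g => PowerSeries.mk fun n => τ (PowerSeries.coeff (p * n + m % p) g)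
      map_zero' := by ext n; simp
      map_add' := fun x y => by ext n; simp }
  have hT : ∀ g n, PowerSeries.coeff n (T g) = τ (PowerSeries.coeff (p * n + m % p) g) :=
    fun g n => PowerSeries.coeff_mk n (fun n => τ (PowerSeries.coeff (p * n + m % p) g))
  have hTC : ∀ (c : S) g, T (PowerSeries.C c ^ p * g) = PowerSeries.C c * T g := by
    intro c g
    ext n
    rw [hT, ← map_pow, PowerSeries.coeff_C_mul, PowerSeries.coeff_C_mul, hT, hτ]
  have hTX : ∀ g, T (PowerSeries.X ^ p * g) = PowerSeries.X * T g := by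
    intro g
    ext n
    rw [hT, PowerSeries.coeff_X_pow_mul']
    cases n with
    | zero =>
      rw [mul_zero, zero_add, if_neg (not_le.2 (Nat.mod_lt _ hp.out.pos)), map_zero, PowerSeries.coeff_zero_X_mul]
    | succ n =>
      rw [PowerSeries.coeff_succ_X_mul, hT, mul_add, mul_one, if_pos (show p ≤ p * n + p + m % p by omega)]
      rw [show p * n + p + m % p - p = p * n + m % p by omega]
  have hchar : CharP (PowerSeries S) p := charP_of_injective_ringHom PowerSeries.C_injective p
  have hTb : ∀ n b g, PowerSeries.X ^ n ∣ T (b ^ p * g) - b * T g := by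
    intro n
    induction n with
    | zero => intro b g; rw [pow_zero]; exact one_dvd _
    | succ n ih =>
      intro b g
      obtain ⟨b', hb'⟩ : PowerSeries.X ∣ b - PowerSeries.C (PowerSeries.constantCoeff b) := by
        rw [PowerSeries.X_dvd_iff]
        simp
      rw [sub_eq_iff_eq_add] at hb'
      obtain ⟨r, hr⟩ := ih b' g
      refine ⟨r, ?_⟩
      rw [hb', add_pow_char, add_mul, map_add, hTC, mul_pow, mul_assoc, hTX]
      rw [pow_succ]
      linear_combination PowerSeries.X * hr
  refine ⟨T, fun b g => sub_eq_zero.1 (PowerSeries.ext fun n => ?_), fun h0 => hτm ?_⟩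
  · rw [map_zero]
    exact PowerSeries.X_pow_dvd_iff.1 (hTb (n + 1) b g) n (Nat.lt_succ_self n)
  · have := hT f (m / p)
    rw [h0, map_zero, Nat.div_add_mod] at this
    exact this.symm

theorem mvPowerSeries (h : HasRootMaps p S) [Fact p.Prime] [CharP S p] (n : ℕ) :
    HasRootMaps p (MvPowerSeries (Fin n) S) := by
  induction n with
  | zero => exact h.of_ringEquiv (MvPowerSeries.isEmptyEquiv (Fin 0) S).toRingEquiv.symm
  | succ n ih =>
    have : CharP (MvPowerSeries (Fin n) S) p := charP_of_injective_ringHom (MvPowerSeries.C_injective (σ := Fin n)) p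
    exact ih.powerSeries.of_ringEquiv (MvPowerSeries.finSuccEquiv S n).toRingEquiv.symm

end HasRootMaps

end

theorem exists_trace_pow_ne_zero (F M : Type) [Field F] [Field M] [Algebra F M] [FiniteDimensional F M]
    [Algebra.IsSeparable F M] (q e : ℕ) [ExpChar F q] : ∃ x : M, Algebra.trace F M (x ^ q ^ e) ≠ 0 := by
  by_contra! h
  have hs : Submodule.span F (Set.range (id : M → M)) = ⊤ := by
    rw [Set.range_id, Submodule.span_univ]
  have := Field.span_map_pow_expChar_pow_eq_top_of_isSeparable q e hs
  refine Algebra.trace_ne_zero F M (LinearMap.ext_on_range this fun i => ?_)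
  simpa using h i

theorem exists_pow_mem_separableClosure (F L : Type) [Field F] [Field L] [Algebra F L]
    [FiniteDimensional F L] (q : ℕ) [ExpChar F q] :
    ∃ e : ℕ, ∀ x : L, x ^ q ^ e ∈ separableClosure F L := by
  have hx : ExpChar (separableClosure F L) q := expChar_of_injective_algebraMap (algebraMap F _).injective q
  obtain ⟨e, he⟩ := (IsPurelyInseparable.hasExponent_iff' (separableClosure F L) L q).1 inferInstance
  refine ⟨e, fun x => ?_⟩
  obtain ⟨y, hy⟩ := he x
  rw [← hy]
  exact y.2

theorem exists_forall_isIntegral_mul_mem {P E F L : Type} [CommRing P] [IsDomain P] [IsNoetherianRing P]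
    [IsIntegrallyClosed P] [CommRing E] [IsDomain E] [Algebra P E] [Module.Finite P E] [Field F] [Field L]
    [Algebra P F] [IsFractionRing P F] [Algebra E L] [IsFractionRing E L] [Algebra F L]
    [Algebra P L] [IsScalarTower P F L] [IsScalarTower P E L] [FaithfulSMul P E] [FiniteDimensional F L]
    (q : ℕ) [ExpChar F q] (hq : HasRootMaps q P) :
    ∃ δ : E, δ ≠ 0 ∧ ∀ x : L, IsIntegral P x → ∃ y : E, algebraMap E L y = algebraMap E L δ * x := by
  obtain ⟨e, he⟩ := exists_pow_mem_separableClosure F L q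
  have hcL : ExpChar L q := expChar_of_injective_algebraMap (algebraMap F L).injective q
  let M := separableClosure F L
  let fr : L →+ M :=
    { toFun := fun x => ⟨x ^ q ^ e, he x⟩
      map_zero' := Subtype.ext (zero_pow (pow_ne_zero _ (expChar_pos F q).ne'))
      map_add' := fun x y => Subtype.ext (add_pow_expChar_pow x y q e) }
  have hfr : ∀ x, ((fr x : M) : L) = x ^ q ^ e := fun x => rfl
  have : IsScalarTower P M L := IsScalarTower.of_algebraMap_eq fun r =>
    (IsScalarTower.algebraMap_apply P F L r).trans (by rw [IsScalarTower.algebraMap_apply P F M]; rfl)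
  have hfint : ∀ x : integralClosure P L, ∃ a : P, algebraMap P F a = Algebra.trace F M (fr x) := by
    intro x
    refine IsIntegrallyClosed.isIntegral_iff.1 (Algebra.isIntegral_trace ?_)
    have h1 : IsIntegral P (algebraMap M L (fr x)) := IsIntegral.pow x.2 (q ^ e)
    exact (isIntegral_algebraMap_iff (algebraMap M L).injective).1 h1
  choose tr htr using hfint
  have hinjF : Function.Injective (algebraMap P F) := IsFractionRing.injective P F
  have hfrs : ∀ (s : P) (x : L), fr (algebraMap P L s * x) = (algebraMap P F s) ^ q ^ e • fr x := by
    intro s x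
    refine Subtype.ext ?_
    rw [hfr, mul_pow, IsScalarTower.algebraMap_apply P F L]
    change _ = ((algebraMap P F s) ^ q ^ e) • ((fr x : M) : L)
    rw [Algebra.smul_def, map_pow, hfr]
  have htr_add : ∀ x y, tr (x + y) = tr x + tr y := by
    intro x y
    apply hinjF
    rw [map_add, htr, htr, htr, ← map_add, ← map_add]
    rfl
  have htr_smul : ∀ (s : P) x, tr (s • x) = s ^ q ^ e * tr x := by
    intro s x
    apply hinjF
    rw [map_mul, map_pow, htr, htr, ← smul_eq_mul, ← map_smul, ← hfrs, ← Algebra.smul_def]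
    rfl
  have hfrac : ∀ x : L, ∃ s : P, s ≠ 0 ∧ ∃ u : E, algebraMap P L s * x = algebraMap E L u := by
    intro x
    obtain ⟨a, b, hb, rfl⟩ := IsFractionRing.div_surjective (A := E) x
    obtain ⟨c, s, hs, h⟩ := Algebra.IsAlgebraic.exists_smul_eq_mul P a (nonZeroDivisors.ne_zero hb)
    refine ⟨s, hs, c, ?_⟩
    have hb' : algebraMap E L b ≠ 0 := (map_ne_zero_iff _ (IsFractionRing.injective E L)).2 (nonZeroDivisors.ne_zero hb)
    have := congrArg (algebraMap E L) h
    rw [Algebra.smul_def, map_mul, map_mul, ← IsScalarTower.algebraMap_apply] at this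
    rw [← mul_div_assoc, this, mul_div_cancel_left₀ _ hb']
  have hEint : ∀ y : E, IsIntegral P (algebraMap E L y) := fun y =>
    (Algebra.IsIntegral.isIntegral y).map (IsScalarTower.toAlgHom P E L)
  obtain ⟨x1, hx1⟩ := exists_trace_pow_ne_zero F M q e
  obtain ⟨s1, hs1, u, hu⟩ := hfrac x1
  let ι : E → integralClosure P L := fun y => ⟨algebraMap E L y, hEint y⟩
  have hu0 : tr (ι u) ≠ 0 := by
    rw [← map_ne_zero_iff _ hinjF, htr]
    change Algebra.trace F M (fr (algebraMap E L u)) ≠ 0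
    rw [← hu, hfrs, map_smul, smul_eq_mul]
    refine mul_ne_zero (pow_ne_zero _ ((map_ne_zero_iff _ hinjF).2 hs1)) ?_
    have : fr x1 = x1 ^ q ^ e := Subtype.ext rfl
    rwa [this]
  obtain ⟨τ, hτ, hτu⟩ := hq.pow e _ hu0
  let lam : integralClosure P L →ₗ[P] P :=
    { toFun := fun x => τ (tr x)
      map_add' := fun x y => by rw [htr_add, map_add]
      map_smul' := fun s x => by rw [htr_smul, hτ]; rfl }
  let Lam : integralClosure P L →ₗ[P] E →ₗ[P] P := LinearMap.mk₂ P (fun x y => lam (x * ι y))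
    (fun x x' y => by rw [add_mul, map_add]) (fun s x y => by rw [smul_mul_assoc, map_smul])
    (fun x y y' => by
      rw [← map_add, ← mul_add]; congr 2; exact Subtype.ext (map_add (algebraMap E L) y y'))
    (fun s x y => by
      rw [← map_smul, ← mul_smul_comm]; congr 2
      refine Subtype.ext ?_
      change algebraMap E L (s • y) = s • algebraMap E L y
      rw [Algebra.smul_def, map_mul, ← IsScalarTower.algebraMap_apply, Algebra.smul_def])
  have hLam : Function.Injective Lam := by
    rw [injective_iff_map_eq_zero]
    intro x hx
    by_contra hx0
    have hx0' : (x : L) ≠ 0 := fun h => hx0 (Subtype.ext h)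
    obtain ⟨s, hs, y, hy⟩ := hfrac (algebraMap E L u / x)
    have h1 : x * ι y = s • ι u := by
      refine Subtype.ext ?_
      change (x : L) * algebraMap E L y = s • algebraMap E L u
      rw [← hy, Algebra.smul_def]
      field_simp
    have h2 : lam (x * ι y) = 0 := congrArg (fun f => f y) hx
    rw [h1, map_smul, smul_eq_mul] at h2
    exact (mul_ne_zero hs hτu) h2
  have hfin : Module.Finite P (integralClosure P L) := Module.Finite.of_injective Lam hLam
  obtain ⟨T, hT⟩ := hfin.fg_top
  classical
  obtain ⟨b, hb⟩ := IsLocalization.exist_integer_multiples_of_finset (nonZeroDivisors E)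
    (T.image (fun x : integralClosure P L => (x : L)))
  refine ⟨b, nonZeroDivisors.ne_zero b.2, fun x hx => ?_⟩
  have hx' : (⟨x, hx⟩ : integralClosure P L) ∈ Submodule.span P (T : Set (integralClosure P L)) := hT ▸ Submodule.mem_top
  have key : ∀ z ∈ Submodule.span P (T : Set (integralClosure P L)), ∃ y : E, algebraMap E L y = algebraMap E L b * z := by
    intro z hz
    induction hz using Submodule.span_induction with
    | mem z hz =>
      obtain ⟨y, hy⟩ := hb z (Finset.mem_image_of_mem _ hz)
      exact ⟨y, by rw [hy, Algebra.smul_def]⟩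
    | zero => exact ⟨0, by rw [map_zero]; exact (mul_zero _).symm⟩
    | add z w _ _ hz hw =>
      obtain ⟨y, hy⟩ := hz
      obtain ⟨y', hy'⟩ := hw
      exact ⟨y + y', by rw [map_add, hy, hy', ← mul_add]; rfl⟩
    | smul s z _ hz =>
      obtain ⟨y, hy⟩ := hz
      refine ⟨s • y, ?_⟩
      change _ = algebraMap E L b * (s • (z : L))
      rw [Algebra.smul_def, map_mul, hy, ← IsScalarTower.algebraMap_apply, Algebra.smul_def]
      ring
  exact key _ hx'

theorem HasRootMaps.of_isField {k : Type} [CommRing k] (hk : IsField k) (p : ℕ) [Fact p.Prime] [CharP k p] :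
    HasRootMaps p k := by
  let := hk.toField
  exact HasRootMaps.of_field k p

theorem exists_forall_isIntegral_mul_mem_of_finite {P E : Type} [CommRing P] [IsDomain P] [IsNoetherianRing P]
    [IsIntegrallyClosed P] [CommRing E] [IsDomain E] (φ : P →+* E) (hφ : Function.Injective φ) (hfin : φ.Finite)
    (q : ℕ) [ExpChar P q] (hq : HasRootMaps q P) :
    ∃ δ : E, δ ≠ 0 ∧ ∀ x : FractionRing E, IsIntegral E x →
      ∃ y : E, algebraMap E (FractionRing E) y = algebraMap E (FractionRing E) δ * x := by
  let L := FractionRing E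
  let F := FractionRing P
  let : Algebra P E := φ.toAlgebra
  have : FaithfulSMul P E := (faithfulSMul_iff_algebraMap_injective P E).2 hφ
  have : FaithfulSMul P L := (faithfulSMul_iff_algebraMap_injective P L).2 (by
    rw [IsScalarTower.algebraMap_eq P E L, RingHom.coe_comp]
    exact (IsFractionRing.injective E L).comp hφ)
  have : Module.Finite P E := hfin
  let : Algebra F L := FractionRing.liftAlgebra P L
  have : IsScalarTower P F L := FractionRing.isScalarTower_liftAlgebra P L
  have : FiniteDimensional F L := Module.Finite.of_isLocalization P E (nonZeroDivisors P)
  have : ExpChar F q := expChar_of_injective_algebraMap (IsFractionRing.injective P F) q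
  obtain ⟨δ, hδ, h⟩ := exists_forall_isIntegral_mul_mem (E := E) (F := F) (L := L) q hq
  exact ⟨δ, hδ, fun x hx => h x (isIntegral_trans x hx)⟩

theorem exists_forall_isIntegral_mul_mem_of_isAdicComplete (E : Type) [CommRing E] [IsDomain E] [IsLocalRing E]
    [IsNoetherianRing E] [IsAdicComplete (maximalIdeal E) E] :
    ∃ δ : E, δ ≠ 0 ∧ ∀ x : FractionRing E, IsIntegral E x →
      ∃ y : E, algebraMap E (FractionRing E) y = algebraMap E (FractionRing E) δ * x := by
  let q := ringChar (ResidueField E)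
  have hq : CharP (ResidueField E) q := ringChar.charP _
  obtain ⟨V, hVl, hVp, hVm, hVc, hVs⟩ := exists_isPrincipalIdealRing_coefficientRing E q
  have hinj : Function.Injective (algebraMap V E) := Subtype.val_injective
  obtain ⟨n, φ, hφ, hfin⟩ := exists_mvPowerSeries_injective_finite (V := V) (E := E) (q : V) hVm
    (by rw [map_natCast]; exact natCast_mem_maximalIdeal q) hinj hVs
  have hP := MvPowerSeries.isDomain_fin V n
  have hac : IsAlmostIntegrallyClosed (MvPowerSeries (Fin n) V) :=
    (IsAlmostIntegrallyClosed.of_isIntegrallyClosed (S := V)).mvPowerSeries n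
  have := hac.isIntegrallyClosed
  rcases CharP.exists' V with h0 | ⟨p, hp, hpV⟩
  · have : CharZero (MvPowerSeries (Fin n) V) :=
      charZero_of_injective_ringHom (MvPowerSeries.C_injective (σ := Fin n))
    exact exists_forall_isIntegral_mul_mem_of_finite φ hφ hfin 1 HasRootMaps.one
  · have hcE : CharP (ResidueField E) p := by
      refine (CharP.charP_iff_prime_eq_zero hp.out).2 ?_
      have : (p : V) = 0 := CharP.cast_eq_zero V p
      have := congrArg ((residue E).comp (algebraMap V E)) this
      rwa [map_natCast, map_zero] at this
    have hqp : q = p := CharP.eq (ResidueField E) hq hcE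
    have hV : IsField V := by
      refine IsLocalRing.isField_iff_maximalIdeal_eq.2 ?_
      rw [hVm, hqp, CharP.cast_eq_zero, Ideal.span_singleton_eq_bot.2 rfl]
    have hcP : CharP (MvPowerSeries (Fin n) V) p := charP_of_injective_ringHom (MvPowerSeries.C_injective (σ := Fin n)) p
    have : ExpChar (MvPowerSeries (Fin n) V) p := ExpChar.prime hp.out
    exact exists_forall_isIntegral_mul_mem_of_finite φ hφ hfin p ((HasRootMaps.of_isField hV p).mvPowerSeries n)

section

section ReesPowerSeries

variable {E : Type} [CommRing E]

/-- The subring of power series whose `n`-th coefficient lies in `K ^ n`. -/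
def Ideal.reesPowerSeries (K : Ideal E) : Subring (PowerSeries E) where
  carrier := {f | ∀ n, PowerSeries.coeff n f ∈ K ^ n}
  mul_mem' := by
    intro f g hf hg n
    rw [PowerSeries.coeff_mul]
    refine Ideal.sum_mem _ fun x hx => ?_
    rw [← Finset.HasAntidiagonal.mem_antidiagonal.1 hx, pow_add]
    exact Ideal.mul_mem_mul (hf _) (hg _)
  one_mem' := by
    intro n
    rw [PowerSeries.coeff_one]
    split_ifs with h
    · rw [h, pow_zero, Ideal.one_eq_top]; trivial
    · exact zero_mem _
  add_mem' := fun hf hg n => by rw [map_add]; exact add_mem (hf n) (hg n)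
  zero_mem' := fun n => by rw [map_zero]; exact zero_mem _
  neg_mem' := fun hf n => by rw [map_neg]; exact neg_mem (hf n)

namespace Ideal.reesPowerSeries

variable (K : Ideal E)

theorem monomial_mem {n : ℕ} {a : E} (ha : a ∈ K ^ n) : PowerSeries.monomial n a ∈ K.reesPowerSeries := by
  intro m
  rw [PowerSeries.coeff_monomial]
  split_ifs with h
  · rwa [h]
  · exact zero_mem _

/-- The constant coefficient map. -/
def constantCoeff : K.reesPowerSeries →+* E := (PowerSeries.constantCoeff (R := E)).comp K.reesPowerSeries.subtype

/-- The inclusion of constants. -/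
def C : E →+* K.reesPowerSeries :=
  (PowerSeries.C (R := E)).codRestrict K.reesPowerSeries fun a => by
    rw [← PowerSeries.monomial_zero_eq_C_apply]
    exact monomial_mem K (by rw [pow_zero, Ideal.one_eq_top]; trivial)

theorem constantCoeff_C (a : E) : constantCoeff K (C K a) = a := PowerSeries.constantCoeff_C a

theorem mem_span_of_coeff_eq_zero {K : Ideal E} {n : ℕ} (s : Finset E) (hs : Ideal.span (s : Set E) = K ^ n)
    (f : K.reesPowerSeries) (hf : ∀ j < n, PowerSeries.coeff j (f : PowerSeries E) = 0) :
    f ∈ Ideal.span (Set.range fun g : s => (⟨PowerSeries.monomial n (g : E),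
      monomial_mem K (hs ▸ Ideal.subset_span g.2)⟩ : K.reesPowerSeries)) := by
  have key : ∀ j, ∃ b : s → E, (∀ g, b g ∈ K ^ j) ∧ PowerSeries.coeff (j + n) (f : PowerSeries E) = ∑ g, b g * g := by
    intro j
    have h1 : PowerSeries.coeff (j + n) (f : PowerSeries E) ∈ K ^ j • Ideal.span (Set.range fun g : s => (g : E)) := by
      have hr : Set.range (fun g : s => (g : E)) = (s : Set E) := Subtype.range_coe
      rw [hr, hs, smul_eq_mul, ← pow_add]
      exact f.2 _
    obtain ⟨a, ha, h⟩ := (Submodule.mem_ideal_smul_span_iff_exists_sum (K ^ j) (fun g : s => (g : E)) _).1 h1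
    exact ⟨a, ha, h.symm.trans (Finsupp.sum_fintype a (fun i c => c • (i : E)) fun i => zero_smul E _)⟩
  choose b hb hsum using key
  have hfe : f = ∑ g : s, (⟨PowerSeries.mk fun j => b j g, fun j => by
      rw [PowerSeries.coeff_mk]; exact hb j g⟩ : K.reesPowerSeries) *
      ⟨PowerSeries.monomial n (g : E), monomial_mem K (hs ▸ Ideal.subset_span g.2)⟩ := by
    refine Subtype.ext (PowerSeries.ext fun m => ?_)
    rw [AddSubmonoidClass.coe_finsetSum, map_sum]
    simp only [Subring.coe_mul]
    rcases lt_or_ge m n with hm | hm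
    · rw [hf m hm, Finset.sum_eq_zero]
      intro g _
      rw [PowerSeries.monomial_eq_C_mul_X_pow, ← mul_assoc, PowerSeries.coeff_mul_X_pow', if_neg (not_le.2 hm)]
    · obtain ⟨j, rfl⟩ := Nat.exists_eq_add_of_le' hm
      rw [hsum]
      refine Finset.sum_congr rfl fun g _ => ?_
      rw [PowerSeries.monomial_eq_C_mul_X_pow, ← mul_assoc, PowerSeries.coeff_mul_X_pow, PowerSeries.coeff_mul_C, PowerSeries.coeff_mk]
  rw [hfe]
  exact Ideal.sum_mem _ fun g _ => Ideal.mul_mem_left _ _ (Ideal.subset_span ⟨g, rfl⟩)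

variable [IsLocalRing E]

/-- The ideal of series whose constant coefficient lies in the maximal ideal. -/
def maxIdeal : Ideal K.reesPowerSeries := (maximalIdeal E).comap (constantCoeff K)

instance : (maxIdeal K).IsMaximal :=
  Ideal.comap_isMaximal_of_surjective _ fun a => ⟨C K a, constantCoeff_C K a⟩

variable {K}

theorem coeff_mem_of_mem_maxIdeal_pow {n : ℕ} {f : K.reesPowerSeries} (hf : f ∈ maxIdeal K ^ n) (j : ℕ) :
    PowerSeries.coeff j (f : PowerSeries E) ∈ maximalIdeal E ^ (n - j) * K ^ j := by
  induction n generalizing f j with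
  | zero => simpa using f.2 j
  | succ n ih =>
    rw [pow_succ] at hf
    refine Submodule.mul_induction_on hf (fun a ha b hb => ?_) (fun a b ha hb => ?_)
    · rw [Subring.coe_mul, PowerSeries.coeff_mul]
      refine Ideal.sum_mem _ fun x hx => ?_
      have hx := Finset.HasAntidiagonal.mem_antidiagonal.1 hx
      rcases Nat.eq_zero_or_pos x.2 with h0 | h0
      · rw [h0] at hx ⊢
        have h1 := ih ha x.1
        have h2 : PowerSeries.coeff 0 (b : PowerSeries E) ∈ maximalIdeal E := by
          rw [PowerSeries.coeff_zero_eq_constantCoeff_apply]; exact hb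
        have h3 := Ideal.mul_mem_mul h2 h1
        have h4 : x.1 = j := by omega
        rw [← mul_assoc, ← pow_succ', h4] at h3
        have h5 : maximalIdeal E ^ (n - j + 1) ≤ maximalIdeal E ^ (n + 1 - j) := Ideal.pow_le_pow_right (by omega)
        rw [mul_comm (PowerSeries.coeff x.1 (a : PowerSeries E)), h4]
        exact Ideal.mul_mono_left h5 h3
      · have h3 := Ideal.mul_mem_mul (ih ha x.1) (b.2 x.2)
        rw [mul_assoc, ← pow_add, hx] at h3
        have h5 : maximalIdeal E ^ (n - x.1) ≤ maximalIdeal E ^ (n + 1 - j) := Ideal.pow_le_pow_right (by omega)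
        exact Ideal.mul_mono_left h5 h3
    · rw [Subring.coe_add, map_add]; exact add_mem ha hb

theorem monomial_mem_maxIdeal_pow {n : ℕ} {a : E} (ha : a ∈ K ^ n) :
    (⟨PowerSeries.monomial n a, monomial_mem K ha⟩ : K.reesPowerSeries) ∈ maxIdeal K ^ n := by
  have : ∀ a ∈ K ^ n, ∃ z : K.reesPowerSeries, (z : PowerSeries E) = PowerSeries.monomial n a ∧
      z ∈ maxIdeal K ^ n := by
    clear ha a
    induction n with
    | zero => exact fun a ha => ⟨⟨_, monomial_mem K ha⟩, rfl, by rw [pow_zero, Ideal.one_eq_top]; trivial⟩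
    | succ n ih =>
      intro a ha
      rw [pow_succ] at ha
      refine Submodule.mul_induction_on (C := fun a => ∃ z : K.reesPowerSeries, (z : PowerSeries E) =
        PowerSeries.monomial (n + 1) a ∧ z ∈ maxIdeal K ^ (n + 1)) ha (fun x hx y hy => ?_) (fun x y hx hy => ?_)
      · obtain ⟨z, hz, hm⟩ := ih x hx
        have hy1 : PowerSeries.monomial 1 y ∈ K.reesPowerSeries := monomial_mem K (by rwa [pow_one])
        have hy2 : (⟨PowerSeries.monomial 1 y, hy1⟩ : K.reesPowerSeries) ∈ maxIdeal K := by
          change PowerSeries.constantCoeff (PowerSeries.monomial 1 y) ∈ maximalIdeal E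
          rw [← PowerSeries.coeff_zero_eq_constantCoeff_apply, PowerSeries.coeff_monomial, if_neg zero_ne_one]
          exact zero_mem _
        refine ⟨z * ⟨_, hy1⟩, ?_, by rw [pow_succ]; exact Ideal.mul_mem_mul hm hy2⟩
        rw [Subring.coe_mul, hz, PowerSeries.monomial_mul_monomial]
      · obtain ⟨z, hz, hm⟩ := hx
        obtain ⟨z', hz', hm'⟩ := hy
        exact ⟨z + z', by rw [Subring.coe_add, hz, hz', map_add], add_mem hm hm'⟩
  obtain ⟨z, hz, hm⟩ := this a ha
  exact (Subtype.ext hz : z = ⟨PowerSeries.monomial n a, monomial_mem K ha⟩) ▸ hm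

end Ideal.reesPowerSeries

end ReesPowerSeries

end

section

namespace Ideal.reesPowerSeries

variable {E : Type} [CommRing E] [IsLocalRing E] {K : Ideal E}

theorem C_mem_maxIdeal_pow {n : ℕ} {a : E} (ha : a ∈ maximalIdeal E ^ n) : C K a ∈ maxIdeal K ^ n := by
  have h1 : (maximalIdeal E).map (C K) ≤ maxIdeal K := by
    rw [Ideal.map_le_iff_le_comap]
    intro x hx
    change constantCoeff K (C K x) ∈ maximalIdeal E
    rwa [constantCoeff_C]
  have h2 := Ideal.mem_map_of_mem (C K) ha
  rw [Ideal.map_pow] at h2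
  exact Ideal.pow_right_mono h1 n h2

variable [IsNoetherianRing E]

theorem mem_maxIdeal_pow_of_coeff_mem {n : ℕ} {f : K.reesPowerSeries}
    (hf : ∀ j, PowerSeries.coeff j (f : PowerSeries E) ∈ maximalIdeal E ^ (n - j) * K ^ j) : f ∈ maxIdeal K ^ n := by
  have hmon : ∀ j < n, ∀ c ∈ maximalIdeal E ^ (n - j) * K ^ j, ∃ z : K.reesPowerSeries,
      (z : PowerSeries E) = PowerSeries.monomial j c ∧ z ∈ maxIdeal K ^ n := by
    intro j hj c hc
    refine Submodule.mul_induction_on (C := fun c => ∃ z : K.reesPowerSeries,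
      (z : PowerSeries E) = PowerSeries.monomial j c ∧ z ∈ maxIdeal K ^ n) hc (fun x hx y hy => ?_) (fun x y hx hy => ?_)
    · refine ⟨C K x * ⟨_, monomial_mem K hy⟩, ?_, ?_⟩
      · change PowerSeries.C x * PowerSeries.monomial j y = _
        rw [← PowerSeries.monomial_zero_eq_C_apply, PowerSeries.monomial_mul_monomial, zero_add]
      · have := Ideal.mul_mem_mul (C_mem_maxIdeal_pow (K := K) hx) (monomial_mem_maxIdeal_pow hy)
        rwa [← pow_add, Nat.sub_add_cancel hj.le] at this
    · obtain ⟨z, hz, hm⟩ := hx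
      obtain ⟨z', hz', hm'⟩ := hy
      exact ⟨z + z', by rw [Subring.coe_add, hz, hz', map_add], add_mem hm hm'⟩
  have hmon' : ∀ j : Fin n, ∃ z : K.reesPowerSeries,
      (z : PowerSeries E) = PowerSeries.monomial (j : ℕ) (PowerSeries.coeff j (f : PowerSeries E)) ∧ z ∈ maxIdeal K ^ n :=
    fun j => hmon j j.2 _ (hf j)
  choose z hz hzm using hmon'
  obtain ⟨s, hs⟩ := IsNoetherian.noetherian (K ^ n)
  have htail := mem_span_of_coeff_eq_zero s hs (f - ∑ j, z j) fun i hi => by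
    rw [AddSubgroupClass.coe_sub, AddSubmonoidClass.coe_finsetSum, map_sub, map_sum, sub_eq_zero,
      Finset.sum_eq_single ⟨i, hi⟩]
    · rw [hz, PowerSeries.coeff_monomial_same]
    · intro j _ hj
      rw [hz, PowerSeries.coeff_monomial, if_neg]
      exact fun h => hj (Fin.ext h.symm)
    · exact fun h => absurd (Finset.mem_univ _) h
  have h1 : f - ∑ j, z j ∈ maxIdeal K ^ n := by
    refine (Ideal.span_le.2 ?_) htail
    rintro _ ⟨g, rfl⟩
    exact monomial_mem_maxIdeal_pow (hs ▸ Ideal.subset_span g.2)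
  rw [← sub_add_cancel f (∑ j, z j)]
  exact add_mem h1 (Ideal.sum_mem _ fun j _ => hzm j)

theorem fg_maxIdeal (K : Ideal E) : (maxIdeal K).FG := by
  obtain ⟨s, hs⟩ := IsNoetherian.noetherian (K ^ 1)
  let J := Ideal.span (Set.range fun g : s => (⟨PowerSeries.monomial 1 (g : E),
      monomial_mem K (hs ▸ Ideal.subset_span g.2)⟩ : K.reesPowerSeries))
  have hJ : J ≤ maxIdeal K := by
    refine Ideal.span_le.2 ?_
    rintro _ ⟨g, rfl⟩
    have := monomial_mem_maxIdeal_pow (K := K) (n := 1) (a := (g : E)) (hs ▸ Ideal.subset_span g.2)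
    rwa [pow_one] at this
  have hC : (maximalIdeal E).map (C K) ≤ maxIdeal K := by
    rw [Ideal.map_le_iff_le_comap]
    intro x hx
    have := C_mem_maxIdeal_pow (K := K) (n := 1) (a := x) (by rwa [pow_one])
    rwa [pow_one] at this
  have : maxIdeal K = (maximalIdeal E).map (C K) ⊔ J := by
    refine le_antisymm (fun f hf => ?_) (sup_le hC hJ)
    rw [← add_sub_cancel (C K (constantCoeff K f)) f]
    refine Submodule.add_mem_sup (Ideal.mem_map_of_mem _ hf) (mem_span_of_coeff_eq_zero s hs _ fun j hj => ?_)
    obtain rfl : j = 0 := by omega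
    rw [PowerSeries.coeff_zero_eq_constantCoeff_apply]
    change constantCoeff K (f - C K (constantCoeff K f)) = 0
    rw [map_sub, constantCoeff_C, sub_self]
  rw [this]
  exact Submodule.FG.sup (Ideal.FG.map (IsNoetherian.noetherian (maximalIdeal E)) (C K)) (Submodule.fg_span (Set.finite_range (ι := s) _))

theorem isAdicComplete_maxIdeal [IsAdicComplete (maximalIdeal E) E] {N : ℕ} (hN : maximalIdeal E ^ N ≤ K) :
    IsAdicComplete (maxIdeal K) K.reesPowerSeries := by
  refine isAdicComplete_of_forall (fun f hf => ?_) (fun f hf => ?_)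
  · refine Subtype.ext (PowerSeries.ext fun j => ?_)
    refine IsHausdorff.eq_zero_of_forall_mem_pow (I := maximalIdeal E) fun n => ?_
    have := coeff_mem_of_mem_maxIdeal_pow (hf (n + j)) j
    rw [Nat.add_sub_cancel] at this
    exact Ideal.mul_le_left (I := maximalIdeal E ^ n) (J := K ^ j) this
  · have hc : ∀ j a b, a ≤ b → PowerSeries.coeff j ((f b : K.reesPowerSeries) : PowerSeries E) -
        PowerSeries.coeff j ((f a : K.reesPowerSeries) : PowerSeries E) ∈ maximalIdeal E ^ (a - j) * K ^ j := by
      intro j a b hab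
      rw [← map_sub]
      exact coeff_mem_of_mem_maxIdeal_pow (hf a b hab) j
    have hlim : ∀ j, ∃ L : E, ∀ n, PowerSeries.coeff j ((f n : K.reesPowerSeries) : PowerSeries E) - L ∈
        maximalIdeal E ^ (n - j) * K ^ j := by
      intro j
      obtain ⟨L, hL⟩ := IsPrecomplete.exists_limit (I := maximalIdeal E)
        (fun n => PowerSeries.coeff j ((f (n + j) : K.reesPowerSeries) : PowerSeries E)) fun n => by
          have := hc j (n + j) (n + 1 + j) (by omega)
          rw [Nat.add_sub_cancel] at this
          exact Ideal.mul_le_left (I := maximalIdeal E ^ n) (J := K ^ j) this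
      refine ⟨L, fun n => ?_⟩
      have hle : maximalIdeal E ^ (n - j + N * j) ≤ maximalIdeal E ^ (n - j) * K ^ j := by
        rw [pow_add, pow_mul]
        exact Ideal.mul_mono_right (Ideal.pow_right_mono hN j)
      have h1 := hle (Ideal.pow_le_pow_right (show n - j + N * j ≤ n + N * j by omega) (hL (n + N * j)))
      have h2 := hc j n (n + N * j + j) (by omega)
      have := sub_mem h1 h2
      rwa [sub_sub_sub_cancel_left] at this
    choose L hL using hlim
    have hLmem : ∀ j, L j ∈ K ^ j := fun j => by
      have h1 := (f 0).2 j
      have h2 := Ideal.mul_le_right (I := maximalIdeal E ^ (0 - j)) (J := K ^ j) (hL j 0)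
      have := sub_mem h1 h2
      rwa [sub_sub_cancel] at this
    refine ⟨⟨PowerSeries.mk L, fun j => by rw [PowerSeries.coeff_mk]; exact hLmem j⟩, fun n => ?_⟩
    refine mem_maxIdeal_pow_of_coeff_mem fun j => ?_
    rw [AddSubgroupClass.coe_sub, map_sub, PowerSeries.coeff_mk]
    exact hL j n

theorem isNoetherianRing [IsAdicComplete (maximalIdeal E) E] {N : ℕ} (hN : maximalIdeal E ^ N ≤ K) :
    IsNoetherianRing K.reesPowerSeries := by
  have := isAdicComplete_maxIdeal hN
  refine isNoetherianRing_of_isAdicComplete (C K) (maxIdeal K) (fg_maxIdeal K) fun f => ⟨constantCoeff K f, ?_⟩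
  change constantCoeff K (f - C K (constantCoeff K f)) ∈ maximalIdeal E
  rw [map_sub, constantCoeff_C, sub_self]
  exact zero_mem _

end Ideal.reesPowerSeries

end

theorem Ideal.reesPowerSeries.isIntegral_monomial {E : Type} [CommRing E] {K : Ideal E} {n : ℕ} {x : E}
    (hx : x ∈ K.icF n) : IsIntegral K.reesPowerSeries (PowerSeries.monomial n x : PowerSeries E) := by
  rw [Ideal.mem_icF_iff] at hx
  let ψ : E[X] →+* PowerSeries E := Polynomial.coeToPowerSeries.ringHom
  let φ : reesAlgebra K →+* K.reesPowerSeries :=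
    (ψ.comp (reesAlgebra K).toSubring.subtype).codRestrict K.reesPowerSeries fun f n => by
      have : PowerSeries.coeff n ((f : E[X]) : PowerSeries E) = (f : E[X]).coeff n := Polynomial.coeff_coe _ _
      exact this ▸ (mem_reesAlgebra_iff K _).1 f.2 n
  have := hx.map_of_comp_eq φ ψ rfl
  change IsIntegral _ ((monomial n x : E[X]) : PowerSeries E) at this
  rwa [Polynomial.coe_monomial] at this

theorem hasLinearBound_of_isDomain {E : Type} [CommRing E] [IsDomain E] [IsLocalRing E] [IsNoetherianRing E]
    [IsAdicComplete (maximalIdeal E) E] (K : Ideal E) (hN : ∃ N, maximalIdeal E ^ N ≤ K) : K.HasLinearBound := by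
  obtain ⟨N, hN⟩ := hN
  by_cases hK : K = ⊥
  · subst hK
    refine ⟨1, fun n x hx => ?_⟩
    rw [Ideal.mem_icF_iff_isIntegralElemOver] at hx
    obtain ⟨d, c, _, hc, h⟩ := hx
    rw [Finset.sum_eq_zero, add_zero] at h
    · rw [eq_zero_of_pow_eq_zero h]
      exact zero_mem _
    · intro i hi
      have hi1 : i ≠ 0 := by have := (Finset.mem_Icc.1 hi).1; omega
      have := hc i hi
      rw [← pow_mul, ← Ideal.zero_eq_bot, zero_pow (by simp [hi1])] at this
      rw [(Ideal.mem_bot).1 this, zero_mul]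
  obtain ⟨k, hk, hk0⟩ := Submodule.exists_mem_ne_zero_of_ne_bot hK
  let S := K.reesPowerSeries
  have hSc : IsAdicComplete (Ideal.reesPowerSeries.maxIdeal K) S := Ideal.reesPowerSeries.isAdicComplete_maxIdeal hN
  have hSn : IsNoetherianRing S := Ideal.reesPowerSeries.isNoetherianRing hN
  have hSl : IsLocalRing S := isLocalRing_of_isAdicComplete_maximal (Ideal.reesPowerSeries.maxIdeal K)
  have hSm : Ideal.reesPowerSeries.maxIdeal K = maximalIdeal S := IsLocalRing.eq_maximalIdeal inferInstance
  rw [hSm] at hSc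
  obtain ⟨δ, hδ, h⟩ := exists_forall_isIntegral_mul_mem_of_isAdicComplete S
  let L := FractionRing S
  let L' := FractionRing (PowerSeries E)
  have hinj : Function.Injective (algebraMap S L') :=
    (IsFractionRing.injective (PowerSeries E) L').comp Subtype.val_injective
  have : FaithfulSMul S L' := (faithfulSMul_iff_algebraMap_injective S L').2 hinj
  let : Algebra L L' := FractionRing.liftAlgebra S L'
  have : IsScalarTower S L L' := FractionRing.isScalarTower_liftAlgebra S L'
  have key : ∀ n x, x ∈ K.icF n → δ.1 * PowerSeries.monomial n x ∈ S := by
    intro n x hx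
    have hkn : k ^ n ∈ K ^ n := Ideal.pow_mem_pow hk n
    have hkn0 : k ^ n ≠ 0 := pow_ne_zero n hk0
    let u : S := ⟨PowerSeries.monomial n (x * k ^ n), Ideal.reesPowerSeries.monomial_mem K (Ideal.mul_mem_left _ _ hkn)⟩
    let v : S := ⟨PowerSeries.monomial 0 (k ^ n), Ideal.reesPowerSeries.monomial_mem K
      (by rw [pow_zero, Ideal.one_eq_top]; trivial)⟩
    have hv0 : v ≠ 0 := fun h0 => hkn0 (by
      have := congrArg (fun f : S => PowerSeries.coeff 0 (f : PowerSeries E)) h0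
      simpa [v] using this)
    have huv : u.1 = v.1 * PowerSeries.monomial n x := by
      change PowerSeries.monomial n (x * k ^ n) = PowerSeries.monomial 0 (k ^ n) * PowerSeries.monomial n x
      rw [PowerSeries.monomial_mul_monomial, zero_add, mul_comm]
    let z : L := algebraMap S L u / algebraMap S L v
    have hz : algebraMap L L' z = algebraMap (PowerSeries E) L' (PowerSeries.monomial n x) := by
      rw [map_div₀, ← IsScalarTower.algebraMap_apply, ← IsScalarTower.algebraMap_apply, 
        div_eq_iff ((map_ne_zero_iff _ hinj).2 hv0)]
      change algebraMap (PowerSeries E) L' u.1 = _ * algebraMap (PowerSeries E) L' v.1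
      rw [← map_mul, huv, mul_comm]
    have hzi : IsIntegral S z := by
      rw [← isIntegral_algebraMap_iff (algebraMap L L').injective, hz]
      exact (Ideal.reesPowerSeries.isIntegral_monomial hx).algebraMap
    obtain ⟨y, hy⟩ := h z hzi
    have h2 := congrArg (algebraMap L L') hy
    rw [map_mul, hz, ← IsScalarTower.algebraMap_apply, ← IsScalarTower.algebraMap_apply] at h2
    change algebraMap (PowerSeries E) L' y.1 = algebraMap (PowerSeries E) L' δ.1 * _ at h2
    rw [← map_mul] at h2
    rw [← IsFractionRing.injective (PowerSeries E) L' h2]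
    exact y.2
  obtain ⟨j, hj⟩ : ∃ j, PowerSeries.coeff j δ.1 ≠ 0 := by
    by_contra! h0
    exact hδ (Subtype.ext (PowerSeries.ext h0))
  refine Ideal.hasLinearBound_of_mul_mem (mem_nonZeroDivisors_of_ne_zero hj) (c := 0) fun n x hx => ?_
  have := key n x hx (j + n)
  rw [PowerSeries.monomial_eq_C_mul_X_pow, ← mul_assoc, PowerSeries.coeff_mul_X_pow, PowerSeries.coeff_mul_C] at this
  exact Ideal.pow_le_pow_right (Nat.le_add_left n j) this

theorem isAdicComplete_map_quotient_mk {R : Type} [CommRing R] {I : Ideal R} [IsPrecomplete I R] (p : Ideal R)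
    (h0 : ∀ x : R ⧸ p, (∀ n, x ∈ (I.map (Ideal.Quotient.mk p)) ^ n) → x = 0) :
    IsAdicComplete (I.map (Ideal.Quotient.mk p)) (R ⧸ p) := by
  refine isAdicComplete_of_forall h0 fun f hf => ?_
  have hd : ∀ n, ∃ d ∈ I ^ n, Ideal.Quotient.mk p d = f (n + 1) - f n := fun n => by
    have := hf n (n + 1) n.le_succ
    rw [← Ideal.map_pow] at this
    exact (Ideal.mem_map_iff_of_surjective _ Ideal.Quotient.mk_surjective).1 this
  choose d hd hdf using hd
  obtain ⟨g₀, hg₀⟩ := Ideal.Quotient.mk_surjective (f 0)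
  let g : ℕ → R := fun n => g₀ + ∑ i ∈ Finset.range n, d i
  have hg : ∀ n, Ideal.Quotient.mk p (g n) = f n := fun n => by
    induction n with
    | zero => simpa [g] using hg₀
    | succ n ih =>
      have : g (n + 1) = g n + d n := by simp only [g, Finset.sum_range_succ]; ring
      rw [this, map_add, ih, hdf]; ring
  obtain ⟨L, hL⟩ := IsPrecomplete.exists_limit (I := I) g fun n => by
    have : g (n + 1) - g n = d n := by simp only [g, Finset.sum_range_succ]; ring
    exact this ▸ hd n
  refine ⟨Ideal.Quotient.mk p L, fun n => ?_⟩
  rw [← hg, ← map_sub, ← Ideal.map_pow]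
  exact Ideal.mem_map_of_mem _ (hL n)

theorem exists_nonZeroDivisor_sum_of_isReduced (R : Type) [CommRing R] [IsNoetherianRing R] [IsReduced R] :
    ∃ (s : Finset (Ideal R)) (e : Ideal R → R), (∀ p ∈ s, p.IsPrime) ∧
      (∀ p ∈ s, ∀ q ∈ p, e p * q = 0) ∧ ∑ p ∈ s, e p ∈ nonZeroDivisors R := by
  have hfin := minimalPrimes.finite_of_isNoetherianRing R
  let s := hfin.toFinset
  have hs : ∀ p, p ∈ s ↔ p ∈ minimalPrimes R := fun p => by simp [s]
  have hprime : ∀ p ∈ s, p.IsPrime := fun p hp => ((hs p).1 hp).1.1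
  have hzero : ∀ x : R, (∀ p ∈ s, x ∈ p) → x = 0 := fun x hx => by
    have : x ∈ sInf (minimalPrimes R) := Ideal.mem_sInf.2 fun {p} hp => hx p ((hs p).2 hp)
    rw [minimalPrimes, Ideal.sInf_minimalPrimes] at this
    have h := nilradical_eq_zero R
    rw [nilradical] at h
    change x ∈ (⊥ : Ideal R).radical at this
    rw [show (⊥ : Ideal R).radical = 0 from h] at this
    exact this
  have hex : ∀ p ∈ s, ∃ e : R, e ∉ p ∧ ∀ q ∈ s, q ≠ p → e ∈ q := by
    intro p hp
    by_contra! h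
    have hle : (s.erase p).inf id ≤ p := fun e he => by
      by_contra hep
      obtain ⟨q, hq, hqp, heq⟩ := h e hep
      exact heq (Finset.inf_le (f := id) (Finset.mem_erase.2 ⟨hqp, hq⟩) he)
    have := hprime p hp
    obtain ⟨q, hq, hqp⟩ := (Ideal.IsPrime.inf_le' this).1 hle
    rw [Finset.mem_erase] at hq
    exact hq.1 (le_antisymm hqp (((hs p).1 hp).2 ((hs q).1 hq.2).1 hqp))
  choose! e he heq using hex
  refine ⟨s, e, hprime, fun p hp q hq => hzero _ fun p' hp' => ?_, ?_⟩
  · by_cases h : p' = p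
    · exact Ideal.mul_mem_left _ _ (h ▸ hq)
    · exact Ideal.mul_mem_right _ _ (heq p hp p' hp' h)
  · rw [mem_nonZeroDivisors_iff_right]
    intro x hx
    refine hzero x fun p hp => ?_
    have hxp : x * ∑ p ∈ s, e p ∈ p := hx ▸ zero_mem _
    refine ((hprime p hp).mem_or_mem hxp).resolve_right fun hsum => he p hp ?_
    rw [← Finset.add_sum_erase s e hp] at hsum
    refine (Ideal.add_mem_iff_left _ (Ideal.sum_mem _ fun q hq => ?_)).1 hsum
    rw [Finset.mem_erase] at hq
    exact heq q hq.2 p hp (Ne.symm hq.1)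

theorem hasLinearBound_of_isReduced {R : Type} [CommRing R] [IsReduced R] [IsLocalRing R] [IsNoetherianRing R]
    [IsAdicComplete (maximalIdeal R) R] (K : Ideal R) (hN : ∃ N, maximalIdeal R ^ N ≤ K) : K.HasLinearBound := by
  obtain ⟨N, hN⟩ := hN
  obtain ⟨s, e, hs, he, hu⟩ := exists_nonZeroDivisor_sum_of_isReduced R
  have hbound : ∀ p ∈ s, (K.map (Ideal.Quotient.mk p)).HasLinearBound := by
    intro p hp
    have := hs p hp
    have hloc : IsLocalRing (R ⧸ p) := .of_surjective' (Ideal.Quotient.mk p) Ideal.Quotient.mk_surjective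
    have hmax : (maximalIdeal R).map (Ideal.Quotient.mk p) = maximalIdeal (R ⧸ p) := by
      refine IsLocalRing.eq_maximalIdeal ?_
      refine (Ideal.map_eq_top_or_isMaximal_of_surjective _ Ideal.Quotient.mk_surjective inferInstance).resolve_left ?_
      intro h
      obtain ⟨a, ha, ha1⟩ := (Ideal.mem_map_iff_of_surjective _ Ideal.Quotient.mk_surjective).1
        ((Ideal.eq_top_iff_one _).1 h)
      rw [← map_one (Ideal.Quotient.mk p), Ideal.Quotient.eq] at ha1
      exact (Ideal.ne_top_iff_one _).1 (maximalIdeal.isMaximal R).ne_top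
        ((Submodule.sub_mem_iff_right _ ha).1 (le_maximalIdeal this.ne_top ha1))
    have hc : IsAdicComplete (maximalIdeal (R ⧸ p)) (R ⧸ p) := hmax ▸ isAdicComplete_map_quotient_mk p fun x hx =>
      IsHausdorff.eq_zero_of_forall_mem_pow (I := maximalIdeal (R ⧸ p)) (hmax ▸ hx)
    refine hasLinearBound_of_isDomain _ ⟨N, ?_⟩
    rw [← hmax, ← Ideal.map_pow]
    exact Ideal.map_mono hN
  choose! c hc using hbound
  refine Ideal.hasLinearBound_of_mul_mem hu (c := s.sup c) fun n x hx => ?_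
  rw [Finset.sum_mul]
  refine Ideal.sum_mem _ fun p hp => ?_
  have h1 := hc p hp n (Ideal.mem_icF_of_intCl_pow (Ideal.Quotient.mk p)
    (K.icF_anti (Nat.add_le_add_left (Finset.le_sup (f := c) hp) n) hx))
  rw [← Ideal.map_pow] at h1
  obtain ⟨a, ha, hax⟩ := (Ideal.mem_map_iff_of_surjective _ Ideal.Quotient.mk_surjective).1 h1
  have := he p hp _ (Ideal.Quotient.eq.1 hax)
  rw [mul_sub, sub_eq_zero] at this
  exact this ▸ Ideal.mul_mem_left _ _ ha

/-- **Statement 9** (Lemma 2.3 of the paper).  Let `(A,𝔪)` be an analytically unramified,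
formally equidimensional Noetherian local ring with `depth A ≥ 2` and `K` an `𝔪`-primary
ideal.  Then there is a flat local extension `A → A'` with `𝔪A' = 𝔪'` and `y ∈ KA'`
satisfying (1)–(4) above. -/
theorem exists_good_flat_extension [IsLocalRing A] [IsNoetherianRing A]
    (hA : IsAnalyticallyUnramified A) (hEq : IsFormallyEquidimensional A)
    (hdepth : HasDepthGE A 2)
    (K : Ideal A) (hK : K.IsMPrimary) :
    Nonempty (GoodFlatExtension K) := by
  obtain ⟨N, hN⟩ : ∃ N, maximalIdeal A ^ N ≤ K := by
    obtain ⟨N, hN⟩ := Ideal.exists_radical_pow_le_of_fg K (IsNoetherian.noetherian _)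
    rw [hK] at hN
    exact ⟨N, hN⟩
  let R := AdicCompletion (maximalIdeal A) A
  have hRn : IsNoetherianRing R := AdicCompletion.isNoetherianRing A
  have hRr : IsReduced R := hA
  have hRc : IsAdicComplete (maximalIdeal R) R := by
    rw [AdicCompletion.maximalIdeal_eq_map]
    exact AdicCompletion.isAdicComplete_self _ (IsNoetherian.noetherian _)
  exact nonempty_goodFlatExtension_of_hasLinearBound hdepth hK
    (hasLinearBound_of_isReduced _ ⟨N, (AdicCompletion.isGoodExtension A).pow_le hN⟩)
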